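/- arXiv:1712.02688 — 5 statements merged into one kernel-verified Lean document; each statement's English description precedes it below -/
import Mathlib

section
/- Every continuous map ξ : [0,1] → [0,1] satisfying ξ ∘ f = f ∘ ξ, where f is the tent map, is one of the following: either ξ = ξ_t for some natural number t ≥ 1, or ξ is the constant map with value 0, or ξ is the constant map with value 2/3. -/
open Set

/-- The tent map: `f(x) = 2x` for `x ≤ 1/2` and `f(x) = 2 - 2x` for `x ≥ 1/2`. -/
noncomputable def tent (x : ℝ) : ℝ := min (2 * x) (2 - 2 * x)

/-- A unimodal map of `[0,1]`. -/
def IsUnimodal (g : ℝ → ℝ) : Prop :=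
  ContinuousOn g (Icc 0 1) ∧ MapsTo g (Icc 0 1) (Icc 0 1) ∧
  ∃ v ∈ Ioo (0:ℝ) 1, StrictMonoOn g (Icc 0 v) ∧ StrictAntiOn g (Icc v 1) ∧
    g 0 = 0 ∧ g 1 = 0 ∧ g v = 1

/-- `g` is piecewise linear (affine) on `[a,b]`. -/
def IsPLOn (g : ℝ → ℝ) (a b : ℝ) : Prop :=
  ∃ (n : ℕ) (p : ℕ → ℝ), 0 < n ∧ p 0 = a ∧ p n = b ∧
    (∀ i < n, p i < p (i + 1)) ∧
    ∀ i < n, ∃ c d : ℝ, ∀ x ∈ Icc (p i) (p (i + 1)), g x = c * x + d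

/-- A carcass map: a piecewise linear unimodal map. -/
def IsCarcass (g : ℝ → ℝ) : Prop := IsUnimodal g ∧ IsPLOn g 0 1

/-- `g^{-n}(0)`, the set of points of `[0,1]` mapped to `0` by the `n`-th iterate. -/
def preimZero (g : ℝ → ℝ) (n : ℕ) : Set ℝ := {x ∈ Icc (0:ℝ) 1 | g^[n] x = 0}

/-- The complete pre-image of `0` under `g`. -/
def completePreimZero (g : ℝ → ℝ) : Set ℝ := ⋃ n ∈ {n : ℕ | 1 ≤ n}, preimZero g n

/-- A homeomorphism of `[0,1]` onto itself (a continuous bijection of the compact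
interval `[0,1]`, whose inverse is then automatically continuous). -/
def IsHomeoI (h : ℝ → ℝ) : Prop :=
  ContinuousOn h (Icc 0 1) ∧ BijOn h (Icc 0 1) (Icc 0 1)

/-- `h` is a topological conjugacy from the tent map to `g`, i.e. a homeomorphism of
`[0,1]` with `h 0 = 0` and `h ∘ f = g ∘ h`. -/
def ConjTent (g h : ℝ → ℝ) : Prop :=
  IsHomeoI h ∧ h 0 = 0 ∧ ∀ x ∈ Icc (0:ℝ) 1, h (tent x) = g (h x)

/-- A kink of a (piecewise linear) map: an interior point where it is not differentiable. -/
def IsKink (g : ℝ → ℝ) (x : ℝ) : Prop := x ∈ Ioo (0:ℝ) 1 ∧ ¬ DifferentiableAt ℝ g x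

/-- A firm carcass map: a carcass map all of whose kinks are in the complete
pre-image of `0`. -/
def IsFirm (g : ℝ → ℝ) : Prop := IsCarcass g ∧ ∀ x, IsKink g x → x ∈ completePreimZero g

/-- A self-semiconjugation of `g`: a continuous surjective map `ψ : [0,1] → [0,1]`
with `ψ ∘ g = g ∘ ψ`. -/
def IsSelfSemiconj (g ψ : ℝ → ℝ) : Prop :=
  ContinuousOn ψ (Icc 0 1) ∧ MapsTo ψ (Icc 0 1) (Icc 0 1) ∧ SurjOn ψ (Icc 0 1) (Icc 0 1) ∧
  ∀ x ∈ Icc (0:ℝ) 1, ψ (g x) = g (ψ x)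

/-- The map `ξ_t(x) = (1 - (-1)^⌊tx⌋)/2 + (-1)^⌊tx⌋ · {tx}`. -/
noncomputable def xi (t : ℕ) (x : ℝ) : ℝ :=
  (1 - (-1 : ℝ) ^ ⌊(t : ℝ) * x⌋) / 2 + (-1 : ℝ) ^ ⌊(t : ℝ) * x⌋ * Int.fract ((t : ℝ) * x)

/-- `μ` enumerates, for each `n ≥ 1`, the set `g^{-n}(0)` in increasing order as
`μ n 0 < μ n 1 < … < μ n 2^{n-1}`. -/
def IsMuSeq (g : ℝ → ℝ) (μ : ℕ → ℕ → ℝ) : Prop :=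
  ∀ n, 1 ≤ n →
    (∀ k < 2 ^ (n - 1), μ n k < μ n (k + 1)) ∧
    ∀ x, x ∈ preimZero g n ↔ ∃ k ≤ 2 ^ (n - 1), μ n k = x

namespace TentAux

/-- Folding map: distance to the nearest even integer. -/
noncomputable def fold (x : ℝ) : ℝ := Real.arccos (Real.cos (Real.pi * x)) / Real.pi

lemma fold_mem (x : ℝ) : fold x ∈ Icc (0:ℝ) 1 := by
  unfold fold
  constructor
  · exact div_nonneg (Real.arccos_nonneg _) Real.pi_pos.le
  · rw [div_le_one Real.pi_pos]; exact Real.arccos_le_pi _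

lemma cos_fold (x : ℝ) : Real.cos (Real.pi * fold x) = Real.cos (Real.pi * x) := by
  unfold fold
  rw [mul_div_cancel₀ _ Real.pi_ne_zero, Real.cos_arccos (Real.neg_one_le_cos _) (Real.cos_le_one _)]

lemma cos_inj {x y : ℝ} (hx : x ∈ Icc (0:ℝ) 1) (hy : y ∈ Icc (0:ℝ) 1)
    (h : Real.cos (Real.pi * x) = Real.cos (Real.pi * y)) : x = y := by
  have hp := Real.pi_pos
  have := Real.injOn_cos (x₁ := Real.pi * x) (x₂ := Real.pi * y)
    ⟨by nlinarith [hx.1], by nlinarith [hx.2]⟩ ⟨by nlinarith [hy.1], by nlinarith [hy.2]⟩ h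
  exact mul_left_cancel₀ hp.ne' this

lemma fold_id {x : ℝ} (hx : x ∈ Icc (0:ℝ) 1) : fold x = x :=
  cos_inj (fold_mem x) hx (cos_fold x)

lemma fold_congr {x y : ℝ} (h : Real.cos (Real.pi * x) = Real.cos (Real.pi * y)) :
    fold x = fold y := by
  unfold fold; rw [h]

lemma tent_mem {x : ℝ} (hx : x ∈ Icc (0:ℝ) 1) : tent x ∈ Icc (0:ℝ) 1 := by
  obtain ⟨h0, h1⟩ := hx
  unfold tent
  constructor
  · apply le_min <;> linarith
  · rcases le_total x (1/2) with h | h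
    · exact (min_le_left _ _).trans (by linarith)
    · exact (min_le_right _ _).trans (by linarith)

lemma cos_tent (x : ℝ) : Real.cos (Real.pi * tent x) = Real.cos (Real.pi * (2 * x)) := by
  unfold tent
  rcases min_choice (2 * x) (2 - 2 * x) with h | h
  · rw [h]
  · rw [h, show Real.pi * (2 - 2 * x) = 2 * Real.pi - Real.pi * (2 * x) by ring,
      Real.cos_two_pi_sub]

lemma cos_dbl (x : ℝ) : Real.cos (Real.pi * (2 * x)) = 2 * Real.cos (Real.pi * x) ^ 2 - 1 := by
  rw [show Real.pi * (2 * x) = 2 * (Real.pi * x) by ring, Real.cos_two_mul]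

lemma fold_two_mul (x : ℝ) : fold (2 * x) = tent (fold x) := by
  apply cos_inj (fold_mem _) (tent_mem (fold_mem _))
  rw [cos_tent, cos_fold, cos_dbl, cos_dbl, cos_fold]

lemma cos_add_even (x : ℝ) (k : ℤ) :
    Real.cos (Real.pi * (x + 2 * k)) = Real.cos (Real.pi * x) := by
  rw [show Real.pi * (x + 2 * k) = Real.pi * x + k * (2 * Real.pi) by ring,
    Real.cos_add_int_mul_two_pi]

lemma cos_eq_iff {x y : ℝ} (h : Real.cos (Real.pi * x) = Real.cos (Real.pi * y)) :
    ∃ k : ℤ, y = 2 * k + x ∨ y = 2 * k - x := by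
  obtain ⟨k, hk⟩ := Real.cos_eq_cos_iff.1 h
  refine ⟨k, hk.imp (fun h => ?_) (fun h => ?_)⟩ <;>
  · apply mul_left_cancel₀ Real.pi_ne_zero
    rw [h]; ring

lemma xi_mem (t : ℕ) (x : ℝ) : xi t x ∈ Icc (0:ℝ) 1 := by
  unfold xi
  have h0 := Int.fract_nonneg ((t:ℝ) * x)
  have h1 := (Int.fract_lt_one ((t:ℝ) * x)).le
  rcases Int.even_or_odd ⌊(t : ℝ) * x⌋ with h | h
  · rw [h.neg_one_zpow]; constructor <;> linarith
  · rw [h.neg_one_zpow]; constructor <;> linarith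

lemma cos_xi (t : ℕ) (x : ℝ) : Real.cos (Real.pi * xi t x) = Real.cos (Real.pi * (t * x)) := by
  unfold xi
  have hf := Int.floor_add_fract ((t:ℝ) * x)
  rcases Int.even_or_odd' ⌊(t : ℝ) * x⌋ with ⟨k, h | h⟩
  · rw [h] at hf ⊢
    rw [(even_two_mul k).neg_one_zpow, ← cos_add_even _ k]
    congr 2
    push_cast at hf; linarith
  · rw [h] at hf ⊢
    rw [(odd_two_mul_add_one k).neg_one_zpow, ← cos_add_even (t * x) (-(k+1)),
      ← Real.cos_neg, ← mul_neg]
    congr 2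
    push_cast at hf ⊢; linarith

lemma eq_of_dyadic {g h : ℝ → ℝ} (hg : ContinuousOn g (Icc 0 1)) (hh : ContinuousOn h (Icc 0 1))
    (H : ∀ q i : ℕ, i ≤ 2 ^ q → g ((i:ℝ) / 2 ^ q) = h ((i:ℝ) / 2 ^ q)) :
    ∀ x ∈ Icc (0:ℝ) 1, g x = h x := by
  intro x hx
  have hle : ∀ q : ℕ, ⌊x * 2 ^ q⌋₊ ≤ 2 ^ q := by
    intro q
    apply Nat.floor_le_of_le
    push_cast
    have : (0:ℝ) < 2 ^ q := by positivity
    nlinarith [hx.2]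
  have ht : Filter.Tendsto (fun q : ℕ => ((⌊x * 2 ^ q⌋₊ : ℕ) : ℝ) / 2 ^ q) Filter.atTop
      (nhdsWithin x (Icc 0 1)) := by
    apply tendsto_nhdsWithin_iff.2
    constructor
    · exact (tendsto_nat_floor_mul_div_atTop hx.1).comp
        (tendsto_pow_atTop_atTop_of_one_lt (one_lt_two))
    · refine Filter.Eventually.of_forall fun q => ⟨by positivity, ?_⟩
      rw [div_le_one (by positivity)]
      exact_mod_cast hle q
  have h1 := (hg x hx).tendsto.comp ht
  have h2 := (hh x hx).tendsto.comp ht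
  refine tendsto_nhds_unique (h1.congr fun q => ?_) h2
  exact H q _ (hle q)

/-- Existence of a lift. -/
lemma exists_lift (ξ : ℝ → ℝ)
    (hcont : ContinuousOn ξ (Icc 0 1))
    (hcomm : ∀ x ∈ Icc (0:ℝ) 1, ξ (tent x) = tent (ξ x)) (c r : ℝ)
    (hcr : ∀ v, Real.cos (Real.pi * (2 * (c + v))) = Real.cos (Real.pi * (c + r * v)))
    (p : ℕ) (hloc : ∀ y, 0 ≤ y → y ≤ 1 / 2 ^ p → ξ (2 * y) - c = r * (ξ y - c)) :
    ∃ L : ℝ → ℝ, (∀ x, 0 ≤ x → L (2 * x) = r * L x) ∧ ContinuousOn L (Ici 0) ∧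
      ∀ x, 0 ≤ x → Real.cos (Real.pi * (c + L x)) = Real.cos (Real.pi * ξ (fold x)) := by
  set F : ℕ → ℝ → ℝ := fun n x => r ^ (n + p) * (ξ (x / 2 ^ (n + p)) - c) with hF
  have hstep : ∀ n x, 0 ≤ x → x ≤ 2 ^ n → F (n + 1) x = F n x := by
    intro n x h0 hx
    have := hloc (x / 2 ^ (n + 1 + p)) (by positivity) (by
      rw [div_le_div_iff₀ (by positivity) (by positivity), pow_add, pow_succ]
      have : (0:ℝ) < 2 ^ p := by positivity
      have : (0:ℝ) < 2 ^ n := by positivity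
      nlinarith)
    have e : 2 * (x / 2 ^ (n + 1 + p)) = x / 2 ^ (n + p) := by
      rw [show n + 1 + p = (n + p) + 1 by ring, pow_succ]; field_simp
    rw [e] at this
    simp only [hF]
    rw [this]; ring
  have hmono : ∀ n m x, n ≤ m → 0 ≤ x → x ≤ 2 ^ n → F m x = F n x := by
    intro n m x hnm h0 hx
    induction m, hnm using Nat.le_induction with
    | base => rfl
    | succ m hm ih =>
      rw [hstep m x h0 (hx.trans (pow_le_pow_right₀ (by norm_num) hm)), ih]
  have hceil : ∀ x : ℝ, x ≤ 2 ^ ⌈x⌉₊ := by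
    intro x
    refine (Nat.le_ceil x).trans ?_
    exact_mod_cast (Nat.lt_two_pow_self (n := ⌈x⌉₊)).le
  set L : ℝ → ℝ := fun x => F ⌈x⌉₊ x with hL
  have hLF : ∀ n x, 0 ≤ x → x ≤ 2 ^ n → L x = F n x := by
    intro n x h0 hx
    rcases le_total n ⌈x⌉₊ with h | h
    · exact hmono _ _ _ h h0 hx
    · exact (hmono _ _ _ h h0 (hceil x)).symm
  refine ⟨L, ?_, ?_, ?_⟩
  · intro x hx
    rw [hLF (⌈x⌉₊ + 1) (2 * x) (by positivity) (by rw [pow_succ]; linarith [hceil x])]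
    simp only [hL, hF]
    rw [show 2 * x / 2 ^ (⌈x⌉₊ + 1 + p) = x / 2 ^ (⌈x⌉₊ + p) by
      rw [show ⌈x⌉₊ + 1 + p = (⌈x⌉₊ + p) + 1 by ring, pow_succ]; field_simp]
    ring
  · intro x hx
    obtain ⟨n, hn⟩ : ∃ n : ℕ, x < 2 ^ n := pow_unbounded_of_one_lt x (by norm_num)
    have hFc : ContinuousOn (F n) (Icc 0 (2 ^ n)) := by
      simp only [hF]
      apply ContinuousOn.mul continuousOn_const
      apply ContinuousOn.sub _ continuousOn_const
      apply hcont.comp (by fun_prop)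
      intro y hy
      refine ⟨div_nonneg hy.1 (by positivity), ?_⟩
      rw [div_le_one (by positivity)]
      exact hy.2.trans (pow_le_pow_right₀ (by norm_num) (by omega))
    have h1 : ContinuousOn L (Icc 0 (2 ^ n)) := hFc.congr fun y hy => hLF n y hy.1 hy.2
    refine (h1 x ⟨hx, hn.le⟩).mono_of_mem_nhdsWithin ?_
    have : Iio ((2:ℝ)^n) ∈ nhds x := Iio_mem_nhds hn
    filter_upwards [self_mem_nhdsWithin, mem_nhdsWithin_of_mem_nhds this] with y hy hy'
    exact ⟨hy, le_of_lt hy'⟩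
  · have key : ∀ (N : ℕ) (y : ℝ), y ∈ Icc (0:ℝ) 1 →
        Real.cos (Real.pi * (c + r ^ N * (ξ y - c))) = Real.cos (Real.pi * ξ (fold (2 ^ N * y))) := by
      intro N y hy
      induction N with
      | zero => simp [fold_id hy]
      | succ N ih =>
        rw [pow_succ' 2, mul_assoc, fold_two_mul, hcomm _ (fold_mem _), cos_tent, cos_dbl, ← ih,
          ← cos_dbl, hcr]
        congr 2; ring
    intro x hx
    have hx1 : x / 2 ^ (⌈x⌉₊ + p) ∈ Icc (0:ℝ) 1 := by
      refine ⟨by positivity, ?_⟩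
      rw [div_le_one (by positivity)]
      exact (hceil x).trans (pow_le_pow_right₀ (by norm_num) (by omega))
    have := key (⌈x⌉₊ + p) _ hx1
    rw [mul_div_cancel₀ x (by positivity)] at this
    exact this

lemma unif_osc (ξ : ℝ → ℝ) (hcont : ContinuousOn ξ (Icc 0 1)) :
    ∃ δ > 0, ∀ x y : ℝ, |x - y| < δ →
      |Real.cos (Real.pi * ξ (fold x)) - Real.cos (Real.pi * ξ (fold y))| < 2 := by
  set G : ℝ → ℝ := fun u => Real.cos (Real.pi * ξ (Real.arccos u / Real.pi)) with hG
  have hGc : ContinuousOn G (Icc (-1) 1) := by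
    apply Real.continuous_cos.comp_continuousOn
    apply continuousOn_const.mul
    apply hcont.comp (Real.continuous_arccos.div_const _).continuousOn
    intro u _
    exact ⟨div_nonneg (Real.arccos_nonneg _) Real.pi_pos.le,
      (div_le_one Real.pi_pos).2 (Real.arccos_le_pi _)⟩
  have hu := isCompact_Icc.uniformContinuousOn_of_continuous hGc
  obtain ⟨η, hη, H⟩ := Metric.uniformContinuousOn_iff.1 hu 2 (by norm_num)
  refine ⟨η / Real.pi, div_pos hη Real.pi_pos, fun x y hxy => ?_⟩
  have := H (Real.cos (Real.pi * x)) ⟨Real.neg_one_le_cos _, Real.cos_le_one _⟩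
    (Real.cos (Real.pi * y)) ⟨Real.neg_one_le_cos _, Real.cos_le_one _⟩ (by
      rw [Real.dist_eq]
      refine (Real.abs_cos_sub_cos_le _ _).trans_lt ?_
      rw [← mul_sub, abs_mul, abs_of_pos Real.pi_pos]
      rwa [lt_div_iff₀' Real.pi_pos] at hxy)
  rw [Real.dist_eq] at this
  exact this

lemma small_step {L Φ : ℝ → ℝ} {c δ : ℝ} (hL : ContinuousOn L (Ici 0))
    (hΦ : ∀ x, 0 ≤ x → Real.cos (Real.pi * (c + L x)) = Φ x)
    (hδ : ∀ x y : ℝ, |x - y| < δ → |Φ x - Φ y| < 2)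
    {x s : ℝ} (hx : 0 ≤ x) (hs : 0 ≤ s) (hsδ : s < δ) : |L (x + s) - L x| ≤ 2 := by
  by_contra! hcon
  have hiv := intermediate_value_uIcc (a := x) (b := x + s) (f := L)
    (hL.mono (by rw [uIcc_of_le (by linarith)]; exact fun y hy => le_trans hx hy.1))
  rw [uIcc_of_le (show x ≤ x + s by linarith)] at hiv
  obtain ⟨lo, hlo⟩ : ∃ lo, Icc lo (lo + 2) ⊆ uIcc (L x) (L (x + s)) := by
    rcases le_total (L x) (L (x + s)) with h | h
    · rw [abs_of_nonneg (by linarith)] at hcon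
      exact ⟨L x, by rw [uIcc_of_le h]; exact Icc_subset_Icc le_rfl (by linarith)⟩
    · rw [abs_of_nonpos (by linarith)] at hcon
      exact ⟨L (x+s), by rw [uIcc_of_ge h]; exact Icc_subset_Icc le_rfl (by linarith)⟩
  have h1 := Int.le_ceil ((lo + c) / 2)
  have h2 := Int.ceil_lt_add_one ((lo + c) / 2)
  have h3 := Int.le_ceil ((lo + c - 1) / 2)
  have h4 := Int.ceil_lt_add_one ((lo + c - 1) / 2)
  set e := ⌈(lo + c) / 2⌉
  set o := ⌈(lo + c - 1) / 2⌉
  obtain ⟨y1, hy1, hy1'⟩ := hiv (hlo (show 2 * (e:ℝ) - c ∈ _ from ⟨by linarith, by linarith⟩))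
  obtain ⟨y2, hy2, hy2'⟩ := hiv (hlo (show 2 * (o:ℝ) + 1 - c ∈ _ from ⟨by linarith, by linarith⟩))
  have f1 := hΦ y1 (hx.trans hy1.1)
  have f2 := hΦ y2 (hx.trans hy2.1)
  rw [hy1', show c + (2 * (e:ℝ) - c) = 0 + 2 * e by ring, cos_add_even, mul_zero,
    Real.cos_zero] at f1
  rw [hy2', show c + (2 * (o:ℝ) + 1 - c) = 1 + 2 * o by ring, cos_add_even, mul_one,
    Real.cos_pi] at f2
  have := hδ y1 y2 (by
    rw [abs_lt]; constructor <;> linarith [hy1.1, hy1.2, hy2.1, hy2.2])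
  rw [← f1, ← f2] at this
  norm_num at this

lemma chain_le {a : ℕ → ℝ} {m : ℝ} (h : ∀ i, |a (i+1) - a i| ≤ m) (i j : ℕ) :
    |a (i + j) - a i| ≤ j * m := by
  induction j with
  | zero => simp
  | succ j ih =>
    have := h (i + j)
    rw [abs_le] at *
    push_cast
    rw [← add_assoc]
    constructor <;> linarith [this.1, this.2, ih.1, ih.2]

lemma big_step {L Φ : ℝ → ℝ} {c δ : ℝ} (hL : ContinuousOn L (Ici 0))
    (hΦ : ∀ x, 0 ≤ x → Real.cos (Real.pi * (c + L x)) = Φ x) (hδ0 : 0 < δ)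
    (hδ : ∀ x y : ℝ, |x - y| < δ → |Φ x - Φ y| < 2) :
    ∃ B : ℝ, ∀ k : ℕ, |L (2 * ((k + 1 : ℕ) : ℝ)) - L (2 * (k : ℝ))| ≤ B := by
  obtain ⟨M, hM⟩ := exists_nat_gt (2 / δ)
  have hM0 : (0:ℝ) < M := lt_trans (by positivity) hM
  have hsδ : 2 / (M:ℝ) < δ := by
    rw [div_lt_iff₀ hδ0] at hM; rw [div_lt_iff₀ hM0]; linarith
  refine ⟨M * 2, fun k => ?_⟩
  have := chain_le (a := fun i : ℕ => L (2 * (k:ℝ) + i * (2 / M))) (m := 2) (fun i => by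
    have := small_step hL hΦ hδ (x := 2 * (k:ℝ) + i * (2 / M)) (s := 2 / M)
      (by positivity) (by positivity) hsδ
    push_cast
    convert this using 4
    ring) 0 M
  simp only [zero_add, Nat.cast_zero, zero_mul, add_zero] at this
  convert this using 4
  push_cast
  field_simp

lemma chain_eq {a : ℕ → ℝ} {m : ℝ} (h : ∀ i, |a (i+1) - a i| ≤ m) (N : ℕ)
    (hN : |a N - a 0| = N * m) :
    ∃ σ : ℝ, (σ = 1 ∨ σ = -1) ∧ ∀ i ≤ N, a i - a 0 = σ * m * i := by
  have key : ∀ i ≤ N, |a i - a 0| ≤ i * m ∧ |a N - a i| ≤ (N - i) * m := by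
    intro i hi
    obtain ⟨j, rfl⟩ := Nat.exists_eq_add_of_le hi
    have h1 := chain_le h 0 i
    have h2 := chain_le h i j
    rw [zero_add] at h1
    refine ⟨h1, ?_⟩
    push_cast
    rwa [add_sub_cancel_left]
  rcases abs_choice (a N - a 0) with hc | hc
  · refine ⟨1, Or.inl rfl, fun i hi => ?_⟩
    obtain ⟨h1, h2⟩ := key i hi
    rw [abs_le] at h1 h2
    rw [hc] at hN
    linarith [h1.1, h1.2, h2.1, h2.2]
  · refine ⟨-1, Or.inr rfl, fun i hi => ?_⟩
    obtain ⟨h1, h2⟩ := key i hi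
    rw [abs_le] at h1 h2
    rw [hc] at hN
    linarith [h1.1, h1.2, h2.1, h2.2]

lemma exists_max {D : ℕ → ℝ} {B : ℝ} (hB : ∀ k, D k ≤ B) (w : ℝ) (hw : 0 < w)
    (hD : ∀ k, ∃ n : ℕ, D k = n * w) : ∃ k0, ∀ k, D k ≤ D k0 := by
  choose n hn using hD
  have hbdd : BddAbove (range n) := by
    refine ⟨⌊B / w⌋₊, ?_⟩
    rintro _ ⟨k, rfl⟩
    apply Nat.le_floor
    rw [le_div_iff₀ hw, ← hn]; exact hB k
  obtain ⟨k0, hk0⟩ := Nat.sSup_mem (range_nonempty n) hbdd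
  refine ⟨k0, fun k => ?_⟩
  rw [hn, hn k0, hk0]
  have : n k ≤ sSup (range n) := le_csSup hbdd ⟨k, rfl⟩
  gcongr

lemma linear_piece {L : ℝ → ℝ} {r m : ℝ} (hr : |r| = 2) (hL : ∀ x, 0 ≤ x → L (2 * x) = r * L x)
    (k0 : ℕ) (hm : |L (2 * ((k0 + 1 : ℕ) : ℝ)) - L (2 * (k0 : ℝ))| = m)
    (hmax : ∀ k : ℕ, |L (2 * ((k + 1 : ℕ) : ℝ)) - L (2 * (k : ℝ))| ≤ m) (q : ℕ) :
    ∃ σ : ℝ, (σ = 1 ∨ σ = -1) ∧ ∀ i : ℕ, i ≤ 2 ^ (q + 1) →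
      L (2 * (k0:ℝ) + i / 2 ^ q) = L (2 * (k0:ℝ)) + σ * m * (i / 2 ^ (q + 1)) := by
  have hpow : ∀ n : ℕ, ∀ x, 0 ≤ x → L (2 ^ n * x) = r ^ n * L x := by
    intro n x hx
    induction n with
    | zero => simp
    | succ n ih => rw [pow_succ', mul_assoc, hL _ (by positivity), ih]; ring
  set n := q + 1 with hn
  have hrn : |r ^ n| = 2 ^ n := by rw [abs_pow, hr]
  have hA : ∀ i : ℕ, L (2 * ((2 ^ n * k0 + i : ℕ) : ℝ)) = r ^ n * L (2 * (k0:ℝ) + i / 2 ^ q) := by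
    intro i
    rw [← hpow n _ (by positivity)]
    congr 1
    push_cast
    rw [hn, pow_succ]
    field_simp
  obtain ⟨σ, hσ, H⟩ := chain_eq (a := fun i : ℕ => L (2 * ((2 ^ n * k0 + i : ℕ) : ℝ))) (m := m)
    (fun i => hmax (2 ^ n * k0 + i)) (2 ^ n) (by
      simp only [hA]
      rw [← mul_sub, abs_mul, hrn, ← hm]
      push_cast
      congr 4
      · rw [hn, pow_succ]; field_simp
      · simp)
  have h0 : (2:ℝ) ^ n ≠ 0 := by positivity
  have hr' : r ^ n = 2 ^ n ∨ r ^ n = -2 ^ n := by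
    rcases abs_choice (r ^ n) with h | h
    · left; linarith
    · right; linarith
  have H' : ∀ i : ℕ, i ≤ 2 ^ n → r ^ n * (L (2 * (k0:ℝ) + i / 2 ^ q) - L (2 * (k0:ℝ))) = σ * m * i := by
    intro i hi
    have := H i hi
    simp only [hA] at this
    simp only [Nat.cast_zero, zero_div, add_zero] at this
    linarith
  rcases hr' with h | h
  · refine ⟨σ, hσ, fun i hi => ?_⟩
    have := H' i hi
    rw [h] at this
    generalize L (2 * (k0:ℝ) + i / 2 ^ q) = X at *
    field_simp
    linarith
  · refine ⟨-σ, by rcases hσ with h | h <;> simp [h], fun i hi => ?_⟩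
    have := H' i hi
    rw [h] at this
    generalize L (2 * (k0:ℝ) + i / 2 ^ q) = X at *
    field_simp
    linarith

lemma core (ξ : ℝ → ℝ)
    (hcont : ContinuousOn ξ (Icc 0 1))
    (hcomm : ∀ x ∈ Icc (0:ℝ) 1, ξ (tent x) = tent (ξ x)) (c r w : ℝ) (hr : |r| = 2) (hw0 : 0 < w)
    (hc : ξ 0 = c)
    (hcr : ∀ v, Real.cos (Real.pi * (2 * (c + v))) = Real.cos (Real.pi * (c + r * v)))
    (hw : ∀ y, Real.cos (Real.pi * (c + y)) = Real.cos (Real.pi * c) → ∃ z : ℤ, y = z * w)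
    (p : ℕ) (hloc : ∀ y, 0 ≤ y → y ≤ 1 / 2 ^ p → ξ (2 * y) - c = r * (ξ y - c)) :
    ∃ (L : ℝ → ℝ) (k0 n : ℕ), (∀ x, 0 ≤ x → L (2 * x) = r * L x) ∧
      (∀ x, 0 ≤ x → Real.cos (Real.pi * (c + L x)) = Real.cos (Real.pi * ξ (fold x))) ∧
      (∀ k : ℕ, ∃ z : ℤ, L (2 * (k:ℝ)) = z * w) ∧
      (∀ k : ℕ, |L (2 * ((k + 1 : ℕ) : ℝ)) - L (2 * (k : ℝ))| ≤ n * w) ∧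
      ∀ q : ℕ, ∃ σ : ℝ, (σ = 1 ∨ σ = -1) ∧ ∀ i : ℕ, i ≤ 2 ^ (q + 1) →
        Real.cos (Real.pi * (c + L (2 * (k0:ℝ)) + σ * (n * w) * (i / 2 ^ (q + 1)))) =
        Real.cos (Real.pi * ξ (fold (i / 2 ^ q))) := by
  obtain ⟨L, hL, hLc, hLΦ⟩ := exists_lift ξ hcont hcomm c r hcr p hloc
  obtain ⟨δ, hδ0, hδ⟩ := unif_osc ξ hcont
  obtain ⟨B, hB⟩ := big_step (Φ := fun x => Real.cos (Real.pi * ξ (fold x))) hLc hLΦ hδ0 hδ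
  have heven : ∀ k : ℕ, ∃ z : ℤ, L (2 * (k:ℝ)) = z * w := by
    intro k
    apply hw
    rw [hLΦ _ (by positivity), fold_congr (y := 0), fold_id (by simp), hc]
    have := cos_add_even 0 k
    simpa using this
  have hD : ∀ k : ℕ, ∃ n : ℕ, |L (2 * ((k + 1 : ℕ) : ℝ)) - L (2 * (k : ℝ))| = n * w := by
    intro k
    obtain ⟨a, ha⟩ := heven k
    obtain ⟨b, hb⟩ := heven (k + 1)
    refine ⟨(b - a).natAbs, ?_⟩
    rw [ha, hb, ← sub_mul, abs_mul, abs_of_pos hw0, Nat.cast_natAbs]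
    push_cast
    rfl
  obtain ⟨k0, hk0⟩ := exists_max hB w hw0 hD
  obtain ⟨n, hn⟩ := hD k0
  refine ⟨L, k0, n, hL, hLΦ, heven, fun k => hn ▸ hk0 k, fun q => ?_⟩
  obtain ⟨σ, hσ, H⟩ := linear_piece hr hL k0 hn (fun k => hn ▸ hk0 k) q
  refine ⟨σ, hσ, fun i hi => ?_⟩
  rw [add_assoc, ← H i hi, hLΦ _ (by positivity)]
  congr 3
  apply fold_congr
  have := cos_add_even ((i:ℝ) / 2 ^ q) k0
  rw [← this]
  congr 2
  push_cast; ring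

lemma near_zero (ξ : ℝ → ℝ) (hcont : ContinuousOn ξ (Icc 0 1)) (U : Set ℝ) (hU : U ∈ nhds (ξ 0)) :
    ∃ p : ℕ, ∀ y, 0 ≤ y → y ≤ 1 / 2 ^ p → y ≤ 1 / 2 ∧ ξ y ∈ U := by
  have h := hcont 0 (by simp) hU
  obtain ⟨δ, hδ, H⟩ := Metric.mem_nhdsWithin_iff.1 (Filter.mem_map.1 h)
  obtain ⟨p, hp⟩ := exists_pow_lt_of_lt_one (lt_min hδ (show (0:ℝ) < 1 / 2 by norm_num))
    (show (1 / 2 : ℝ) < 1 by norm_num)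
  rw [one_div_pow] at hp
  refine ⟨p, fun y h0 hy => ?_⟩
  have h1 := hy.trans_lt hp
  have h2 := h1.trans_le (min_le_left _ _)
  have h3 := h1.trans_le (min_le_right _ _)
  refine ⟨h3.le, H ⟨?_, h0, by linarith⟩⟩
  rw [Metric.mem_ball, Real.dist_eq, sub_zero, abs_of_nonneg h0]
  exact h2

lemma case_zero (ξ : ℝ → ℝ)
    (hcont : ContinuousOn ξ (Icc 0 1)) (hmaps : MapsTo ξ (Icc 0 1) (Icc 0 1))
    (hcomm : ∀ x ∈ Icc (0:ℝ) 1, ξ (tent x) = tent (ξ x)) (hc : ξ 0 = 0) :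
    (∃ t : ℕ, 1 ≤ t ∧ ∀ x ∈ Icc (0:ℝ) 1, ξ x = xi t x) ∨
    (∀ x ∈ Icc (0:ℝ) 1, ξ x = 0) := by
  obtain ⟨p, hp⟩ := near_zero ξ hcont (Iio (1/2)) (by rw [hc]; exact Iio_mem_nhds (by norm_num))
  obtain ⟨L, k0, n, -, -, hz, -, H⟩ := core ξ hcont hcomm 0 2 2 (by norm_num) (by norm_num) hc
    (fun v => by simp) (fun y hy => by
      obtain ⟨k, h | h⟩ := cos_eq_iff hy
      · exact ⟨-k, by push_cast; linarith⟩
      · exact ⟨k, by linarith⟩) p (fun y h0 hy => by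
      obtain ⟨h1, h2⟩ := hp y h0 hy
      have h2 : ξ y < 1 / 2 := h2
      have := hcomm y ⟨h0, by linarith⟩
      unfold tent at this
      rw [min_eq_left (by linarith), min_eq_left (by linarith)] at this
      rw [this]; ring)
  obtain ⟨z, hz⟩ := hz k0
  have key : ∀ x ∈ Icc (0:ℝ) 1, Real.cos (Real.pi * ξ x) = Real.cos (Real.pi * (n * x)) := by
    apply eq_of_dyadic (g := fun x => Real.cos (Real.pi * ξ x))
      (h := fun x => Real.cos (Real.pi * (n * x)))
    · exact Real.continuous_cos.comp_continuousOn (continuousOn_const.mul hcont)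
    · fun_prop
    · intro q i hi
      obtain ⟨σ, hσ, G⟩ := H q
      have g := G i (hi.trans (Nat.pow_le_pow_right (by norm_num) (by omega)))
      rw [fold_id ⟨by positivity, by
        rw [div_le_one (by positivity)]; exact_mod_cast hi⟩, hz] at g
      rw [← g]
      rw [show (0:ℝ) + z * 2 + σ * (n * 2) * (i / 2 ^ (q + 1)) =
        σ * (n * (i / 2 ^ q)) + 2 * z by rw [pow_succ]; field_simp; ring, cos_add_even]
      rcases hσ with rfl | rfl
      · rw [one_mul]
      · rw [neg_one_mul, mul_neg, Real.cos_neg]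
  rcases Nat.eq_zero_or_pos n with rfl | hn
  · right
    intro x hx
    apply cos_inj (hmaps hx) (by simp)
    rw [key x hx]; simp
  · left
    refine ⟨n, hn, fun x hx => cos_inj (hmaps hx) (xi_mem _ _) ?_⟩
    rw [key x hx, cos_xi]

lemma case_two_thirds (ξ : ℝ → ℝ)
    (hcont : ContinuousOn ξ (Icc 0 1)) (hmaps : MapsTo ξ (Icc 0 1) (Icc 0 1))
    (hcomm : ∀ x ∈ Icc (0:ℝ) 1, ξ (tent x) = tent (ξ x)) (hc : ξ 0 = 2 / 3) :
    ∀ x ∈ Icc (0:ℝ) 1, ξ x = 2 / 3 := by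
  obtain ⟨p, hp⟩ := near_zero ξ hcont (Ioi (1/2)) (by rw [hc]; exact Ioi_mem_nhds (by norm_num))
  obtain ⟨L, k0, n, hL, hLΦ, hz, hmax, H⟩ := core ξ hcont hcomm (2/3) (-2) (2/3) (by norm_num)
    (by norm_num) hc
    (fun v => by
      rw [← Real.cos_neg, ← mul_neg, ← cos_add_even _ 1]
      congr 2; push_cast; ring) (fun y hy => by
      obtain ⟨k, h | h⟩ := cos_eq_iff hy
      · exact ⟨-3 * k, by push_cast; linarith⟩
      · exact ⟨3 * k - 2, by push_cast; linarith⟩) p (fun y h0 hy => by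
      obtain ⟨h1, h2⟩ := hp y h0 hy
      have h2 : 1 / 2 < ξ y := h2
      have := hcomm y ⟨h0, by linarith⟩
      unfold tent at this
      rw [min_eq_left (by linarith), min_eq_right (by linarith)] at this
      rw [this]; ring)
  have hn : n = 0 := by
    by_contra hn
    obtain ⟨q, hq⟩ : ∃ q : ℕ, (n:ℝ) < 2 ^ q := pow_unbounded_of_one_lt _ (by norm_num)
    obtain ⟨σ, hσ, G⟩ := H q
    have hq1 : 1 ≤ 2 ^ q := Nat.one_le_two_pow
    have g0 := G (2 ^ q) (by rw [pow_succ]; omega)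
    have g1 := G (2 ^ q + 1) (by rw [pow_succ]; omega)
    have g2 := G (2 ^ q - 1) (by rw [pow_succ]; omega)
    have hpos : (0:ℝ) < 2 ^ q := by positivity
    rw [Nat.cast_pow, Nat.cast_ofNat, div_self hpos.ne', fold_id (by simp)] at g0
    rw [fold_congr (x := ((2 ^ q + 1 : ℕ) : ℝ) / 2 ^ q) (y := ((2 ^ q - 1 : ℕ) : ℝ) / 2 ^ q),
      ← g2] at g1
    swap
    · rw [← Real.cos_neg, ← mul_neg, ← cos_add_even _ 1]
      congr 2
      push_cast [hq1]
      field_simp; ring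
    -- the value at the centre is not a fold point
    have hz1 : ¬ ∃ k : ℤ, 2 / 3 + L (2 * (k0:ℝ)) + σ * (n * (2/3)) * (2 ^ q / 2 ^ (q + 1)) = k := by
      rintro ⟨k, hk⟩
      rw [hk] at g0
      have h1 := hcomm 1 (by simp)
      have h2 : tent 1 = 0 := by unfold tent; norm_num
      rw [h2, hc] at h1
      have h3 := cos_tent (ξ 1)
      rw [← h1, cos_dbl, ← g0] at h3
      have h4 : Real.cos (Real.pi * (k:ℝ)) ^ 2 = 1 := by
        rw [mul_comm, Real.cos_int_mul_pi, ← zpow_natCast, ← zpow_mul, mul_comm, zpow_mul]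
        norm_num
      rw [h4] at h3
      have := cos_inj (x := 2/3) (y := 0) (by norm_num) (by simp) (by rw [h3]; norm_num)
      norm_num at this
    obtain ⟨k, h | h⟩ := cos_eq_iff g1
    · push_cast [hq1] at h
      have h5 : σ * (n * (2/3)) * (1 / 2 ^ q) = -2 * k := by
        rw [pow_succ] at h
        field_simp at h ⊢
        linarith
      have h6 : |σ * (n * (2/3)) * (1 / 2 ^ q)| < 1 := by
        rw [abs_mul, abs_mul, show |σ| = 1 by rcases hσ with h | h <;> simp [h],
          abs_of_nonneg (by positivity), abs_of_nonneg (by positivity), one_mul, mul_one_div,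
          div_lt_one hpos]
        linarith [(Nat.cast_nonneg n : (0:ℝ) ≤ n)]
      have h7 : k = 0 := by
        rw [h5, abs_lt] at h6
        have a1 : (-1 : ℤ) < -2 * k := by exact_mod_cast h6.1
        have a2 : -2 * k < (1 : ℤ) := by exact_mod_cast h6.2
        omega
      rw [h7] at h5
      have : (n:ℝ) ≠ 0 := by exact_mod_cast hn
      have hσ0 : σ ≠ 0 := by rcases hσ with h | h <;> simp [h]
      have : σ * (n * (2/3)) * (1 / 2 ^ q) ≠ 0 := by positivity
      apply this; rw [h5]; simp
    · apply hz1
      refine ⟨k, ?_⟩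
      push_cast [hq1] at h
      rw [pow_succ] at h ⊢
      field_simp at h ⊢
      apply mul_left_cancel₀ hpos.ne'
      linarith
  have hL0 : L 0 = 0 := by
    have := hL 0 le_rfl
    rw [mul_zero] at this; linarith
  have hLk : ∀ k : ℕ, L (2 * (k:ℝ)) = 0 := by
    intro k
    induction k with
    | zero => simpa using hL0
    | succ k ih =>
      have := hmax k
      rw [hn, ih] at this
      simpa using this
  have hLq : ∀ (q i : ℕ), L ((i:ℝ) / 2 ^ q) = 0 := by
    intro q i
    induction q with
    | zero =>
      have := hL i (by positivity)
      rw [hLk i] at this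
      simp only [pow_zero, div_one]; linarith
    | succ q ih =>
      have := hL ((i:ℝ) / 2 ^ (q+1)) (by positivity)
      rw [show 2 * ((i:ℝ) / 2 ^ (q + 1)) = i / 2 ^ q by rw [pow_succ]; field_simp, ih] at this
      linarith
  apply eq_of_dyadic (h := fun _ => 2 / 3) hcont continuousOn_const
  intro q i hi
  have hmem : (i:ℝ) / 2 ^ q ∈ Icc (0:ℝ) 1 := ⟨by positivity, by
        rw [div_le_one (by positivity)]; exact_mod_cast hi⟩
  apply cos_inj (hmaps hmem) (by norm_num)
  have := hLΦ ((i:ℝ) / 2 ^ q) hmem.1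
  rw [hLq, fold_id hmem, add_zero] at this
  exact this.symm

end TentAux

/-- Every continuous map `ξ : [0,1] → [0,1]` commuting with the tent map is
either some `ξ_t` with `t ≥ 1`, or the constant `0`, or the constant `2/3`. -/
theorem semiconj_tent_classification (ξ : ℝ → ℝ)
    (hcont : ContinuousOn ξ (Icc 0 1)) (hmaps : MapsTo ξ (Icc 0 1) (Icc 0 1))
    (hcomm : ∀ x ∈ Icc (0:ℝ) 1, ξ (tent x) = tent (ξ x)) :
    (∃ t : ℕ, 1 ≤ t ∧ ∀ x ∈ Icc (0:ℝ) 1, ξ x = xi t x) ∨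
    (∀ x ∈ Icc (0:ℝ) 1, ξ x = 0) ∨
    (∀ x ∈ Icc (0:ℝ) 1, ξ x = 2 / 3) := by
  have h0 := hcomm 0 (by simp)
  have ht : tent 0 = 0 := by unfold tent; norm_num
  rw [ht] at h0
  unfold tent at h0
  rcases min_choice (2 * ξ 0) (2 - 2 * ξ 0) with h | h
  · rcases TentAux.case_zero ξ hcont hmaps hcomm (by linarith) with h | h
    · exact Or.inl h
    · exact Or.inr (Or.inl h)
  · exact Or.inr (Or.inr (TentAux.case_two_thirds ξ hcont hmaps hcomm (by linarith)))
end

section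
/- Let g be a carcass map which is topologically conjugated to the tent map f via a homeomorphism h : [0,1] → [0,1] with h(0) = 0 and h ∘ f = g ∘ h. If every self-semiconjugation of g is piecewise linear, then h is piecewise linear. -/
open Set

/-- `h` is an affine function of `φ` on `[x,y]`. -/
def AffOn (φ h : ℝ → ℝ) (x y : ℝ) : Prop := ∃ c d : ℝ, ∀ z ∈ Icc x y, h z = c * φ z + d

theorem pl_append {h : ℝ → ℝ} {a x y : ℝ} (H : x = a ∨ IsPLOn h a x) (hxy : x < y)
    (hA : AffOn id h x y) : IsPLOn h a y := by
  obtain ⟨c, d, hcd⟩ := hA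
  rcases H with rfl | ⟨n, p, hn, p0, pn, hp, hq⟩
  · refine ⟨1, fun i => if i = 0 then x else y, one_pos, by simp, by simp, ?_, ?_⟩
    · intro i hi
      obtain rfl : i = 0 := by omega
      simpa using hxy
    · intro i hi
      obtain rfl : i = 0 := by omega
      exact ⟨c, d, by simpa using hcd⟩
  · refine ⟨n + 1, fun i => if i ≤ n then p i else y, by omega, by simp [p0], by simp, ?_, ?_⟩
    · intro i hi
      by_cases h1 : i < n
      · have h2 : i ≤ n := h1.le
        have h3 : i + 1 ≤ n := h1
        simpa [h2, h3] using hp i h1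
      · obtain rfl : i = n := by omega
        simpa [pn] using hxy
    · intro i hi
      by_cases h1 : i < n
      · have h2 : i ≤ n := h1.le
        have h3 : i + 1 ≤ n := h1
        simpa [h2, h3] using hq i h1
      · obtain rfl : i = n := by omega
        refine ⟨c, d, ?_⟩
        simpa [pn] using hcd

theorem pl_of_local {h : ℝ → ℝ} {a b : ℝ} (hab : a < b)
    (hr : ∀ x ∈ Ico a b, ∃ ε > 0, AffOn id h x (x + ε))
    (hl : ∀ x ∈ Ioc a b, ∃ ε > 0, AffOn id h (x - ε) x) : IsPLOn h a b := by
  set S : Set ℝ := {x | x ∈ Icc a b ∧ (x = a ∨ IsPLOn h a x)} with hS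
  have haS : a ∈ S := ⟨⟨le_rfl, hab.le⟩, Or.inl rfl⟩
  have hbd : BddAbove S := ⟨b, fun x hx => hx.1.2⟩
  set s := sSup S with hs
  have has : a ≤ s := le_csSup hbd haS
  have hsb : s ≤ b := csSup_le ⟨a, haS⟩ fun x hx => hx.1.2
  have hsS : s = a ∨ IsPLOn h a s := by
    rcases has.eq_or_lt with h1 | h1
    · exact Or.inl h1.symm
    obtain ⟨ε, he, c, d, hcd⟩ := hl s ⟨h1, hsb⟩
    obtain ⟨x, hxS, hx⟩ := exists_lt_of_lt_csSup ⟨a, haS⟩ (show s - ε < sSup S by linarith)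
    have hxs : x ≤ s := le_csSup hbd hxS
    rcases hxs.eq_or_lt with h2 | h2
    · exact h2 ▸ hxS.2
    · exact Or.inr (pl_append hxS.2 h2 ⟨c, d, fun z hz => hcd z ⟨by linarith [hz.1], hz.2⟩⟩)
  have hsb' : s = b := by
    by_contra hne
    have hlt : s < b := lt_of_le_of_ne hsb hne
    obtain ⟨ε, he, c, d, hcd⟩ := hr s ⟨has, hlt⟩
    have hlt2 : s < min (s + ε) b := lt_min (by linarith) hlt
    have := pl_append hsS hlt2 ⟨c, d, fun z hz => hcd z ⟨hz.1, hz.2.trans (min_le_left _ _)⟩⟩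
    have h3 : min (s + ε) b ∈ S := ⟨⟨by linarith, min_le_right _ _⟩, Or.inr this⟩
    linarith [le_csSup hbd h3]
  rcases hsS with h1 | h1
  · linarith
  · exact hsb' ▸ h1

theorem local_of_pl {h : ℝ → ℝ} {a b : ℝ} (H : IsPLOn h a b) :
    (∀ x ∈ Ico a b, ∃ ε > 0, AffOn id h x (x + ε)) ∧
    (∀ x ∈ Ioc a b, ∃ ε > 0, AffOn id h (x - ε) x) := by
  obtain ⟨n, p, hn, rfl, rfl, hp, hq⟩ := H
  constructor
  · intro x hx
    have : ∀ m ≤ n, x < p m → ∃ i < m, p i ≤ x ∧ x < p (i + 1) := by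
      intro m
      induction m with
      | zero => intro _ h1; linarith [hx.1]
      | succ k ih =>
        intro hk h1
        by_cases h2 : x < p k
        · obtain ⟨i, hi, h3⟩ := ih (by omega) h2
          exact ⟨i, by omega, h3⟩
        · exact ⟨k, by omega, not_lt.1 h2, h1⟩
    obtain ⟨i, hi, h1, h2⟩ := this n le_rfl hx.2
    obtain ⟨c, d, hcd⟩ := hq i hi
    exact ⟨p (i + 1) - x, by linarith, c, d, fun z hz => hcd z ⟨by linarith [hz.1], by linarith [hz.2]⟩⟩
  · intro x hx
    have : ∀ m ≤ n, x ≤ p m → ∃ i < m, p i < x ∧ x ≤ p (i + 1) := by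
      intro m
      induction m with
      | zero => intro _ h1; linarith [hx.1]
      | succ k ih =>
        intro hk h1
        by_cases h2 : x ≤ p k
        · obtain ⟨i, hi, h3⟩ := ih (by omega) h2
          exact ⟨i, by omega, h3⟩
        · exact ⟨k, by omega, not_le.1 h2, h1⟩
    obtain ⟨i, hi, h1, h2⟩ := this n le_rfl hx.2
    obtain ⟨c, d, hcd⟩ := hq i hi
    exact ⟨x - p i, by linarith, c, d, fun z hz => hcd z ⟨by linarith [hz.1], by linarith [hz.2]⟩⟩

theorem irr_log : Irrational (Real.log 2 / Real.log 3) := by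
  have h2 : 0 < Real.log 2 := Real.log_pos (by norm_num)
  have h3 : 0 < Real.log 3 := Real.log_pos (by norm_num)
  rintro ⟨q, hq⟩
  have hqp : 0 < q := by
    have : (0:ℝ) < q := by rw [hq]; positivity
    exact_mod_cast this
  obtain ⟨m, hm⟩ : ∃ m : ℕ, q.num = m := ⟨q.num.toNat, by
    have := Rat.num_pos.2 hqp
    omega⟩
  have hqd : (q : ℝ) = (m : ℝ) / q.den := by
    rw [Rat.cast_def, hm]; simp
  have hd : (0:ℝ) < q.den := by exact_mod_cast q.den_pos
  rw [hqd] at hq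
  have h4 : (q.den : ℝ) * Real.log 2 = m * Real.log 3 := by
    field_simp at hq
    linarith
  have h5 : (2:ℝ) ^ q.den = 3 ^ m := by
    rw [← Real.log_pow, ← Real.log_pow] at h4
    exact Real.log_injOn_pos (by simp) (by simp) h4
  have h6 : 2 ^ q.den = 3 ^ m := by exact_mod_cast h5
  have h7 : Even (3 ^ m) := by
    rw [← h6]; exact (Nat.even_pow.2 ⟨even_two, q.den_ne_zero⟩)
  have h8 : Odd (3 ^ m) := Odd.pow (by decide)
  exact (Nat.not_even_iff_odd.2 h8) h7

theorem const_of_two_periods {P : ℝ → ℝ} {S l m β : ℝ} (hl : 0 < l) (hm : 0 < m)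
    (hirr : Irrational (l / m)) (hc : ContinuousOn P (Iic S))
    (h1 : ∀ s ≤ S, P (s - l) = P s) (h2 : ∀ s ≤ S, P (s - m) = P s - β) :
    ∀ s < S, ∀ t < S, P s = P t := by
  have h1n : ∀ n : ℕ, ∀ s ≤ S, P (s - n * l) = P s := by
    intro n
    induction n with
    | zero => intro s _; simp
    | succ k ih =>
      intro s hs
      rw [← ih s hs, ← h1 (s - k * l) (by nlinarith [mul_nonneg k.cast_nonneg hl.le])]
      congr 1; push_cast; ring
  have h2n : ∀ n : ℕ, ∀ s ≤ S, P (s - n * m) = P s - n * β := by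
    intro n
    induction n with
    | zero => intro s _; simp
    | succ k ih =>
      intro s hs
      have := h2 (s - k * m) (by nlinarith [mul_nonneg k.cast_nonneg hm.le])
      rw [ih s hs] at this
      have e : s - (k + 1 : ℕ) * m = s - k * m - m := by push_cast; ring
      rw [e, this]; push_cast; ring
  obtain ⟨M, hM⟩ : ∃ M, ∀ s ≤ S, |P s| ≤ M := by
    obtain ⟨M, hM⟩ := (isCompact_Icc (a := S - l) (b := S)).exists_bound_of_continuousOn
      (hc.mono fun x hx => hx.2)
    refine ⟨M, fun s hs => ?_⟩
    set n := ⌊(S - s) / l⌋₊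
    have hn : (n : ℝ) ≤ (S - s) / l := Nat.floor_le (div_nonneg (by linarith) hl.le)
    have hn' : (S - s) / l < n + 1 := Nat.lt_floor_add_one _
    rw [le_div_iff₀ hl] at hn
    rw [div_lt_iff₀ hl] at hn'
    have := h1n n (s + n * l) (by linarith)
    rw [add_sub_cancel_right] at this
    rw [this]
    exact hM _ ⟨by linarith, by linarith⟩
  have hβ : β = 0 := by
    by_contra hne
    have hpos : 0 < |β| := abs_pos.2 hne
    obtain ⟨n, hn⟩ := exists_nat_gt (2 * M / |β|)
    rw [div_lt_iff₀ hpos] at hn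
    have e := h2n n S le_rfl
    have hb1 := abs_le.1 (hM S le_rfl)
    have hb2 := abs_le.1 (hM (S - n * m) (by nlinarith [mul_nonneg n.cast_nonneg hm.le]))
    rw [e] at hb2
    have : |n * β| ≤ 2 * M := abs_le.2 ⟨by linarith, by linarith⟩
    rw [abs_mul, Nat.abs_cast] at this
    linarith
  subst hβ
  have h12 : ∀ i j : ℕ, ∀ s ≤ S, P (s - i * l - j * m) = P s := by
    intro i j s hs
    rw [h2n j _ (by nlinarith [mul_nonneg i.cast_nonneg hl.le]), h1n i s hs]; simp
  have hz : ∀ a b : ℤ, ∀ s ≤ S, s + (a * l + b * m) ≤ S → P (s + (a * l + b * m)) = P s := by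
    intro a b s hs hs'
    have ha : (a : ℝ) = (a.toNat : ℝ) - ((-a).toNat : ℝ) := by
      have : a = (a.toNat : ℤ) - ((-a).toNat : ℤ) := by omega
      exact_mod_cast this
    have hb : (b : ℝ) = (b.toNat : ℝ) - ((-b).toNat : ℝ) := by
      have : b = (b.toNat : ℤ) - ((-b).toNat : ℤ) := by omega
      exact_mod_cast this
    rw [← h12 a.toNat b.toNat _ hs', ← h12 (-a).toNat (-b).toNat s hs]
    congr 1
    rw [ha, hb]; ring
  have hdense := dense_addSubgroupClosure_pair_iff.2 hirr
  intro s hs t ht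
  have hct : ContinuousAt P t := (hc t ht.le).continuousAt (Iic_mem_nhds ht)
  by_contra hne
  have hne' : ∀ᶠ u in nhds t, P u ≠ P s := hct.eventually_ne (Ne.symm hne)
  have hlt : ∀ᶠ u in nhds t, u < S := Iio_mem_nhds ht
  obtain ⟨U, hU, hUo, htU⟩ := eventually_nhds_iff.1 (hne'.and hlt)
  have hV : IsOpen ((fun z => s + z) ⁻¹' U) := hUo.preimage (by fun_prop)
  obtain ⟨z, hzV, hzc⟩ := hdense.inter_open_nonempty _ hV ⟨t - s, by simpa using htU⟩
  obtain ⟨a, b, rfl⟩ := AddSubgroup.mem_closure_pair.1 hzc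
  have := hU _ hzV
  simp only [zsmul_eq_mul] at this
  exact this.1 (hz a b s hs.le this.2.le)

theorem alpha_eq_one {α K A B ε : ℝ} (hα : 0 < α) (hK : 0 < K) (hε : 0 < ε)
    (H : ∀ t ∈ Icc 0 ε, K * t ^ α = A * (1 - t) ^ α + B) : α = 1 := by
  have h0 := H 0 ⟨le_rfl, hε.le⟩
  rw [Real.zero_rpow hα.ne'] at h0
  simp only [mul_zero, sub_zero, Real.one_rpow, mul_one] at h0
  have hB : B = -A := by linarith
  subst hB
  have hd : HasDerivAt (fun t : ℝ => (A * (1 - t) ^ α + -A) / K) (-(A * α) / K) 0 := by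
    have h1 : HasDerivAt (fun t : ℝ => 1 - t) (-1) 0 := by
      simpa using (hasDerivAt_id (0:ℝ)).const_sub 1
    have h2 := h1.rpow_const (p := α) (Or.inl (by norm_num))
    have h3 := ((h2.const_mul A).add_const (-A)).div_const K
    have e : -(A * α) / K = A * (-1 * α * (1 - 0) ^ (α - 1)) / K := by simp
    rw [e]
    exact h3
  have hs := hd.tendsto_slope_zero_right
  have hev : ∀ᶠ t in nhdsWithin (0:ℝ) (Ioi 0), t ^ (α - 1) =
      t⁻¹ • ((A * (1 - (0 + t)) ^ α + -A) / K - (A * (1 - 0) ^ α + -A) / K) := by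
    filter_upwards [Ioc_mem_nhdsGT hε] with t ht
    have := H t ⟨ht.1.le, ht.2⟩
    simp only [zero_add, sub_zero, Real.one_rpow, mul_one, smul_eq_mul]
    rw [← this, Real.rpow_sub_one ht.1.ne']
    field_simp
    ring
  have hs' : Filter.Tendsto (fun t : ℝ => t ^ (α - 1)) (nhdsWithin 0 (Ioi 0))
      (nhds (-(A * α) / K)) := hs.congr' (hev.mono fun t ht => ht.symm)
  rcases lt_trichotomy α 1 with h | h | h
  · exfalso
    exact not_tendsto_nhds_of_tendsto_atTop (tendsto_rpow_neg_nhdsGT_zero (by linarith)) _ hs'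
  · exact h
  · exfalso
    have hc : Filter.Tendsto (fun t : ℝ => t ^ (α - 1)) (nhdsWithin 0 (Ioi 0)) (nhds 0) := by
      have := (Real.continuousAt_rpow_const (0:ℝ) (α - 1) (Or.inr (by linarith))).tendsto
      rw [Real.zero_rpow (by linarith)] at this
      exact this.mono_left nhdsWithin_le_nhds
    have hA := tendsto_nhds_unique hs' hc
    have hA0 : A = 0 := by
      rw [div_eq_zero_iff] at hA
      rcases hA with h1 | h1
      · rcases mul_eq_zero.1 (neg_eq_zero.1 h1) with h2 | h2
        · exact h2
        · linarith
      · linarith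
    have h5 := H ε ⟨hε.le, le_rfl⟩
    rw [hA0] at h5
    have := mul_pos hK (Real.rpow_pos_of_pos hε α)
    linarith

/-- The standing facts about the conjugacy `h`. -/
structure Std (g h : ℝ → ℝ) : Prop where
  cont : ContinuousOn h (Icc 0 1)
  mono : StrictMonoOn h (Icc 0 1)
  maps : MapsTo h (Icc 0 1) (Icc 0 1)
  zero : h 0 = 0
  one : h 1 = 1
  conj : ∀ x ∈ Icc (0:ℝ) 1, h (tent x) = g (h x)

theorem std_of_conj {g h : ℝ → ℝ} (hh : ConjTent g h) : Std g h := by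
  obtain ⟨⟨hc, hb⟩, h0, hcj⟩ := hh
  have hm : StrictMonoOn h (Icc 0 1) := by
    refine hc.strictMonoOn_of_injOn_Icc zero_le_one ?_ hb.injOn
    rw [h0]
    exact (hb.mapsTo ⟨zero_le_one, le_rfl⟩).1
  refine ⟨hc, hm, hb.mapsTo, h0, ?_, hcj⟩
  obtain ⟨x, hx, hx1⟩ := hb.surjOn (show (1:ℝ) ∈ Icc (0:ℝ) 1 from ⟨zero_le_one, le_rfl⟩)
  have h1 := hm.monotoneOn hx ⟨zero_le_one, le_rfl⟩ hx.2
  have h2 := (hb.mapsTo (show (1:ℝ) ∈ Icc (0:ℝ) 1 from ⟨zero_le_one, le_rfl⟩)).2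
  linarith

theorem Std.near {g h : ℝ → ℝ} (H : Std g h) {u : ℝ} (hu : u ∈ Icc (0:ℝ) 1) {ε : ℝ} (hε : 0 < ε) :
    ∃ η > 0, ∀ y ∈ Icc (0:ℝ) 1, |y - u| ≤ η → |h y - h u| < ε := by
  obtain ⟨η, hη, hy⟩ := Metric.continuousOn_iff.1 H.cont u hu ε hε
  refine ⟨η / 2, by linarith, fun y hy1 hy2 => ?_⟩
  exact hy y hy1 (by rw [Real.dist_eq]; linarith)

theorem tent_left {y : ℝ} (hy : y ≤ 1 / 2) : tent y = 2 * y := by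
  unfold tent; exact min_eq_left (by linarith)

theorem tent_right {y : ℝ} (hy : 1 / 2 ≤ y) : tent y = 2 - 2 * y := by
  unfold tent; exact min_eq_right (by linarith)

theorem left_step {g h φ : ℝ → ℝ} (H : Std g h) {κ : ℝ} (hκ : κ ≠ 0)
    (hφ : ∀ y, 0 ≤ y → φ (2 * y) = κ * φ y)
    (hgl : ∀ x ∈ Ioc (0:ℝ) 1, ∃ ε > 0, AffOn id g (x - ε) x)
    {u : ℝ} (hu : 0 < u) (hu' : u ≤ 1 / 2) (hA : ∃ ε > 0, AffOn φ h (u - ε) u) :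
    ∃ ε > 0, AffOn φ h (2 * u - ε) (2 * u) := by
  obtain ⟨ε, hε, A, B, hAB⟩ := hA
  have huI : u ∈ Icc (0:ℝ) 1 := ⟨hu.le, by linarith⟩
  have hpos : 0 < h u := by
    rw [← H.zero]; exact H.mono ⟨le_rfl, zero_le_one⟩ huI hu
  obtain ⟨ε', hε', c, d, hcd⟩ := hgl (h u) ⟨hpos, (H.maps huI).2⟩
  obtain ⟨η, hη, hy⟩ := H.near huI hε'
  refine ⟨min ε (min η u), by positivity, c * A / κ, c * B + d, fun z hz => ?_⟩
  have e1 := min_le_left ε (min η u)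
  have e2 := (min_le_right ε (min η u)).trans (min_le_left η u)
  have e3 := (min_le_right ε (min η u)).trans (min_le_right η u)
  set y := z / 2 with hyd
  have hzy : z = 2 * y := by rw [hyd]; ring
  have hz1 := hz.1
  have hz2 := hz.2
  have hyI : y ∈ Icc (0:ℝ) 1 := ⟨by linarith, by linarith⟩
  have hb := abs_lt.1 (hy y hyI (abs_le.2 ⟨by linarith, by linarith⟩))
  have hle : h y ≤ h u := H.mono.monotoneOn hyI huI (by linarith)
  have h1 := H.conj y hyI
  rw [tent_left (by linarith), hcd (h y) ⟨by linarith [hb.1], hle⟩,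
    hAB y ⟨by linarith, by linarith⟩] at h1
  rw [hzy, h1, hφ y hyI.1]
  simp only [id]
  field_simp
  try ring

theorem right_step {g h φ : ℝ → ℝ} (H : Std g h) {κ : ℝ} (hκ : κ ≠ 0)
    (hφ : ∀ y, 0 ≤ y → φ (2 * y) = κ * φ y)
    (hgr : ∀ x ∈ Ico (0:ℝ) 1, ∃ ε > 0, AffOn id g x (x + ε))
    {u : ℝ} (hu : 0 ≤ u) (hu' : u < 1 / 2) (hA : ∃ ε > 0, AffOn φ h u (u + ε)) :
    ∃ ε > 0, AffOn φ h (2 * u) (2 * u + ε) := by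
  obtain ⟨ε, hε, A, B, hAB⟩ := hA
  have huI : u ∈ Icc (0:ℝ) 1 := ⟨hu, by linarith⟩
  have hpos : h u < 1 := by
    rw [← H.one]; exact H.mono huI ⟨zero_le_one, le_rfl⟩ (by linarith)
  obtain ⟨ε', hε', c, d, hcd⟩ := hgr (h u) ⟨(H.maps huI).1, hpos⟩
  obtain ⟨η, hη, hy⟩ := H.near huI hε'
  have hw : 0 < 1 / 2 - u := by linarith
  refine ⟨min ε (min η (1 / 2 - u)), by positivity, c * A / κ, c * B + d, fun z hz => ?_⟩
  have e1 := min_le_left ε (min η (1 / 2 - u))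
  have e2 := (min_le_right ε (min η (1 / 2 - u))).trans (min_le_left η (1 / 2 - u))
  have e3 := (min_le_right ε (min η (1 / 2 - u))).trans (min_le_right η (1 / 2 - u))
  set y := z / 2 with hyd
  have hzy : z = 2 * y := by rw [hyd]; ring
  have hz1 := hz.1
  have hz2 := hz.2
  have hyI : y ∈ Icc (0:ℝ) 1 := ⟨by linarith, by linarith⟩
  have hb := abs_lt.1 (hy y hyI (abs_le.2 ⟨by linarith, by linarith⟩))
  have hle : h u ≤ h y := H.mono.monotoneOn huI hyI (by linarith)
  have h1 := H.conj y hyI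
  rw [tent_left (by linarith), hcd (h y) ⟨hle, by linarith [hb.2]⟩,
    hAB y ⟨by linarith, by linarith⟩] at h1
  rw [hzy, h1, hφ y hyI.1]
  simp only [id]
  field_simp
  try ring

theorem extend_local {g h φ : ℝ → ℝ} (H : Std g h) {κ : ℝ} (hκ : κ ≠ 0)
    (hφ : ∀ y, 0 ≤ y → φ (2 * y) = κ * φ y) (hg : IsPLOn g 0 1)
    {δ K : ℝ} (hδ : 0 < δ) (hK : ∀ x ∈ Icc 0 δ, h x = K * φ x) :
    (∀ x ∈ Ico (0:ℝ) 1, ∃ ε > 0, AffOn φ h x (x + ε)) ∧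
    (∀ x ∈ Ioc (0:ℝ) 1, ∃ ε > 0, AffOn φ h (x - ε) x) := by
  obtain ⟨hgr, hgl⟩ := local_of_pl hg
  have harch : ∀ x : ℝ, ∃ n : ℕ, x < 2 ^ n * δ := by
    intro x
    obtain ⟨n, hn⟩ := pow_unbounded_of_one_lt (x / δ) (one_lt_two)
    exact ⟨n, by rwa [div_lt_iff₀ hδ] at hn⟩
  constructor
  · have : ∀ n : ℕ, ∀ x ∈ Ico (0:ℝ) 1, x < 2 ^ n * δ → ∃ ε > 0, AffOn φ h x (x + ε) := by
      intro n
      induction n with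
      | zero =>
        intro x hx hx'
        exact ⟨δ - x, by linarith, K, 0, fun z hz => by
          rw [hK z ⟨hx.1.trans hz.1, by linarith [hz.2]⟩]; ring⟩
      | succ n ih =>
        intro x hx hx'
        have h1 := ih (x / 2) ⟨by linarith [hx.1], by linarith [hx.1, hx.2]⟩
          (by rw [pow_succ] at hx'; linarith)
        have h2 := right_step H hκ hφ hgr (by linarith [hx.1]) (by linarith [hx.2]) h1
        rwa [show 2 * (x / 2) = x by ring] at h2
    intro x hx
    obtain ⟨n, hn⟩ := harch x
    exact this n x hx hn
  · have : ∀ n : ℕ, ∀ x ∈ Ioc (0:ℝ) 1, x < 2 ^ n * δ → ∃ ε > 0, AffOn φ h (x - ε) x := by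
      intro n
      induction n with
      | zero =>
        intro x hx hx'
        exact ⟨x, hx.1, K, 0, fun z hz => by
          rw [hK z ⟨by linarith [hz.1], by linarith [hz.2]⟩]; ring⟩
      | succ n ih =>
        intro x hx hx'
        have h1 := ih (x / 2) ⟨by linarith [hx.1], by linarith [hx.1, hx.2]⟩
          (by rw [pow_succ] at hx'; linarith)
        have h2 := left_step H hκ hφ hgl (by linarith [hx.1]) (by linarith [hx.2]) h1
        rwa [show 2 * (x / 2) = x by ring] at h2
    intro x hx
    obtain ⟨n, hn⟩ := harch x
    exact this n x hx hn

theorem power_form {g h : ℝ → ℝ} (H : Std g h) {δ a b : ℝ} (hδ : 0 < δ) (hδ' : δ ≤ 1 / 3)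
    (ha : ∀ x ∈ Icc 0 δ, h (2 * x) = a * h x) (hb : ∀ x ∈ Icc 0 δ, h (3 * x) = b * h x) :
    ∃ K > 0, ∃ α : ℝ, 0 < α ∧ ∀ x ∈ Icc 0 (δ / 2), h x = K * x ^ α := by
  have hpos : ∀ x, 0 < x → x ≤ 1 → 0 < h x := by
    intro x hx hx1
    rw [← H.zero]; exact H.mono ⟨le_rfl, zero_le_one⟩ ⟨hx.le, hx1⟩ hx
  have hl2 : 0 < Real.log 2 := Real.log_pos (by norm_num)
  have hl3 : 0 < Real.log 3 := Real.log_pos (by norm_num)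
  have hδp := hpos δ hδ (by linarith)
  have ha1 : 1 < a := by
    have h1 := H.mono (a := δ) (b := 2 * δ) ⟨hδ.le, by linarith⟩ ⟨by linarith, by linarith⟩ (by linarith)
    rw [ha δ ⟨hδ.le, le_rfl⟩] at h1
    by_contra hn
    nlinarith
  have hb0 : 0 < b := by
    have h1 := hpos (3 * δ) (by linarith) (by linarith)
    rw [hb δ ⟨hδ.le, le_rfl⟩] at h1
    exact pos_of_mul_pos_left h1 hδp.le
  set α := Real.log a / Real.log 2 with hαd
  have hα : 0 < α := div_pos (Real.log_pos ha1) hl2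
  have hαl : α * Real.log 2 = Real.log a := by rw [hαd]; field_simp
  set P : ℝ → ℝ := fun s => Real.log (h (Real.exp s)) - α * s with hP
  have hexp : ∀ s ≤ Real.log δ, Real.exp s ≤ δ := by
    intro s hs
    rwa [Real.le_log_iff_exp_le hδ] at hs
  have hcont : ContinuousOn P (Iic (Real.log δ)) := by
    refine ContinuousOn.sub (ContinuousOn.log (H.cont.comp Real.continuous_exp.continuousOn ?_) ?_)
      (by fun_prop)
    · intro s hs
      exact ⟨(Real.exp_pos s).le, by linarith [hexp s hs]⟩
    · intro s hs
      exact (hpos _ (Real.exp_pos s) (by linarith [hexp s hs])).ne'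
  have h1 : ∀ s ≤ Real.log δ, P (s - Real.log 2) = P s := by
    intro s hs
    have hes := hexp s hs
    have hep := Real.exp_pos s
    have e : Real.exp (s - Real.log 2) = Real.exp s / 2 := by
      rw [Real.exp_sub, Real.exp_log (by norm_num)]
    have e2 := ha (Real.exp s / 2) ⟨by linarith, by linarith⟩
    rw [show 2 * (Real.exp s / 2) = Real.exp s by ring] at e2
    have e3 := hpos (Real.exp s / 2) (by linarith) (by linarith)
    simp only [hP]
    rw [e, e2, Real.log_mul (by linarith) e3.ne']
    linarith
  have h2 : ∀ s ≤ Real.log δ, P (s - Real.log 3) = P s - (Real.log b - α * Real.log 3) := by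
    intro s hs
    have hes := hexp s hs
    have hep := Real.exp_pos s
    have e : Real.exp (s - Real.log 3) = Real.exp s / 3 := by
      rw [Real.exp_sub, Real.exp_log (by norm_num)]
    have e2 := hb (Real.exp s / 3) ⟨by linarith, by linarith⟩
    rw [show 3 * (Real.exp s / 3) = Real.exp s by ring] at e2
    have e3 := hpos (Real.exp s / 3) (by linarith) (by linarith)
    simp only [hP]
    rw [e, e2, Real.log_mul hb0.ne' e3.ne']
    ring
  have hconst := const_of_two_periods hl2 hl3 irr_log hcont h1 h2
  refine ⟨Real.exp (P (Real.log δ - 1)), Real.exp_pos _, α, hα, fun x hx => ?_⟩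
  rcases hx.1.eq_or_lt with h0 | h0
  · rw [← h0, H.zero, Real.zero_rpow hα.ne', mul_zero]
  · have hlt : Real.log x < Real.log δ := Real.log_lt_log h0 (by linarith [hx.2])
    have e := hconst _ hlt _ (show Real.log δ - 1 < Real.log δ by linarith)
    rw [← e]
    simp only [hP]
    rw [Real.exp_log h0, Real.exp_sub, Real.exp_log (hpos x h0 (by linarith [hx.2])),
      Real.rpow_def_of_pos h0, mul_comm α]
    field_simp

/-- The three-fold tent map. -/
noncomputable def tent3 (x : ℝ) : ℝ := max (min (3 * x) (2 - 3 * x)) (3 * x - 2)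

theorem tent3_comm (x : ℝ) (hx : x ∈ Icc (0:ℝ) 1) : tent3 (tent x) = tent (tent3 x) := by
  obtain ⟨h0, h1⟩ := hx
  unfold tent3 tent
  grind

theorem tent3_maps : MapsTo tent3 (Icc 0 1) (Icc 0 1) := by
  rintro x ⟨h0, h1⟩
  unfold tent3
  constructor <;> grind

theorem tent_maps : MapsTo tent (Icc 0 1) (Icc 0 1) := by
  rintro x ⟨h0, h1⟩
  unfold tent
  constructor <;> grind

theorem tent3_left {x : ℝ} (hx : x ≤ 1 / 3) : tent3 x = 3 * x := by
  unfold tent3; grind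

theorem semiconj3 {g h : ℝ → ℝ} (hh : ConjTent g h) :
    ∃ ψ, IsSelfSemiconj g ψ ∧ ∀ x ∈ Icc (0:ℝ) 1, ψ (h x) = h (tent3 x) := by
  obtain ⟨⟨hc, hb⟩, h0, hcj⟩ := hh
  have hinv := hb.invOn_invFunOn
  set k := Function.invFunOn h (Icc 0 1) with hk
  have hkm : MapsTo k (Icc 0 1) (Icc 0 1) := hb.surjOn.mapsTo_invFunOn
  have hkc : ContinuousOn k (Icc 0 1) := by
    rw [continuousOn_iff_isClosed]
    intro t ht
    have hcomp : IsCompact (Set.image h (Icc 0 1 ∩ t)) :=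
      (isCompact_Icc.inter_right ht).image_of_continuousOn (hc.mono inter_subset_left)
    refine ⟨_, hcomp.isClosed, ?_⟩
    ext y
    constructor
    · rintro ⟨hy1, hy2⟩
      exact ⟨⟨k y, ⟨hkm hy2, hy1⟩, hinv.2 hy2⟩, hy2⟩
    · rintro ⟨⟨x, ⟨hx1, hx2⟩, rfl⟩, hy2⟩
      refine ⟨?_, hy2⟩
      change k (h x) ∈ t
      rw [hinv.1 hx1]; exact hx2
  have htc : Continuous tent3 := by unfold tent3; fun_prop
  refine ⟨fun y => h (tent3 (k y)), ⟨?_, ?_, ?_, ?_⟩, ?_⟩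
  · exact hc.comp (htc.comp_continuousOn hkc) (tent3_maps.comp hkm)
  · exact fun y hy => hb.mapsTo (tent3_maps (hkm hy))
  · intro z hz
    have hkz := hkm hz
    have hx : k z / 3 ∈ Icc (0:ℝ) 1 := ⟨by linarith [hkz.1], by linarith [hkz.1, hkz.2]⟩
    refine ⟨h (k z / 3), hb.mapsTo hx, ?_⟩
    simp only
    rw [hinv.1 hx, tent3_left (by linarith [hkz.2]), show 3 * (k z / 3) = k z by ring, hinv.2 hz]
  · intro y hy
    have hky := hkm hy
    have e1 : g y = h (tent (k y)) := by rw [hcj _ hky, hinv.2 hy]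
    simp only
    rw [e1, hinv.1 (tent_maps hky), tent3_comm _ hky, hcj _ (tent3_maps hky)]
  · intro x hx
    simp only
    rw [hinv.1 hx]

theorem linear_at_zero {ψ : ℝ → ℝ} (H : IsPLOn ψ 0 1) (h0 : ψ 0 = 0) :
    ∃ ε > 0, ∃ c, ∀ y ∈ Icc 0 ε, ψ y = c * y := by
  obtain ⟨ε, hε, c, d, hcd⟩ := (local_of_pl H).1 0 ⟨le_rfl, one_pos⟩
  have := hcd 0 ⟨le_rfl, by linarith⟩
  simp only [id, h0, mul_zero, zero_add] at this
  refine ⟨ε, hε, c, fun y hy => ?_⟩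
  rw [hcd y ⟨hy.1, by linarith [hy.2]⟩, ← this]; simp

/-- If every self-semiconjugation of a carcass map `g`, topologically
conjugated to the tent map via `h`, is piecewise linear, then `h` is piecewise linear. -/
theorem conjugacy_piecewiseLinear_of_all_selfSemiconj_pl (g h : ℝ → ℝ)
    (hg : IsCarcass g) (hh : ConjTent g h)
    (hall : ∀ ψ : ℝ → ℝ, IsSelfSemiconj g ψ → IsPLOn ψ 0 1) :
    IsPLOn h 0 1 := by
  have H := std_of_conj hh
  have hgpl := hg.2
  obtain ⟨v, -, -, -, hg0, -, -⟩ := hg.1.2.2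
  obtain ⟨ψ, hψ, hψh⟩ := semiconj3 hh
  have hz : (0:ℝ) ∈ Icc (0:ℝ) 1 := ⟨le_rfl, zero_le_one⟩
  have hψ0 : ψ 0 = 0 := by
    have := hψh 0 hz
    rw [H.zero, tent3_left (by norm_num), mul_zero, H.zero] at this
    exact this
  obtain ⟨ε₁, hε₁, a, ha⟩ := linear_at_zero hgpl hg0
  obtain ⟨ε₂, hε₂, b, hb⟩ := linear_at_zero (hall ψ hψ) hψ0
  obtain ⟨η, hη, hy⟩ := H.near hz (lt_min hε₁ hε₂)
  have hsmall : ∀ x ∈ Icc 0 (min η (1 / 3)), x ∈ Icc (0:ℝ) 1 ∧ x ≤ 1 / 3 ∧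
      0 ≤ h x ∧ h x ≤ ε₁ ∧ h x ≤ ε₂ := by
    intro x hx
    have hx1 := hx.2.trans (min_le_left _ _)
    have hx2 := hx.2.trans (min_le_right _ _)
    have hxI : x ∈ Icc (0:ℝ) 1 := ⟨hx.1, by linarith⟩
    have := hy x hxI (by rw [sub_zero, abs_of_nonneg hx.1]; exact hx1)
    rw [H.zero, sub_zero, lt_min_iff] at this
    have e := le_abs_self (h x)
    exact ⟨hxI, hx2, (H.maps hxI).1, by linarith, by linarith⟩
  have hδ : 0 < min η (1 / 3) := lt_min hη (by norm_num)
  obtain ⟨K, hK, α, hα, hpow⟩ := power_form (a := a) (b := b) H hδ (min_le_right _ _)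
    (by
      intro x hx
      obtain ⟨h1, h2, h3, h4, h5⟩ := hsmall x hx
      have := H.conj x h1
      rwa [tent_left (by linarith), ha _ ⟨h3, h4⟩] at this)
    (by
      intro x hx
      obtain ⟨h1, h2, h3, h4, h5⟩ := hsmall x hx
      have := hψh x h1
      rw [tent3_left h2, hb _ ⟨h3, h5⟩] at this
      exact this.symm)
  set δ := min η (1 / 3) / 2 with hδd
  have hδp : 0 < δ := by positivity
  have h2α : (2:ℝ) ^ α ≠ 0 := (Real.rpow_pos_of_pos two_pos α).ne'
  have hφ : ∀ y : ℝ, 0 ≤ y → (fun x : ℝ => x ^ α) (2 * y) = 2 ^ α * (fun x : ℝ => x ^ α) y :=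
    fun y hy => Real.mul_rpow zero_le_two hy
  obtain ⟨hR, hL⟩ := extend_local (φ := fun x : ℝ => x ^ α) H h2α hφ hgpl hδp hpow
  have hα1 : α = 1 := by
    have h1I : (1:ℝ) ∈ Icc (0:ℝ) 1 := ⟨zero_le_one, le_rfl⟩
    obtain ⟨e1, he1, A, B, hAB⟩ := hL 1 ⟨one_pos, le_rfl⟩
    obtain ⟨e2, he2, c, d, hcd⟩ := (local_of_pl hgpl).2 1 ⟨one_pos, le_rfl⟩
    obtain ⟨e3, he3, hnear⟩ := H.near h1I he2
    have hhalf : (0:ℝ) < 1 / 2 := by norm_num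
    have hδ2 : 0 < δ / 2 := by linarith
    refine alpha_eq_one (K := K * 2 ^ α) (A := c * A) (B := c * B + d)
      (ε := min (min e1 e3) (min (1 / 2) (δ / 2))) hα (by positivity)
      (lt_min (lt_min he1 he3) (lt_min hhalf hδ2)) ?_
    intro t ht
    have l1 := ht.2.trans ((min_le_left _ _).trans (min_le_left _ _))
    have l2 := ht.2.trans ((min_le_left _ _).trans (min_le_right _ _))
    have l3 := ht.2.trans ((min_le_right _ _).trans (min_le_left _ _))
    have l4 := ht.2.trans ((min_le_right _ _).trans (min_le_right _ _))
    have ht0 := ht.1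
    have hyI : 1 - t ∈ Icc (0:ℝ) 1 := ⟨by linarith, by linarith⟩
    have hn := hnear (1 - t) hyI (by
      rw [show 1 - t - 1 = -t by ring, abs_neg, abs_of_nonneg ht0]; exact l2)
    rw [H.one] at hn
    have hn' := (abs_lt.1 hn).1
    have e := H.conj (1 - t) hyI
    rw [tent_right (by linarith), show 2 - 2 * (1 - t) = 2 * t by ring,
      hpow (2 * t) ⟨by linarith, by linarith⟩, Real.mul_rpow zero_le_two ht0,
      hcd (h (1 - t)) ⟨by linarith, (H.maps hyI).2⟩,
      hAB (1 - t) ⟨by linarith, by linarith⟩] at e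
    simp only [id] at e
    linarith
  subst hα1
  have hid : (fun x : ℝ => x ^ (1:ℝ)) = id := by ext x; simp
  rw [hid] at hR hL
  exact pl_of_local one_pos hR hL
end

section
/- For every firm carcass map g, the complete pre-image of 0 under g is dense in [0,1]; consequently, g is topologically conjugated to the tent map. -/
open Set

/-- Adjacent points of a set. -/
def AdjIn (P : Set ℝ) (a b : ℝ) : Prop :=
  a ∈ P ∧ b ∈ P ∧ a < b ∧ ∀ z ∈ Ioo a b, z ∉ P

lemma exists_adjIn {P : Set ℝ} (hfin : P.Finite) (h0 : (0:ℝ) ∈ P) (h1 : (1:ℝ) ∈ P)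
    {x y : ℝ} (hx : 0 ≤ x) (hxy : x < y) (hy : y ≤ 1) (hd : ∀ z ∈ Icc x y, z ∉ P) :
    ∃ a b, AdjIn P a b ∧ a < x ∧ y < b := by
  obtain ⟨a, ⟨haP, hax⟩, ha⟩ := Set.exists_max_image (P ∩ Iic x) id (hfin.subset inter_subset_left)
    ⟨0, h0, hx⟩
  obtain ⟨b, ⟨hbP, hby⟩, hb⟩ := Set.exists_min_image (P ∩ Ici y) id (hfin.subset inter_subset_left)
    ⟨1, h1, hy⟩
  simp only [mem_Iic, mem_Ici, id, mem_inter_iff, and_imp] at *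
  have hax' : a < x := lt_of_le_of_ne hax (by rintro rfl; exact hd a ⟨le_rfl, hxy.le⟩ haP)
  have hby' : y < b := lt_of_le_of_ne hby (by rintro rfl; exact hd y ⟨hxy.le, le_rfl⟩ hbP)
  refine ⟨a, b, ⟨haP, hbP, by linarith, ?_⟩, hax', hby'⟩
  rintro z ⟨hz1, hz2⟩ hzP
  by_cases h1 : z ≤ x
  · linarith [ha z hzP h1]
  · by_cases h2 : y ≤ z
    · linarith [hb z hzP h2]
    · exact hd z ⟨by linarith, by linarith⟩ hzP

lemma exists_gap {P : Set ℝ} (hfin : P.Finite) :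
    ∃ δ > 0, ∀ a ∈ P, ∀ b ∈ P, a < b → a + δ ≤ b := by
  have hf : ((fun q : ℝ × ℝ => q.2 - q.1) '' ((P ×ˢ P) ∩ {q | q.1 < q.2})).Finite :=
    ((hfin.prod hfin).subset inter_subset_left).image _
  rcases Set.eq_empty_or_nonempty
    ((fun q : ℝ × ℝ => q.2 - q.1) '' ((P ×ˢ P) ∩ {q | q.1 < q.2})) with he | hne
  · refine ⟨1, one_pos, fun a ha b hb hab => ?_⟩
    exfalso
    have : b - a ∈ ((fun q : ℝ × ℝ => q.2 - q.1) '' ((P ×ˢ P) ∩ {q | q.1 < q.2})) :=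
      ⟨(a, b), ⟨⟨ha, hb⟩, hab⟩, rfl⟩
    rw [he] at this
    exact this
  · obtain ⟨d, hd, hmin⟩ := Set.exists_min_image _ id hf hne
    obtain ⟨q, ⟨-, hq⟩, rfl⟩ := hd
    refine ⟨q.2 - q.1, sub_pos.2 hq, fun a ha b hb hab => ?_⟩
    have := hmin (b - a) ⟨(a, b), ⟨⟨ha, hb⟩, hab⟩, rfl⟩
    simp only [id] at this
    linarith

/-- Abstract stretching argument: affine on the intervals of a finite invariant set. -/
lemma core_density {g : ℝ → ℝ} {A P : Set ℝ} {N : ℕ} (hfin : P.Finite)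
    (h0 : (0:ℝ) ∈ P) (h1 : (1:ℝ) ∈ P) (hP01 : P ⊆ Icc 0 1) (hgP : ∀ x ∈ P, g x ∈ P)
    (hPA : P ⊆ A) (hback : ∀ x ∈ Icc (0:ℝ) 1, g x ∈ A → x ∈ A)
    (hN : ∀ x ∈ P, g^[N] x = 0)
    (haff : ∀ a b, AdjIn P a b →
      ∃ c, c ≠ 0 ∧ ∀ x ∈ Icc a b, ∀ y ∈ Icc a b, g y - g x = c * (y - x))
    {x y : ℝ} (hx : 0 ≤ x) (hxy : x < y) (hy : y ≤ 1) : ∃ z ∈ Icc x y, z ∈ A := by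
  by_contra! hcon
  obtain ⟨δ, hδ, hgap⟩ := exists_gap hfin
  -- one image step
  have step : ∀ a b x y, AdjIn P a b → a < x → x < y → y < b → (∀ z ∈ Icc x y, z ∉ A) →
      ∃ a' b' x' y', AdjIn P a' b' ∧ a' < x' ∧ x' < y' ∧ y' < b' ∧ (∀ z ∈ Icc x' y', z ∉ A) ∧
        (((a' = g a ∧ b' = g b ∨ a' = g b ∧ b' = g a) ∧
            (y' - x') * (b - a) = (y - x) * (b' - a')) ∨
          (1 + δ) * ((y - x) * (b' - a')) ≤ (y' - x') * (b - a)) := by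
    intro a b x y hab hax hxy hyb hd
    obtain ⟨c, hc, hlin⟩ := haff a b hab
    obtain ⟨haP, hbP, hab', -⟩ := id hab
    have ha01 := hP01 haP
    have hb01 := hP01 hbP
    have hga := hP01 (hgP a haP)
    have hgb := hP01 (hgP b hbP)
    have key : ∀ z ∈ Icc a b, g z = g a + c * (z - a) := fun z hz => by
      linarith [hlin a ⟨le_rfl, hab'.le⟩ z hz]
    have eb := key b ⟨hab'.le, le_rfl⟩
    -- common conclusion
    have concl : ∀ l r x' y', l ∈ P → r ∈ P → l < x' → x' < y' → y' < r →
        (∀ z ∈ Icc x' y', z ∉ A) → (l = g a ∧ r = g b ∨ l = g b ∧ r = g a) →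
        r - l = |c| * (b - a) → y' - x' = |c| * (y - x) →
      ∃ a' b' x' y', AdjIn P a' b' ∧ a' < x' ∧ x' < y' ∧ y' < b' ∧ (∀ z ∈ Icc x' y', z ∉ A) ∧
        (((a' = g a ∧ b' = g b ∨ a' = g b ∧ b' = g a) ∧
            (y' - x') * (b - a) = (y - x) * (b' - a')) ∨
          (1 + δ) * ((y - x) * (b' - a')) ≤ (y' - x') * (b - a)) := by
      intro l r x' y' hl hr hlx hx'y' hy'r hd' hlr e1 e2
      have hl01 := hP01 hl
      have hr01 := hP01 hr
      obtain ⟨a', b', hadj, ha', hb'⟩ := exists_adjIn hfin h0 h1 (x := x') (y := y')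
        (by linarith [hl01.1]) hx'y' (by linarith [hr01.2]) (fun z hz hzP => hd' z hz (hPA hzP))
      obtain ⟨ha'P, hb'P, ha'b', hno⟩ := id hadj
      have hla : l ≤ a' := by
        by_contra! h
        exact hno l ⟨h, by linarith⟩ hl
      have hrb : b' ≤ r := by
        by_contra! h
        exact hno r ⟨by linarith, h⟩ hr
      refine ⟨a', b', x', y', hadj, ha', hx'y', hb', hd', ?_⟩
      have e3 : (y' - x') * (b - a) = (y - x) * (r - l) := by rw [e1, e2]; ring
      by_cases hall : l = a' ∧ r = b'
      · left
        obtain ⟨rfl, rfl⟩ := hall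
        exact ⟨hlr, e3⟩
      · right
        have hbig : b' - a' + δ ≤ r - l := by
          rcases hla.lt_or_eq with h | h
          · linarith [hgap l hl a' ha'P h]
          · rcases hrb.lt_or_eq with h' | h'
            · linarith [hgap b' hb'P r hr h']
            · exact absurd ⟨h, h'.symm⟩ hall
        have hle : b' - a' ≤ 1 := by linarith [(hP01 ha'P).1, (hP01 hb'P).2]
        rw [e3]
        have : (1 + δ) * (b' - a') ≤ r - l := by nlinarith
        calc (1 + δ) * ((y - x) * (b' - a')) = (y - x) * ((1 + δ) * (b' - a')) := by ring
          _ ≤ _ := mul_le_mul_of_nonneg_left this (by linarith)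
    -- points of the image interval avoid A
    have himg : ∀ w, (∃ z ∈ Icc x y, g z = w) → w ∉ A := by
      rintro w ⟨z, hz, rfl⟩ hw
      exact hd z hz (hback z ⟨by linarith [ha01.1, hz.1], by linarith [hb01.2, hz.2]⟩ hw)
    have ex := key x ⟨by linarith, by linarith⟩
    have ey := key y ⟨by linarith, by linarith⟩
    rcases lt_or_gt_of_ne hc with hneg | hpos
    · refine concl (g b) (g a) (g y) (g x) (hgP b hbP) (hgP a haP) (by nlinarith) (by nlinarith)
        (by nlinarith) ?_ (Or.inr ⟨rfl, rfl⟩) (by rw [abs_of_neg hneg]; linarith)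
        (by rw [abs_of_neg hneg]; linarith)
      intro w hw
      have hmem : a + (w - g a) / c ∈ Icc x y := by
        constructor
        · have : x - a ≤ (w - g a) / c := by
            rw [le_div_iff_of_neg hneg]; linarith [hw.2]
          linarith
        · have : (w - g a) / c ≤ y - a := by
            rw [div_le_iff_of_neg hneg]; linarith [hw.1]
          linarith
      refine himg w ⟨_, hmem, ?_⟩
      rw [key _ ⟨by linarith [hmem.1], by linarith [hmem.2]⟩]
      field_simp
      ring
    · refine concl (g a) (g b) (g x) (g y) (hgP a haP) (hgP b hbP) (by nlinarith) (by nlinarith)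
        (by nlinarith) ?_ (Or.inl ⟨rfl, rfl⟩) (by rw [abs_of_pos hpos]; linarith)
        (by rw [abs_of_pos hpos]; linarith)
      intro w hw
      have hmem : a + (w - g a) / c ∈ Icc x y := by
        constructor
        · have : x - a ≤ (w - g a) / c := by
            rw [le_div_iff₀ hpos]; linarith [hw.1]
          linarith
        · have : (w - g a) / c ≤ y - a := by
            rw [div_le_iff₀ hpos]; linarith [hw.2]
          linarith
      refine himg w ⟨_, hmem, ?_⟩
      rw [key _ ⟨by linarith [hmem.1], by linarith [hmem.2]⟩]
      field_simp
      ring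
  -- the ratio gains a definite factor
  have gain : ∀ n a b x y θ, g^[n] a = g^[n] b → AdjIn P a b → a < x → x < y → y < b →
      (∀ z ∈ Icc x y, z ∉ A) → θ * (b - a) ≤ y - x → 0 < θ →
      ∃ a' b' x' y', AdjIn P a' b' ∧ a' < x' ∧ x' < y' ∧ y' < b' ∧ (∀ z ∈ Icc x' y', z ∉ A) ∧
        (1 + δ) * θ * (b' - a') ≤ y' - x' := by
    intro n
    induction n with
    | zero =>
      intro a b x y θ h hab
      exact absurd h hab.2.2.1.ne
    | succ n ih =>
      intro a b x y θ h hab hax hxy hyb hd hθ hθ0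
      obtain ⟨a', b', x', y', hadj, h1, h2, h3, hd', hor⟩ := step a b x y hab hax hxy hyb hd
      have hba : 0 < b - a := sub_pos.2 hab.2.2.1
      have hba' : 0 < b' - a' := sub_pos.2 hadj.2.2.1
      rcases hor with ⟨hends, heq⟩ | hge
      · refine ih a' b' x' y' θ ?_ hadj h1 h2 h3 hd' ?_ hθ0
        · simp only [Function.iterate_succ, Function.comp_apply] at h
          rcases hends with ⟨rfl, rfl⟩ | ⟨rfl, rfl⟩
          · exact h
          · exact h.symm
        · refine le_of_mul_le_mul_right ?_ hba
          rw [heq]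
          calc θ * (b' - a') * (b - a) = θ * (b - a) * (b' - a') := by ring
            _ ≤ _ := mul_le_mul_of_nonneg_right hθ hba'.le
      · refine ⟨a', b', x', y', hadj, h1, h2, h3, hd', ?_⟩
        refine le_of_mul_le_mul_right (le_trans ?_ hge) hba
        calc (1 + δ) * θ * (b' - a') * (b - a) = (1 + δ) * (θ * (b - a) * (b' - a')) := by ring
          _ ≤ _ := mul_le_mul_of_nonneg_left (mul_le_mul_of_nonneg_right hθ hba'.le)
            (by linarith)
  obtain ⟨a, b, hab, hax, hyb⟩ := exists_adjIn hfin h0 h1 hx hxy hy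
    (fun z hz hzP => hcon z hz (hPA hzP))
  have hba : 0 < b - a := sub_pos.2 hab.2.2.1
  set θ := (y - x) / (b - a) with hθdef
  have hθ0 : 0 < θ := div_pos (by linarith) hba
  have all : ∀ k : ℕ, ∃ a' b' x' y', AdjIn P a' b' ∧ a' < x' ∧ x' < y' ∧ y' < b' ∧
      (∀ z ∈ Icc x' y', z ∉ A) ∧ (1 + δ) ^ k * θ * (b' - a') ≤ y' - x' := by
    intro k
    induction k with
    | zero =>
      refine ⟨a, b, x, y, hab, hax, hxy, hyb, hcon, ?_⟩
      rw [hθdef, pow_zero, one_mul, div_mul_cancel₀ _ hba.ne']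
    | succ k ih =>
      obtain ⟨a', b', x', y', hadj, h1, h2, h3, hd', hk⟩ := ih
      obtain ⟨a'', b'', x'', y'', hadj', h1', h2', h3', hd'', hk'⟩ :=
        gain N a' b' x' y' _ (by rw [hN a' hadj.1, hN b' hadj.2.1]) hadj h1 h2 h3 hd' hk
          (by positivity)
      refine ⟨a'', b'', x'', y'', hadj', h1', h2', h3', hd'', ?_⟩
      rw [pow_succ]
      linarith
  obtain ⟨k, hk⟩ := pow_unbounded_of_one_lt (1 / θ) (show 1 < 1 + δ by linarith)
  obtain ⟨a', b', x', y', hadj, h1, h2, h3, -, hle⟩ := all k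
  have hba' : 0 < b' - a' := sub_pos.2 hadj.2.2.1
  have : 1 < (1 + δ) ^ k * θ := by rwa [div_lt_iff₀ hθ0] at hk
  nlinarith

lemma affine_of_noKink {g : ℝ → ℝ} {a b : ℝ} (ha : 0 ≤ a) (hab : a < b) (hb : b ≤ 1)
    (hc : ContinuousOn g (Icc 0 1)) (hpl : IsPLOn g 0 1)
    (hd : ∀ x ∈ Ioo a b, DifferentiableAt ℝ g x) :
    ∃ c, ∀ x ∈ Icc a b, ∀ y ∈ Icc a b, g y - g x = c * (y - x) := by
  obtain ⟨n, p, hn, hp0, hpn, hlt, hpc⟩ := hpl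
  choose! c d hcd using hpc
  have hcover : ∀ x ∈ Ico (0:ℝ) 1, ∃ i < n, x ∈ Ico (p i) (p (i + 1)) := by
    intro x hx
    have hm : ∀ m ≤ n, x < p m → ∃ i < n, x ∈ Ico (p i) (p (i + 1)) := by
      intro m
      induction m with
      | zero => intro _ h; linarith [hx.1]
      | succ m ih =>
        intro hmn h
        by_cases h' : x < p m
        · exact ih (by omega) h'
        · exact ⟨m, by omega, not_lt.1 h', h⟩
    exact hm n le_rfl (by rw [hpn]; exact hx.2)
  have hval : ∀ x ∈ Ioo a b, deriv g x ∈ c '' (Iio n) := by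
    intro x hx
    obtain ⟨i, hi, hxi⟩ := hcover x ⟨by linarith [hx.1], by linarith [hx.2]⟩
    refine ⟨i, hi, ?_⟩
    have h1 : HasDerivWithinAt g (deriv g x) (Icc (p i) (p (i + 1))) x :=
      (hd x hx).hasDerivAt.hasDerivWithinAt
    have h2 : HasDerivWithinAt g (c i) (Icc (p i) (p (i + 1))) x := by
      have h3 : HasDerivAt (fun x => c i * x + d i) (c i) x := by
        simpa using ((hasDerivAt_id x).const_mul (c i)).add_const (d i)
      exact h3.hasDerivWithinAt.congr (fun y hy => hcd i hi y hy)
        (hcd i hi x (Ico_subset_Icc_self hxi))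
    exact (uniqueDiffOn_Icc (hlt i hi) x (Ico_subset_Icc_self hxi)).eq_deriv _ h2 h1
  have hfin : (deriv g '' Ioo a b).Finite :=
    ((finite_Iio n).image c).subset (by rintro _ ⟨x, hx, rfl⟩; exact hval x hx)
  have hsub : (deriv g '' Ioo a b).Subsingleton := by
    have hoc : OrdConnected (deriv g '' Ioo a b) := ordConnected_Ioo.image_deriv hd
    by_contra hns
    rw [Set.not_subsingleton_iff] at hns
    exact hoc.isPreconnected.infinite_of_nontrivial hns hfin
  have hmid : (a + b) / 2 ∈ Ioo a b := ⟨by linarith, by linarith⟩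
  have main : ∀ x ∈ Icc a b, ∀ y ∈ Icc a b, x < y →
      g y - g x = deriv g ((a + b) / 2) * (y - x) := by
    intro x hx y hy hxy
    obtain ⟨z, hz, hz'⟩ := exists_deriv_eq_slope g hxy
      (hc.mono (Icc_subset_Icc (by linarith [hx.1]) (by linarith [hy.2])))
      (fun z hz => (hd z ⟨by linarith [hx.1, hz.1], by linarith [hy.2, hz.2]⟩).differentiableWithinAt)
    have : deriv g ((a + b) / 2) = deriv g z :=
      hsub ⟨_, hmid, rfl⟩ ⟨z, ⟨by linarith [hx.1, hz.1], by linarith [hy.2, hz.2]⟩, rfl⟩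
    rw [this, hz', div_mul_cancel₀]
    linarith
  refine ⟨deriv g ((a + b) / 2), fun x hx y hy => ?_⟩
  rcases lt_trichotomy x y with h | rfl | h
  · exact main x hx y hy h
  · simp
  · linarith [main y hy x hx h]

lemma kinks_finite {g : ℝ → ℝ} (hpl : IsPLOn g 0 1) : {x | IsKink g x}.Finite := by
  obtain ⟨n, p, hn, hp0, hpn, hlt, hpc⟩ := hpl
  refine ((finite_Iic n).image p).subset ?_
  rintro x ⟨hx, hnd⟩
  by_contra hxp
  have hm : ∀ m ≤ n, x < p m → ∃ i < n, x ∈ Ioo (p i) (p (i + 1)) := by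
    intro m
    induction m with
    | zero => intro _ h; linarith [hx.1]
    | succ m ih =>
      intro hmn h
      by_cases h' : x < p m
      · exact ih (by omega) h'
      · exact ⟨m, by omega, lt_of_le_of_ne (not_lt.1 h')
          (fun h => hxp ⟨m, show m ≤ n by omega, h⟩), h⟩
  obtain ⟨i, hi, hxi⟩ := hm n le_rfl (by rw [hpn]; exact hx.2)
  obtain ⟨c, d, hcd⟩ := hpc i hi
  apply hnd
  have h3 : DifferentiableAt ℝ (fun x => c * x + d) x := by fun_prop
  refine h3.congr_of_eventuallyEq ?_
  filter_upwards [Ioo_mem_nhds hxi.1 hxi.2] with y hy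
  exact hcd y (Ioo_subset_Icc_self hy)

section Uni
variable {g : ℝ → ℝ} {v : ℝ}

lemma preimZero_succ (hm : MapsTo g (Icc 0 1) (Icc 0 1)) (n : ℕ) (x : ℝ) :
    x ∈ preimZero g (n + 1) ↔ x ∈ Icc (0:ℝ) 1 ∧ g x ∈ preimZero g n := by
  simp only [preimZero, mem_setOf_eq, Function.iterate_succ, Function.comp_apply]
  constructor
  · rintro ⟨h1, h2⟩
    exact ⟨h1, hm h1, h2⟩
  · rintro ⟨h1, -, h2⟩
    exact ⟨h1, h2⟩

lemma preimZero_mono (h0 : g 0 = 0) {m n : ℕ} (hmn : m ≤ n) : preimZero g m ⊆ preimZero g n := by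
  rintro x ⟨hx, h⟩
  refine ⟨hx, ?_⟩
  obtain ⟨k, rfl⟩ := Nat.exists_eq_add_of_le hmn
  rw [add_comm, Function.iterate_add_apply, h]
  exact Function.iterate_fixed h0 k

lemma preimZero_finite (hm : MapsTo g (Icc 0 1) (Icc 0 1))
    (h1 : StrictMonoOn g (Icc 0 v)) (h2 : StrictAntiOn g (Icc v 1)) (n : ℕ) :
    (preimZero g n).Finite := by
  induction n with
  | zero =>
    refine (finite_singleton (0:ℝ)).subset ?_
    rintro x ⟨-, hx⟩
    simpa using hx
  | succ n ih =>
    have e1 : (Icc 0 v ∩ g ⁻¹' (preimZero g n)).Finite := by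
      refine Set.Finite.of_finite_image (ih.subset ?_) (h1.injOn.mono inter_subset_left)
      rintro _ ⟨x, hx, rfl⟩
      exact hx.2
    have e2 : (Icc v 1 ∩ g ⁻¹' (preimZero g n)).Finite := by
      refine Set.Finite.of_finite_image (ih.subset ?_) (h2.injOn.mono inter_subset_left)
      rintro _ ⟨x, hx, rfl⟩
      exact hx.2
    refine (e1.union e2).subset ?_
    intro x hx
    rw [preimZero_succ hm] at hx
    rcases le_total x v with h | h
    · exact Or.inl ⟨⟨hx.1.1, h⟩, hx.2⟩
    · exact Or.inr ⟨⟨h, hx.1.2⟩, hx.2⟩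

lemma mem_complete {x : ℝ} : x ∈ completePreimZero g ↔ ∃ n, 1 ≤ n ∧ x ∈ preimZero g n := by
  simp [completePreimZero]

lemma firm_interval (hg : IsFirm g) {x y : ℝ} (hx : 0 ≤ x) (hxy : x < y) (hy : y ≤ 1) :
    ∃ z ∈ Icc x y, z ∈ completePreimZero g := by
  obtain ⟨⟨⟨hc, hm, v, hv, hmono, hanti, h0, h1, hv1⟩, hpl⟩, hk⟩ := hg
  have hkf := kinks_finite hpl
  have hk' : ∀ x, IsKink g x → ∃ n, 1 ≤ n ∧ x ∈ preimZero g n := fun x hx => mem_complete.1 (hk x hx)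
  choose! N hN1 hN2 using hk'
  obtain ⟨M, hM⟩ := (hkf.image N).bddAbove
  set K := M + 2
  have hPfin := preimZero_finite hm hmono hanti K
  have hkP : ∀ x, IsKink g x → x ∈ preimZero g K := fun x hx =>
    preimZero_mono h0 (le_trans (hM ⟨x, hx, rfl⟩) (by omega)) (hN2 x hx)
  have h0P : (0:ℝ) ∈ preimZero g K :=
    preimZero_mono h0 (Nat.zero_le _) ⟨⟨le_rfl, zero_le_one⟩, rfl⟩
  have h1P : (1:ℝ) ∈ preimZero g K :=
    preimZero_mono h0 (show 1 ≤ K by omega) ⟨⟨zero_le_one, le_rfl⟩, by simpa using h1⟩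
  have hvP : v ∈ preimZero g K :=
    preimZero_mono h0 (show 2 ≤ K by omega) ⟨⟨hv.1.le, hv.2.le⟩, by simp [hv1, h1]⟩
  refine core_density (g := g) (P := preimZero g K) (N := K) hPfin h0P h1P (fun x hx => hx.1)
    ?_ ?_ ?_ (fun x hx => hx.2) ?_ hx hxy hy
  · intro x hx
    exact ((preimZero_succ hm K x).1 (preimZero_mono h0 (Nat.le_succ K) hx)).2
  · intro x hx
    exact mem_complete.2 ⟨K, by omega, hx⟩
  · intro x hx hgx
    obtain ⟨n, hn, h⟩ := mem_complete.1 hgx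
    exact mem_complete.2 ⟨n + 1, by omega, (preimZero_succ hm n x).2 ⟨hx, h⟩⟩
  · rintro a b ⟨ha, hb, hab, hno⟩
    obtain ⟨c, hcc⟩ := affine_of_noKink ha.1.1 hab hb.1.2 hc hpl (by
      intro x hx
      by_contra hnd
      exact hno x hx (hkP x ⟨⟨by linarith [hx.1, ha.1.1], by linarith [hx.2, hb.1.2]⟩, hnd⟩))
    refine ⟨c, ?_, hcc⟩
    rintro rfl
    have heq := hcc a ⟨le_rfl, hab.le⟩ b ⟨hab.le, le_rfl⟩
    rw [zero_mul] at heq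
    rcases le_or_gt b v with h | h
    · linarith [hmono ⟨ha.1.1, by linarith⟩ ⟨hb.1.1, h⟩ hab]
    · have hva : v ≤ a := by
        by_contra! h'
        exact hno v ⟨h', h⟩ hvP
      linarith [hanti ⟨hva, ha.1.2⟩ ⟨h.le, hb.1.2⟩ hab]

lemma dense_of_interval {A : Set ℝ}
    (h : ∀ x y : ℝ, 0 ≤ x → x < y → y ≤ 1 → ∃ z ∈ Icc x y, z ∈ A) :
    Icc (0:ℝ) 1 ⊆ closure A := by
  intro x hx
  rw [Metric.mem_closure_iff]
  intro ε hε
  obtain ⟨z, hz, hzA⟩ := h (max 0 (x - ε / 2)) (min 1 (x + ε / 2)) (le_max_left _ _)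
    (by
      simp only [max_lt_iff, lt_min_iff]
      refine ⟨⟨by linarith, by linarith [hx.1, hx.2]⟩, by linarith [hx.1, hx.2], by linarith⟩)
    (min_le_left _ _)
  refine ⟨z, hzA, ?_⟩
  rw [Real.dist_eq, abs_lt]
  have h1 := le_trans (le_max_right _ _) hz.1
  have h2 := le_trans hz.2 (min_le_right _ _)
  constructor <;> linarith

/-- The functional operator whose fixed point is the semiconjugacy to the tent map. -/
noncomputable def semiStep (g : ℝ → ℝ) (v : ℝ) (φ : ℝ → ℝ) (x : ℝ) : ℝ :=
  if x ≤ v then φ (g x) / 2 else 1 - φ (g x) / 2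

/-- Iterates of `semiStep`, started at the identity. -/
noncomputable def semiSeq (g : ℝ → ℝ) (v : ℝ) : ℕ → ℝ → ℝ
  | 0 => fun x => x
  | n + 1 => semiStep g v (semiSeq g v n)

lemma semiStep_mono {φ : ℝ → ℝ} (hv : v ∈ Ioo (0:ℝ) 1) (hm : MapsTo g (Icc 0 1) (Icc 0 1))
    (hmono : StrictMonoOn g (Icc 0 v)) (hanti : StrictAntiOn g (Icc v 1))
    (hφ : MonotoneOn φ (Icc 0 1)) (hφ1 : φ 1 = 1) :
    MonotoneOn (semiStep g v φ) (Icc 0 1) := by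
  intro x hx y hy hxy
  have top : ∀ x ∈ Icc (0:ℝ) 1, φ (g x) ≤ 1 := fun x hx => by
    rw [← hφ1]; exact hφ (hm hx) ⟨zero_le_one, le_rfl⟩ (hm hx).2
  unfold semiStep
  split_ifs with h1 h2 h2
  · have := hφ (hm hx) (hm hy) (hmono.monotoneOn ⟨hx.1, h1⟩ ⟨hy.1, h2⟩ hxy)
    linarith
  · linarith [top x hx, top y hy]
  · linarith
  · have := hφ (hm hy) (hm hx) (hanti.antitoneOn ⟨by linarith, hx.2⟩ ⟨by linarith, hy.2⟩ hxy)
    linarith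

lemma semiStep_cont {φ : ℝ → ℝ} (hm : MapsTo g (Icc 0 1) (Icc 0 1))
    (hc : ContinuousOn g (Icc 0 1)) (hv1 : g v = 1)
    (hφ : ContinuousOn φ (Icc 0 1)) (hφ1 : φ 1 = 1) :
    ContinuousOn (semiStep g v φ) (Icc 0 1) := by
  have hcomp : ContinuousOn (fun x => φ (g x)) (Icc 0 1) := hφ.comp hc hm
  unfold semiStep
  refine ContinuousOn.if ?_ ?_ ?_
  · rintro a ⟨-, ha⟩
    have : a = v := by
      have := frontier_Iic_subset v ha
      simpa using this
    rw [this, hv1, hφ1]; norm_num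
  · exact (hcomp.div_const 2).mono inter_subset_left
  · exact (continuousOn_const.sub (hcomp.div_const 2)).mono inter_subset_left

lemma exists_semiconj (hv : v ∈ Ioo (0:ℝ) 1) (hm : MapsTo g (Icc 0 1) (Icc 0 1))
    (hc : ContinuousOn g (Icc 0 1))
    (hmono : StrictMonoOn g (Icc 0 v)) (hanti : StrictAntiOn g (Icc v 1))
    (h0 : g 0 = 0) (h1 : g 1 = 0) (hv1 : g v = 1) :
    ∃ φ : ℝ → ℝ, ContinuousOn φ (Icc 0 1) ∧ MonotoneOn φ (Icc 0 1) ∧ φ 0 = 0 ∧ φ 1 = 1 ∧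
      ∀ x ∈ Icc (0:ℝ) 1, φ (g x) = tent (φ x) := by
  have hs : ∀ n, ContinuousOn (semiSeq g v n) (Icc 0 1) ∧ MonotoneOn (semiSeq g v n) (Icc 0 1) ∧
      semiSeq g v n 0 = 0 ∧ semiSeq g v n 1 = 1 := by
    intro n
    induction n with
    | zero => exact ⟨continuousOn_id, fun x _ y _ h => h, rfl, rfl⟩
    | succ n ih =>
      obtain ⟨i1, i2, i3, i4⟩ := ih
      refine ⟨semiStep_cont hm hc hv1 i1 i4, semiStep_mono hv hm hmono hanti i2 i4, ?_, ?_⟩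
      · simp [semiSeq, semiStep, hv.1.le, h0, i3]
      · simp [semiSeq, semiStep, not_le.2 hv.2, h1, i3]
  have hd : ∀ n, ∀ x ∈ Icc (0:ℝ) 1,
      dist (semiSeq g v n x) (semiSeq g v (n + 1) x) ≤ 1 * (1 / 2) ^ n := by
    intro n
    induction n with
    | zero =>
      intro x hx
      have a1 := (hs 1).2.1 ⟨le_rfl, zero_le_one⟩ hx hx.1
      have a2 := (hs 1).2.1 hx ⟨zero_le_one, le_rfl⟩ hx.2
      rw [(hs 1).2.2.1] at a1
      rw [(hs 1).2.2.2] at a2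
      rw [Real.dist_eq, abs_le]
      simp only [zero_add, pow_zero, semiSeq] at *
      constructor <;> linarith [hx.1, hx.2]
    | succ n ih =>
      intro x hx
      have := ih (g x) (hm hx)
      rw [Real.dist_eq, abs_le] at this ⊢
      change -(1 * (1 / 2) ^ (n + 1)) ≤ semiStep g v (semiSeq g v n) x
          - semiStep g v (semiSeq g v (n + 1)) x ∧
        semiStep g v (semiSeq g v n) x - semiStep g v (semiSeq g v (n + 1)) x
          ≤ 1 * (1 / 2) ^ (n + 1)
      rw [pow_succ]
      unfold semiStep
      split_ifs <;> constructor <;> linarith [this.1, this.2]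
  have hlim : ∀ x ∈ Icc (0:ℝ) 1, ∃ y, Filter.Tendsto (fun n => semiSeq g v n x) Filter.atTop (nhds y) :=
    fun x hx => cauchySeq_tendsto_of_complete
      (cauchySeq_of_le_geometric (1 / 2) 1 (by norm_num) (fun n => hd n x hx))
  choose! φ hφ using hlim
  have hz : (0:ℝ) ∈ Icc (0:ℝ) 1 := ⟨le_rfl, zero_le_one⟩
  have ho : (1:ℝ) ∈ Icc (0:ℝ) 1 := ⟨zero_le_one, le_rfl⟩
  have hφm : MonotoneOn φ (Icc 0 1) := fun x hx y hy hxy =>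
    le_of_tendsto_of_tendsto' (hφ x hx) (hφ y hy) (fun n => (hs n).2.1 hx hy hxy)
  have hφ0 : φ 0 = 0 := tendsto_nhds_unique (hφ 0 hz) (by
    simp only [fun n => (hs n).2.2.1]; exact tendsto_const_nhds)
  have hφ1 : φ 1 = 1 := tendsto_nhds_unique (hφ 1 ho) (by
    simp only [fun n => (hs n).2.2.2]; exact tendsto_const_nhds)
  refine ⟨φ, ?_, hφm, hφ0, hφ1, ?_⟩
  · have hu : TendstoUniformlyOn (semiSeq g v) φ Filter.atTop (Icc 0 1) := by
      rw [Metric.tendstoUniformlyOn_iff]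
      intro ε hε
      have ht : Filter.Tendsto (fun n : ℕ => (1:ℝ) * (1 / 2) ^ n / (1 - 1 / 2)) Filter.atTop
          (nhds 0) := by
        have := ((tendsto_pow_atTop_nhds_zero_of_lt_one (r := (1:ℝ) / 2) (by norm_num)
          (by norm_num)).const_mul 1).div_const (1 - 1 / 2)
        simpa using this
      filter_upwards [ht.eventually (gt_mem_nhds hε)] with n hn x hx
      rw [dist_comm]
      exact lt_of_le_of_lt (dist_le_of_le_geometric_of_tendsto (1 / 2) 1 (by norm_num)
        (fun n => hd n x hx) (hφ x hx) n) hn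
    exact hu.continuousOn (Filter.Frequently.of_forall (fun n => (hs n).1))
  · intro x hx
    have hfix : φ x = semiStep g v φ x := by
      refine tendsto_nhds_unique ((hφ x hx).comp (Filter.tendsto_add_atTop_nat 1)) ?_
      change Filter.Tendsto (fun n => semiStep g v (semiSeq g v n) x) Filter.atTop _
      unfold semiStep
      split_ifs
      · exact (hφ _ (hm hx)).div_const 2
      · exact ((hφ _ (hm hx)).div_const 2).const_sub 1
    have b1 : φ (g x) ≤ 1 := by
      rw [← hφ1]; exact hφm (hm hx) ho (hm hx).2
    rw [hfix]
    unfold semiStep tent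
    split_ifs
    · rw [min_eq_left (by linarith)]; ring
    · rw [min_eq_right (by linarith)]; ring

lemma semiconj_strict (hm : MapsTo g (Icc 0 1) (Icc 0 1))
    (hmono : StrictMonoOn g (Icc 0 v)) (hanti : StrictAntiOn g (Icc v 1))
    (h0 : g 0 = 0) (h1 : g 1 = 0) {φ : ℝ → ℝ}
    (hd : ∀ x y : ℝ, 0 ≤ x → x < y → y ≤ 1 → ∃ z ∈ Icc x y, z ∈ completePreimZero g)
    (hφm : MonotoneOn φ (Icc 0 1)) (hφ0 : φ 0 = 0) (hφ1 : φ 1 = 1)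
    (heq : ∀ x ∈ Icc (0:ℝ) 1, φ (g x) = tent (φ x)) : StrictMonoOn φ (Icc 0 1) := by
  have hit : ∀ n, ∀ x ∈ Icc (0:ℝ) 1, φ (g^[n] x) = tent^[n] (φ x) := by
    intro n
    induction n with
    | zero => intro x _; rfl
    | succ n ih =>
      intro x hx
      rw [Function.iterate_succ_apply, Function.iterate_succ_apply, ih _ (hm hx), heq x hx]
  have hroot : ∀ x ∈ Icc (0:ℝ) 1, g x = 0 → x = 0 ∨ x = 1 := by
    intro x hx hgx
    rcases le_total x v with h | h
    · left
      exact hmono.injOn ⟨hx.1, h⟩ ⟨le_rfl, hx.1.trans h⟩ (by rw [hgx, h0])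
    · right
      exact hanti.injOn ⟨h, hx.2⟩ ⟨h.trans hx.2, le_rfl⟩ (by rw [hgx, h1])
  intro x hx y hy hxy
  refine lt_of_le_of_ne (hφm hx hy hxy.le) fun hne => ?_
  have hconst : ∀ z ∈ Icc x y, z ∈ Icc (0:ℝ) 1 ∧ φ z = φ x := by
    intro z hz
    have hz01 : z ∈ Icc (0:ℝ) 1 := ⟨hx.1.trans hz.1, hz.2.trans hy.2⟩
    refine ⟨hz01, le_antisymm ?_ (hφm hx hz01 hz.1)⟩
    rw [hne]; exact hφm hz01 hy hz.2
  obtain ⟨a, ha, haA⟩ := hd x y hx.1 hxy hy.2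
  obtain ⟨n, hn, han⟩ := mem_complete.1 haA
  -- a subinterval avoiding the finite set
  have hfin := preimZero_finite hm hmono hanti n
  obtain ⟨w, hwI, hwn⟩ := (Ioo_infinite hxy).exists_notMem_finite hfin
  have hopen : IsOpen (Ioo x y ∩ (preimZero g n)ᶜ) := isOpen_Ioo.inter hfin.isClosed.isOpen_compl
  obtain ⟨ε, hε, hball⟩ := Metric.isOpen_iff.1 hopen w ⟨hwI, hwn⟩
  have hsub : ∀ z ∈ Icc (w - ε / 2) (w + ε / 2), z ∈ Ioo x y ∩ (preimZero g n)ᶜ := by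
    intro z hz
    apply hball
    rw [Metric.mem_ball, Real.dist_eq, abs_lt]
    constructor <;> linarith [hz.1, hz.2]
  have e1 := (hsub (w - ε / 2) ⟨le_rfl, by linarith⟩).1
  have e2 := (hsub (w + ε / 2) ⟨by linarith, le_rfl⟩).1
  obtain ⟨b, hb, hbA⟩ := hd (w - ε / 2) (w + ε / 2) (by linarith [hx.1, e1.1]) (by linarith)
    (by linarith [hy.2, e2.2])
  obtain ⟨hbI, hbn⟩ := hsub b hb
  obtain ⟨hb01, hbφ⟩ := hconst b (Ioo_subset_Icc_self hbI)
  obtain ⟨ha01, haφ⟩ := hconst a ha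
  obtain ⟨m, hm1, hbm⟩ := mem_complete.1 hbA
  have hex : ∃ m, b ∈ preimZero g m := ⟨m, hbm⟩
  classical
  set k := Nat.find hex with hk
  have hkb : b ∈ preimZero g k := Nat.find_spec hex
  have hkn : n < k := by
    by_contra! h
    exact hbn (preimZero_mono h0 h hkb)
  obtain ⟨j, hj⟩ : ∃ j, k = j + 1 := ⟨k - 1, by omega⟩
  have hjb : g^[j] b = 1 := by
    have hmem : g^[j] b ∈ Icc (0:ℝ) 1 := hm.iterate j hb01
    rcases hroot _ hmem (by
      rw [← Function.iterate_succ_apply' g j b, ← Nat.succ_eq_add_one] at *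
      rw [hj] at hkb; exact hkb.2) with h | h
    · exact absurd ⟨hb01, h⟩ (Nat.find_min hex (show j < Nat.find hex by omega))
    · exact h
  have hja : g^[j] a = 0 := (preimZero_mono h0 (show n ≤ j by omega) han).2
  have f1 := hit j a ha01
  have f2 := hit j b hb01
  rw [hja, hφ0, haφ] at f1
  rw [hjb, hφ1, hbφ] at f2
  linarith

lemma conj_of_strict (hm : MapsTo g (Icc 0 1) (Icc 0 1)) {φ : ℝ → ℝ}
    (hc : ContinuousOn φ (Icc 0 1)) (hφ : StrictMonoOn φ (Icc 0 1)) (hφ0 : φ 0 = 0)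
    (hφ1 : φ 1 = 1)
    (heq : ∀ x ∈ Icc (0:ℝ) 1, φ (g x) = tent (φ x)) : ∃ h, ConjTent g h := by
  have hz : (0:ℝ) ∈ Icc (0:ℝ) 1 := ⟨le_rfl, zero_le_one⟩
  have ho : (1:ℝ) ∈ Icc (0:ℝ) 1 := ⟨zero_le_one, le_rfl⟩
  have hmaps : MapsTo φ (Icc 0 1) (Icc 0 1) := fun x hx =>
    ⟨by rw [← hφ0]; exact hφ.monotoneOn hz hx hx.1, by
      rw [← hφ1]; exact hφ.monotoneOn hx ho hx.2⟩
  have hsurj : SurjOn φ (Icc 0 1) (Icc 0 1) := by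
    have := intermediate_value_Icc zero_le_one hc
    rwa [hφ0, hφ1] at this
  let ψ : Icc (0:ℝ) 1 → Icc (0:ℝ) 1 := fun x => ⟨φ x, hmaps x.2⟩
  have hψm : StrictMono ψ := fun x y hxy => hφ x.2 y.2 hxy
  have hψs : Function.Surjective ψ := by
    rintro ⟨y, hy⟩
    obtain ⟨x, hx, rfl⟩ := hsurj hy
    exact ⟨⟨x, hx⟩, rfl⟩
  let e := hψm.orderIsoOfSurjective ψ hψs
  have heψ : ∀ x, e x = ψ x := fun x => rfl
  let h : ℝ → ℝ := IccExtend zero_le_one (fun x => (e.symm x : ℝ))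
  have hh : ∀ x (hx : x ∈ Icc (0:ℝ) 1), h x = e.symm ⟨x, hx⟩ := fun x hx =>
    IccExtend_of_mem _ _ hx
  have hhφ : ∀ x ∈ Icc (0:ℝ) 1, h (φ x) = x := by
    intro x hx
    rw [hh _ (hmaps hx)]
    have : (⟨φ x, hmaps hx⟩ : Icc (0:ℝ) 1) = e ⟨x, hx⟩ := rfl
    rw [this, e.symm_apply_apply]
  refine ⟨h, ⟨?_, ?_, ?_, ?_⟩, ?_, ?_⟩
  · have : Continuous h := (continuous_subtype_val.comp e.symm.continuous).Icc_extend'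
    exact this.continuousOn
  · intro x hx
    rw [hh x hx]; exact (e.symm ⟨x, hx⟩).2
  · intro x hx y hy hxy
    rw [hh x hx, hh y hy] at hxy
    have := e.symm.injective (Subtype.ext hxy)
    exact congrArg Subtype.val this
  · intro x hx
    exact ⟨φ x, hmaps hx, hhφ x hx⟩
  · have := hhφ 0 hz
    rwa [hφ0] at this
  · intro x hx
    obtain ⟨z, hz, rfl⟩ := hsurj hx
    rw [← heq z hz, hhφ z hz, hhφ _ (hm hz)]

end Uni

/-- For every firm carcass map `g`, the complete pre-image of `0` is dense
in `[0,1]`; consequently `g` is topologically conjugated to the tent map. -/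
theorem firm_dense_preimage_and_conjugate (g : ℝ → ℝ) (hg : IsFirm g) :
    Icc (0:ℝ) 1 ⊆ closure (completePreimZero g) ∧ ∃ h : ℝ → ℝ, ConjTent g h := by
  have hd : ∀ x y : ℝ, 0 ≤ x → x < y → y ≤ 1 → ∃ z ∈ Icc x y, z ∈ completePreimZero g :=
    fun x y hx hxy hy => firm_interval hg hx hxy hy
  refine ⟨dense_of_interval hd, ?_⟩
  obtain ⟨⟨⟨hc, hm, v, hv, hmono, hanti, h0, h1, hv1⟩, -⟩, -⟩ := hg
  obtain ⟨φ, hφc, hφm, hφ0, hφ1, heq⟩ := exists_semiconj hv hm hc hmono hanti h0 h1 hv1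
  exact conj_of_strict hm hφc (semiconj_strict hm hmono hanti h0 h1 hd hφm hφ0 hφ1 heq) hφ0 hφ1 heq
end

section
/- Let g be a carcass map whose complete pre-image of 0 is dense in [0,1]. For every self-semiconjugation ψ of g there exists a natural number t ≥ 1 such that ψ(μ_{n,k}(g)) = μ_{n,t·k}(g) for all n ≥ 1 and all k with 0 ≤ k ≤ ⌊2^{n-1}/t⌋. -/
open Set

/-- Distance to the nearest even integer. -/
noncomputable def pf (y : ℝ) : ℝ := |y - 2 * (round (y / 2) : ℤ)|

lemma pf_le (y : ℝ) (m : ℤ) : pf y ≤ |y - 2 * m| := by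
  have h := round_le (y / 2) m
  unfold pf
  have e1 : y - 2 * (round (y / 2) : ℤ) = 2 * (y / 2 - (round (y / 2) : ℤ)) := by ring
  have e2 : y - 2 * (m : ℝ) = 2 * (y / 2 - m) := by ring
  rw [e1, e2, abs_mul, abs_mul]
  gcongr

lemma pf_spec (y : ℝ) : ∃ m : ℤ, pf y = y + 2 * m ∨ pf y = -y + 2 * m := by
  unfold pf
  rcases abs_choice (y - 2 * (round (y / 2) : ℤ)) with h | h
  · exact ⟨-round (y / 2), Or.inl (by rw [h]; push_cast; ring)⟩
  · exact ⟨round (y / 2), Or.inr (by rw [h]; ring)⟩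

lemma pf_nonneg (y : ℝ) : 0 ≤ pf y := abs_nonneg _

lemma pf_le_one (y : ℝ) : pf y ≤ 1 := by
  have h := abs_sub_round (y / 2)
  unfold pf
  have e1 : y - 2 * (round (y / 2) : ℤ) = 2 * (y / 2 - (round (y / 2) : ℤ)) := by ring
  rw [e1, abs_mul, abs_two]
  linarith

lemma pf_mem (y : ℝ) : pf y ∈ Icc (0:ℝ) 1 := ⟨pf_nonneg y, pf_le_one y⟩

lemma pf_add (y : ℝ) (m : ℤ) : pf (y + 2 * m) = pf y := by
  unfold pf
  have : (y + 2 * m) / 2 = y / 2 + m := by ring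
  rw [this, round_add_intCast]
  push_cast
  congr 1
  ring

lemma pf_lip (y z : ℝ) : |pf y - pf z| ≤ |y - z| := by
  have key : ∀ y z : ℝ, pf y ≤ |y - z| + pf z := by
    intro y z
    calc pf y ≤ |y - 2 * (round (z / 2) : ℤ)| := pf_le y _
      _ = |(y - z) + (z - 2 * (round (z / 2) : ℤ))| := by congr 1; ring
      _ ≤ _ := abs_add_le _ _
  rw [abs_le]
  have h1 := key y z
  have h2 := key z y
  rw [abs_sub_comm z y] at h2
  constructor <;> linarith

lemma pf_neg (y : ℝ) : pf (-y) = pf y := by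
  have key : ∀ y : ℝ, pf (-y) ≤ pf y := by
    intro y
    calc pf (-y) ≤ |-y - 2 * ((-round (y / 2) : ℤ) : ℝ)| := pf_le _ _
      _ = |-(y - 2 * (round (y / 2) : ℤ))| := by congr 1; push_cast; ring
      _ = pf y := by rw [abs_neg]; rfl
  apply le_antisymm (key y)
  simpa using key (-y)

lemma pf_id {x : ℝ} (hx : x ∈ Icc (0:ℝ) 1) : pf x = x := by
  apply le_antisymm
  · have := pf_le x 0
    simpa [abs_of_nonneg hx.1] using this
  · unfold pf
    generalize round (x / 2) = m
    rcases le_or_gt m 0 with h | h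
    · have : (m : ℝ) ≤ 0 := by exact_mod_cast h
      exact le_trans (by linarith) (le_abs_self _)
    · have : (1 : ℝ) ≤ m := by exact_mod_cast h
      exact le_trans (by linarith [hx.2]) (neg_le_abs _)

lemma pf_eq {y z : ℝ} (h : pf y = pf z) :
    ∃ m : ℤ, y = z + 2 * m ∨ y = -z + 2 * m := by
  obtain ⟨a, ha⟩ := pf_spec y
  obtain ⟨b, hb⟩ := pf_spec z
  rcases ha with ha | ha <;> rcases hb with hb | hb
  · exact ⟨b - a, Or.inl (by push_cast; linarith)⟩
  · exact ⟨b - a, Or.inr (by push_cast; linarith)⟩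
  · exact ⟨a - b, Or.inr (by push_cast; linarith)⟩
  · exact ⟨a - b, Or.inl (by push_cast; linarith)⟩

lemma tent_pf (y : ℝ) : tent (pf y) = pf (2 * y) := by
  have h1 : ∀ x ∈ Icc (0:ℝ) 1, tent x = pf (2 * x) := by
    intro x hx
    unfold tent
    rcases le_total x (1 / 2) with h | h
    · rw [min_eq_left (by linarith), pf_id ⟨by linarith [hx.1], by linarith⟩]
    · rw [min_eq_right (by linarith), ← pf_neg, ← pf_add _ 1,
        pf_id ⟨by push_cast; linarith [hx.2], by push_cast; linarith⟩]
      push_cast; ring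
  rw [h1 _ (pf_mem y)]
  obtain ⟨m, h | h⟩ := pf_spec y
  · rw [h, ← pf_add (2 * y) (2 * m)]; congr 1; push_cast; ring
  · rw [h, ← pf_neg (2 * y), ← pf_add (-(2 * y)) (2 * m)]; congr 1; push_cast; ring

lemma tent_iter_pf (n : ℕ) (y : ℝ) : tent^[n] (pf y) = pf (2 ^ n * y) := by
  induction n with
  | zero => simp
  | succ n ih => rw [Function.iterate_succ_apply', ih, tent_pf]; congr 1; ring

lemma pf_iso {a b : ℝ} (hab : a ≤ b) (h : b ≤ ⌊a⌋ + 1) : |pf a - pf b| = b - a := by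
  have h0 := Int.floor_le a
  rcases Int.even_or_odd' ⌊a⌋ with ⟨k, hk | hk⟩
  · rw [hk] at h h0
    push_cast at h h0
    have e : ∀ x : ℝ, 2 * (k:ℝ) ≤ x → x ≤ 2 * k + 1 → pf x = x - 2 * k := by
      intro x h1 h2
      have := pf_id (x := x - 2 * k) ⟨by linarith, by linarith⟩
      rw [← this, ← pf_add x (-k)]; congr 1; push_cast; ring
    rw [e a h0 (by linarith), e b (by linarith) h, abs_sub_comm, abs_of_nonneg] <;> linarith
  · rw [hk] at h h0
    push_cast at h h0
    have e : ∀ x : ℝ, 2 * (k:ℝ) + 1 ≤ x → x ≤ 2 * k + 2 → pf x = 2 * k + 2 - x := by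
      intro x h1 h2
      have := pf_id (x := 2 * k + 2 - x) ⟨by linarith, by linarith⟩
      rw [← this, ← pf_neg x, ← pf_add (-x) (k + 1)]; congr 1; push_cast; ring
    rw [e a h0 (by linarith), e b (by linarith) (by linarith), abs_of_nonneg] <;> linarith

/-- On an interval of length `1/2`, `pf` oscillates by at least `1/4`. -/
lemma pf_osc (u : ℝ) : |pf u - pf (u + 1/4)| = 1/4 ∨ |pf (u + 1/4) - pf (u + 1/2)| = 1/4 := by
  by_cases h : u + 1/4 ≤ ⌊u⌋ + 1
  · left; rw [pf_iso (by linarith) h]; ring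
  · right
    push Not at h
    rw [pf_iso (by linarith)]
    · ring
    · have : ⌊u⌋ + 1 ≤ ⌊u + 1/4⌋ := by
        rw [Int.le_floor]; push_cast; linarith
      have h2 : ((⌊u⌋ : ℝ) + 1) ≤ (⌊u + 1/4⌋ : ℝ) := by exact_mod_cast this
      have := Int.lt_floor_add_one u
      linarith

lemma comm_iter {φ : ℝ → ℝ} (hm : MapsTo φ (Icc 0 1) (Icc 0 1))
    (hcomm : ∀ x ∈ Icc (0:ℝ) 1, φ (tent x) = tent (φ x)) (n : ℕ) {z : ℝ}
    (hz : z ∈ Icc (0:ℝ) 1) : φ (pf (2 ^ n * z)) = pf (2 ^ n * φ z) := by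
  induction n with
  | zero => simp [pf_id hz, pf_id (hm hz)]
  | succ n ih =>
    have e : ∀ y : ℝ, (2:ℝ) ^ (n + 1) * y = 2 * (2 ^ n * y) := by intro y; ring
    rw [e, e, ← tent_pf, ← tent_pf, hcomm _ (pf_mem _), ih]

lemma comm_lip {φ : ℝ → ℝ} (hc : ContinuousOn φ (Icc 0 1)) (hm : MapsTo φ (Icc 0 1) (Icc 0 1))
    (hcomm : ∀ x ∈ Icc (0:ℝ) 1, φ (tent x) = tent (φ x)) :
    ∃ C : ℝ, 0 ≤ C ∧ ∀ x ∈ Icc (0:ℝ) 1, ∀ y ∈ Icc (0:ℝ) 1, |φ x - φ y| ≤ C * |x - y| := by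
  have huc := isCompact_Icc.uniformContinuousOn_of_continuous hc
  rw [Metric.uniformContinuousOn_iff] at huc
  obtain ⟨δ', hδ', hδ⟩ := huc (1/4) (by norm_num)
  simp only [Real.dist_eq] at hδ
  obtain ⟨δ, hδ0, hδδ⟩ : ∃ δ, 0 < δ ∧ δ < δ' := ⟨δ' / 2, by linarith, by linarith⟩
  refine ⟨1 / δ, by positivity, ?_⟩
  suffices H : ∀ x ∈ Icc (0:ℝ) 1, ∀ y ∈ Icc (0:ℝ) 1, x < y → |φ x - φ y| ≤ 1 / δ * (y - x) by
    intro x hx y hy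
    rcases lt_trichotomy x y with h | h | h
    · rw [abs_sub_comm x y, abs_of_pos (sub_pos.2 h)]; exact H x hx y hy h
    · subst h; simp
    · rw [abs_of_pos (sub_pos.2 h), abs_sub_comm]; exact H y hy x hx h
  intro x hx y hy hxy
  have hd : 0 < y - x := sub_pos.2 hxy
  by_cases hbig : δ ≤ y - x
  · have h1 : 1 ≤ 1 / δ * (y - x) := by
      rw [one_div, inv_mul_eq_div, le_div_iff₀ hδ0]; linarith
    have h2 := hm hx
    have h3 := hm hy
    refine le_trans ?_ h1
    rw [abs_le]; constructor <;> linarith [h2.1, h2.2, h3.1, h3.2]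
  push Not at hbig
  obtain ⟨n, hn1, hn2⟩ := exists_nat_pow_near (x := δ / (y - x)) (y := (2:ℝ))
    (by rw [le_div_iff₀ hd]; linarith) (by norm_num)
  rw [le_div_iff₀ hd] at hn1
  rw [div_lt_iff₀ hd] at hn2
  have hpow : (0:ℝ) < 2 ^ n := by positivity
  have hsub : Icc x y ⊆ Icc (0:ℝ) 1 := Icc_subset_Icc hx.1 hy.2
  have hosc : ∀ z ∈ Icc x y, ∀ w ∈ Icc x y, |pf (2 ^ n * φ z) - pf (2 ^ n * φ w)| < 1/4 := by
    intro z hz w hw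
    rw [← comm_iter hm hcomm n (hsub hz), ← comm_iter hm hcomm n (hsub hw)]
    apply hδ _ (pf_mem _) _ (pf_mem _)
    refine lt_of_le_of_lt (pf_lip _ _) ?_
    rw [← mul_sub, abs_mul, abs_of_pos hpow]
    have : |z - w| ≤ y - x := by
      rw [abs_le]; constructor <;> linarith [hz.1, hz.2, hw.1, hw.2]
    nlinarith
  have hcont : ContinuousOn (fun z => 2 ^ n * φ z) (uIcc x y) := by
    rw [uIcc_of_le hxy.le]
    exact continuousOn_const.mul (hc.mono hsub)
  have hivt := intermediate_value_uIcc hcont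
  rw [uIcc_of_le hxy.le] at hivt
  have hmain : |2 ^ n * φ x - 2 ^ n * φ y| ≤ 1/2 := by
    by_contra hcon
    push Not at hcon
    obtain ⟨u, hu⟩ : ∃ u : ℝ, ∀ s ∈ Icc (0:ℝ) (1/2), u + s ∈ uIcc (2 ^ n * φ x) (2 ^ n * φ y) := by
      refine ⟨min (2 ^ n * φ x) (2 ^ n * φ y), fun s hs => ?_⟩
      have := max_sub_min_eq_abs (2 ^ n * φ x) (2 ^ n * φ y)
      rw [abs_sub_comm] at this
      rw [uIcc, mem_Icc]
      constructor <;> linarith [hs.1, hs.2]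
    obtain ⟨z0, hz0, e0⟩ := hivt (hu 0 ⟨by norm_num, by norm_num⟩)
    obtain ⟨z1, hz1, e1⟩ := hivt (hu (1/4) ⟨by norm_num, by norm_num⟩)
    obtain ⟨z2, hz2, e2⟩ := hivt (hu (1/2) ⟨by norm_num, by norm_num⟩)
    have o1 := hosc z0 hz0 z1 hz1
    have o2 := hosc z1 hz1 z2 hz2
    simp only at e0 e1 e2
    rw [e0, e1] at o1
    rw [e1, e2] at o2
    rw [add_zero] at o1
    rcases pf_osc u with h | h <;> linarith
  rw [← mul_sub, abs_mul, abs_of_pos hpow] at hmain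
  rw [one_div, inv_mul_eq_div, le_div_iff₀ hδ0]
  rw [pow_succ] at hn2
  have h0 := abs_nonneg (φ x - φ y)
  calc |φ x - φ y| * δ ≤ |φ x - φ y| * (2 ^ n * 2 * (y - x)) := by gcongr
    _ = (2 ^ n * |φ x - φ y|) * (2 * (y - x)) := by ring
    _ ≤ (1/2) * (2 * (y - x)) := by gcongr
    _ = y - x := by ring

lemma comm_diff {φ : ℝ → ℝ} (hc : ContinuousOn φ (Icc 0 1)) (hm : MapsTo φ (Icc 0 1) (Icc 0 1))
    (hcomm : ∀ x ∈ Icc (0:ℝ) 1, φ (tent x) = tent (φ x)) :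
    ∃ x₀ ∈ Ico (0:ℝ) 1, ∃ c : ℝ, HasDerivWithinAt φ c (Icc 0 1) x₀ := by
  obtain ⟨C, hC, hlip⟩ := comm_lip hc hm hcomm
  have hL : LipschitzOnWith ⟨C, hC⟩ φ (Icc 0 1) :=
    LipschitzOnWith.of_dist_le_mul fun x hx y hy => by
      rw [Real.dist_eq, Real.dist_eq]; exact hlip x hx y hy
  have hae := hL.ae_differentiableWithinAt_of_mem_real
  by_contra hcon
  push Not at hcon
  have hsub : Ico (0:ℝ) 1 ⊆ {x | ¬ (x ∈ Icc (0:ℝ) 1 → DifferentiableWithinAt ℝ φ (Icc 0 1) x)} := by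
    intro x hx h
    exact hcon x hx _ (h ⟨hx.1, hx.2.le⟩).hasDerivWithinAt
  have h0 := MeasureTheory.measure_mono_null hsub hae
  simp at h0

lemma comm_blowup {φ : ℝ → ℝ} (hm : MapsTo φ (Icc 0 1) (Icc 0 1))
    (hcomm : ∀ x ∈ Icc (0:ℝ) 1, φ (tent x) = tent (φ x)) {x₀ c : ℝ} (hx₀ : x₀ ∈ Ico (0:ℝ) 1)
    (hd : HasDerivWithinAt φ c (Icc 0 1) x₀) {ε : ℝ} (hε : 0 < ε) :
    ∃ b : ℝ, ∀ x ∈ Icc (0:ℝ) 1, |φ x - pf (c * x + b)| ≤ ε := by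
  have hb := hd.hasFDerivWithinAt.isLittleO.def hε
  rw [Filter.Eventually, Metric.mem_nhdsWithin_iff] at hb
  obtain ⟨η, hη, hb⟩ := hb
  obtain ⟨n, hn⟩ := exists_pow_lt_of_lt_one hη (show (1/2 : ℝ) < 1 by norm_num)
  have hpow : (0:ℝ) < 2 ^ n := by positivity
  have hpw : (1/2 : ℝ) ^ n * 2 ^ n = 1 := by rw [← mul_pow]; norm_num
  have hfl := Int.floor_le (2 ^ n * x₀)
  have hfl2 := Int.lt_floor_add_one (2 ^ n * x₀)
  have hf0 : (0:ℝ) ≤ ⌊2 ^ n * x₀⌋ := by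
    have : (0:ℤ) ≤ ⌊2 ^ n * x₀⌋ := Int.floor_nonneg.2 (mul_nonneg hpow.le hx₀.1)
    exact_mod_cast this
  have hf1 : (⌊2 ^ n * x₀⌋ : ℝ) + 1 ≤ 2 ^ n := by
    have h : ⌊2 ^ n * x₀⌋ < (2 ^ n : ℤ) := by
      rw [Int.floor_lt]; push_cast; nlinarith [hx₀.2]
    have h2 : ⌊2 ^ n * x₀⌋ + 1 ≤ (2 ^ n : ℤ) := h
    exact_mod_cast h2
  obtain ⟨s, e, hs, he⟩ : ∃ (s : ℝ) (e : ℤ), (s = 1 ∨ s = -1) ∧ ∀ x ∈ Icc (0:ℝ) 1,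
      (⌊2 ^ n * x₀⌋ : ℝ) ≤ 2 * e + s * x ∧ 2 * e + s * x ≤ ⌊2 ^ n * x₀⌋ + 1 := by
    rcases Int.even_or_odd' ⌊2 ^ n * x₀⌋ with ⟨k, hk | hk⟩
    · refine ⟨1, k, Or.inl rfl, fun x hx => ?_⟩
      rw [hk]; push_cast
      constructor <;> linarith [hx.1, hx.2]
    · refine ⟨-1, k + 1, Or.inr rfl, fun x hx => ?_⟩
      rw [hk]; push_cast
      constructor <;> linarith [hx.1, hx.2]
  have hss : s * s = 1 := by rcases hs with h | h <;> rw [h] <;> norm_num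
  have hpfs : ∀ z, pf (s * z) = pf z := by
    intro z
    rcases hs with h | h <;> rw [h]
    · simp
    · rw [neg_one_mul, pf_neg]
  refine ⟨s * (2 ^ n * φ x₀ + c * (2 * e - 2 ^ n * x₀)), fun x hx => ?_⟩
  obtain ⟨h1, h2⟩ := he x hx
  set y := (2 * e + s * x) / 2 ^ n with hy
  have hny : 2 ^ n * y = 2 * e + s * x := by rw [hy]; field_simp
  have hyI : y ∈ Icc (0:ℝ) 1 := by
    constructor
    · apply div_nonneg _ hpow.le; linarith
    · rw [hy, div_le_one hpow]; linarith
  have hdist : |2 ^ n * (y - x₀)| ≤ 1 := by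
    rw [mul_sub, hny, abs_le]; constructor <;> linarith
  have hyd : 2 ^ n * |y - x₀| ≤ 1 := by rwa [abs_mul, abs_of_pos hpow] at hdist
  have hyη : |y - x₀| < η := by
    have : |y - x₀| ≤ (1/2) ^ n := by
      calc |y - x₀| = (1/2) ^ n * (2 ^ n * |y - x₀|) := by rw [← mul_assoc, hpw, one_mul]
        _ ≤ (1/2) ^ n * 1 := by gcongr
        _ = _ := mul_one _
    linarith
  have hmem := hb ⟨by rw [Metric.mem_ball, Real.dist_eq]; exact hyη, hyI⟩
  simp only [mem_ofPred_eq, Real.norm_eq_abs] at hmem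
  have hx' : φ x = pf (2 ^ n * φ y) := by
    rw [← comm_iter hm hcomm n hyI, hny]
    congr 1
    rw [add_comm, pf_add, hpfs, pf_id hx]
  rw [hx', ← hpfs (c * x + _)]
  refine le_trans (pf_lip _ _) ?_
  have e1 : 2 ^ n * φ y - s * (c * x + s * (2 ^ n * φ x₀ + c * (2 * e - 2 ^ n * x₀)))
      = 2 ^ n * (φ y - φ x₀ - (y - x₀) * c) := by
    linear_combination (c : ℝ) * hny - (2 ^ n * φ x₀ + c * (2 * e - 2 ^ n * x₀)) * hss
  rw [e1, abs_mul, abs_of_pos hpow]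
  have hm2 : |φ y - φ x₀ - (y - x₀) * c| ≤ ε * |y - x₀| := by
    simpa using hmem
  calc 2 ^ n * |φ y - φ x₀ - (y - x₀) * c| ≤ 2 ^ n * (ε * |y - x₀|) := by gcongr
    _ = ε * (2 ^ n * |y - x₀|) := by ring
    _ ≤ ε * 1 := by gcongr
    _ = ε := mul_one _

lemma comm_affine {φ : ℝ → ℝ} {c : ℝ}
    (h : ∀ ε > 0, ∃ b : ℝ, ∀ x ∈ Icc (0:ℝ) 1, |φ x - pf (c * x + b)| ≤ ε) :
    ∃ b : ℝ, ∀ x ∈ Icc (0:ℝ) 1, φ x = pf (c * x + b) := by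
  by_contra hcon
  push Not at hcon
  obtain ⟨x1, hx1, h1⟩ := hcon (φ 0)
  obtain ⟨x2, hx2, h2⟩ := hcon (-φ 0)
  have p1 := abs_pos.2 (sub_ne_zero.2 h1)
  have p2 := abs_pos.2 (sub_ne_zero.2 h2)
  obtain ⟨ε, hε, hε1, hε2⟩ : ∃ ε > 0, 2 * ε < |φ x1 - pf (c * x1 + φ 0)| ∧
      2 * ε < |φ x2 - pf (c * x2 + -φ 0)| := by
    refine ⟨min |φ x1 - pf (c * x1 + φ 0)| |φ x2 - pf (c * x2 + -φ 0)| / 4, by positivity, ?_, ?_⟩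
    · have := min_le_left |φ x1 - pf (c * x1 + φ 0)| |φ x2 - pf (c * x2 + -φ 0)|
      linarith
    · have := min_le_right |φ x1 - pf (c * x1 + φ 0)| |φ x2 - pf (c * x2 + -φ 0)|
      linarith
  obtain ⟨b, hb⟩ := h ε hε
  have h0 := hb 0 ⟨le_rfl, zero_le_one⟩
  rw [mul_zero, zero_add] at h0
  obtain ⟨m, hm | hm⟩ := pf_spec b
  · have t1 := hb x1 hx1
    have t2 : |pf (c * x1 + b) - pf (c * x1 + φ 0)| ≤ ε := by
      rw [← pf_add (c * x1 + b) m]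
      refine le_trans (pf_lip _ _) ?_
      rw [abs_sub_comm, hm] at h0
      have e : c * x1 + b + 2 * m - (c * x1 + φ 0) = b + 2 * m - φ 0 := by ring
      rw [e]; exact h0
    have := abs_sub_le (φ x1) (pf (c * x1 + b)) (pf (c * x1 + φ 0))
    linarith
  · have t1 := hb x2 hx2
    have t2 : |pf (c * x2 + b) - pf (c * x2 + -φ 0)| ≤ ε := by
      rw [← pf_add (c * x2 + b) (-m)]
      refine le_trans (pf_lip _ _) ?_
      rw [hm] at h0
      have e : c * x2 + b + 2 * (-m : ℤ) - (c * x2 + -φ 0) = φ 0 - (-b + 2 * m) := by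
        push_cast; ring
      rw [e]; exact h0
    have := abs_sub_le (φ x2) (pf (c * x2 + b)) (pf (c * x2 + -φ 0))
    linarith

theorem tent_comm {φ : ℝ → ℝ} (hc : ContinuousOn φ (Icc 0 1))
    (hm : MapsTo φ (Icc 0 1) (Icc 0 1)) (hs : SurjOn φ (Icc 0 1) (Icc 0 1))
    (hcomm : ∀ x ∈ Icc (0:ℝ) 1, φ (tent x) = tent (φ x)) :
    ∃ c : ℤ, c ≠ 0 ∧ ∀ x ∈ Icc (0:ℝ) 1, φ x = pf (c * x) := by
  obtain ⟨x₀, hx₀, c, hd⟩ := comm_diff hc hm hcomm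
  obtain ⟨b, hb⟩ := comm_affine fun ε hε => comm_blowup hm hcomm hx₀ hd hε
  have hc0 : c ≠ 0 := by
    rintro rfl
    obtain ⟨x, hx, e1⟩ := hs (show (0:ℝ) ∈ Icc (0:ℝ) 1 by simp)
    obtain ⟨y, hy, e2⟩ := hs (show (1:ℝ) ∈ Icc (0:ℝ) 1 by simp)
    rw [hb x hx] at e1
    rw [hb y hy] at e2
    simp only [zero_mul] at e1 e2
    linarith
  -- a small test point
  obtain ⟨w, hw0, hw1, hwc⟩ : ∃ w : ℝ, 0 < w ∧ w ≤ 1/4 ∧ |2 * c * w| < 1 := by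
    have hcp : 0 < |c| := abs_pos.2 hc0
    refine ⟨1 / (4 * (1 + |c|)), by positivity, ?_, ?_⟩
    · apply one_div_le_one_div_of_le <;> linarith
    · rw [abs_mul, abs_mul, abs_two, abs_of_pos (show 0 < 1 / (4 * (1 + |c|)) by positivity),
        mul_one_div, div_lt_one (by positivity)]
      linarith
  have hwn : ∀ k : ℤ, 2 * c * w ≠ k := by
    intro k hk
    rw [hk] at hwc
    have : |k| < 1 := by exact_mod_cast hwc
    rw [Int.abs_lt_one_iff] at this
    rw [this, Int.cast_zero] at hk
    have : 2 * c * w ≠ 0 := by positivity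
    exact this hk
  have hbe : ∃ m : ℤ, b = 2 * m := by
    have key : ∀ x ∈ Icc (0:ℝ) (1/2), pf (2 * c * x + b) = pf (2 * c * x + 2 * b) := by
      intro x hx
      have hxI : x ∈ Icc (0:ℝ) 1 := ⟨hx.1, by linarith [hx.2]⟩
      have h := hcomm x hxI
      have ht : tent x = 2 * x := min_eq_left (by linarith [hx.2])
      rw [ht, hb x hxI, tent_pf, hb (2 * x) ⟨by linarith [hx.1], by linarith [hx.2]⟩] at h
      convert h using 2 <;> ring
    obtain ⟨m, h | h⟩ := pf_eq (key 0 ⟨le_rfl, by norm_num⟩)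
    · exact ⟨-m, by push_cast; linarith⟩
    obtain ⟨k, h' | h'⟩ := pf_eq (key w ⟨hw0.le, by linarith⟩)
    · exact ⟨-k, by push_cast; linarith⟩
    exact absurd (by push_cast; linarith) (hwn (k - m))
  obtain ⟨m, hbm⟩ := hbe
  have hb' : ∀ x ∈ Icc (0:ℝ) 1, φ x = pf (c * x) := by
    intro x hx
    rw [hb x hx, hbm, pf_add]
  have hci : ∃ k : ℤ, c = k := by
    have key : ∀ x ∈ Icc (1/2:ℝ) 1, pf (2 * c - 2 * c * x) = pf (2 * c * x) := by
      intro x hx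
      have hxI : x ∈ Icc (0:ℝ) 1 := ⟨by linarith [hx.1], hx.2⟩
      have h := hcomm x hxI
      have ht : tent x = 2 - 2 * x := min_eq_right (by linarith [hx.1])
      rw [ht, hb' x hxI, tent_pf, hb' (2 - 2 * x) ⟨by linarith [hx.2], by linarith [hx.1]⟩] at h
      convert h using 2 <;> ring
    obtain ⟨k, h' | h'⟩ := pf_eq (key (1/2 + w) ⟨by linarith, by linarith⟩)
    · exact absurd (by push_cast; linarith) (hwn (-k))
    · exact ⟨k, by linarith⟩
  obtain ⟨k, rfl⟩ := hci
  exact ⟨k, by exact_mod_cast hc0, hb'⟩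

/-- Approximating sequence for the conjugacy with the tent map. -/
noncomputable def hseq (g : ℝ → ℝ) (v : ℝ) : ℕ → ℝ → ℝ
  | 0 => fun x => x
  | n + 1 => fun x => if x ≤ v then hseq g v n (g x) / 2 else 1 - hseq g v n (g x) / 2

lemma hseq_props {g : ℝ → ℝ} {v : ℝ} (hc : ContinuousOn g (Icc 0 1))
    (hm : MapsTo g (Icc 0 1) (Icc 0 1)) (hv : v ∈ Ioo (0:ℝ) 1) (hmono : StrictMonoOn g (Icc 0 v))
    (hanti : StrictAntiOn g (Icc v 1)) (h0 : g 0 = 0) (h1 : g 1 = 0) (hgv : g v = 1) (n : ℕ) :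
    hseq g v n 0 = 0 ∧ hseq g v n 1 = 1 ∧ MonotoneOn (hseq g v n) (Icc 0 1) ∧
      ContinuousOn (hseq g v n) (Icc 0 1) := by
  induction n with
  | zero => exact ⟨rfl, rfl, fun x _ y _ h => h, continuousOn_id⟩
  | succ n ih =>
    obtain ⟨i0, i1, im, ic⟩ := ih
    have I0 : (0:ℝ) ∈ Icc (0:ℝ) 1 := by simp
    have I1 : (1:ℝ) ∈ Icc (0:ℝ) 1 := by simp
    have hle1 : ∀ x ∈ Icc (0:ℝ) 1, hseq g v n (g x) ≤ 1 := fun x hx => by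
      rw [← i1]; exact im (hm hx) I1 (hm hx).2
    refine ⟨?_, ?_, ?_, ?_⟩
    · simp [hseq, hv.1.le, h0, i0]
    · simp [hseq, not_le.2 hv.2, h1, i0]
    · intro x hx y hy hxy
      simp only [hseq]
      split_ifs with hxv hyv hyv
      · have := im (hm hx) (hm hy) (hmono.monotoneOn ⟨hx.1, hxv⟩ ⟨hy.1, hyv⟩ hxy)
        linarith
      · linarith [hle1 x hx, hle1 y hy]
      · linarith
      · have := im (hm hy) (hm hx) (hanti.antitoneOn ⟨by linarith, hx.2⟩ ⟨by linarith, hy.2⟩ hxy)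
        linarith
    · have hcomp : ContinuousOn (fun x => hseq g v n (g x)) (Icc 0 1) := ic.comp hc hm
      have hu : Icc (0:ℝ) 1 = Icc 0 v ∪ Icc v 1 := (Icc_union_Icc_eq_Icc hv.1.le hv.2.le).symm
      rw [hu]
      apply ContinuousOn.union_of_isClosed _ _ isClosed_Icc isClosed_Icc
      · refine ((hcomp.mono (Icc_subset_Icc le_rfl hv.2.le)).div_const 2).congr fun x hx => ?_
        simp [hseq, hx.2]
      · refine (continuousOn_const (c := (1:ℝ)).sub
          ((hcomp.mono (Icc_subset_Icc hv.1.le le_rfl)).div_const 2)).congr fun x hx => ?_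
        simp only [hseq]
        split_ifs with h
        · have : x = v := le_antisymm h hx.1
          have e : hseq g v n (g x) = 1 := by rw [this, hgv, i1]
          simp only [Pi.sub_apply, e]; norm_num
        · rfl

lemma exists_semi {g : ℝ → ℝ} (hg : IsUnimodal g) :
    ∃ H : ℝ → ℝ, ContinuousOn H (Icc 0 1) ∧ MonotoneOn H (Icc 0 1) ∧ H 0 = 0 ∧ H 1 = 1 ∧
      ∀ x ∈ Icc (0:ℝ) 1, H (g x) = tent (H x) := by
  obtain ⟨hc, hm, v, hv, hmono, hanti, h0, h1, hgv⟩ := hg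
  have P := hseq_props hc hm hv hmono hanti h0 h1 hgv
  have I0 : (0:ℝ) ∈ Icc (0:ℝ) 1 := by simp
  have I1 : (1:ℝ) ∈ Icc (0:ℝ) 1 := by simp
  have hrange : ∀ n, ∀ x ∈ Icc (0:ℝ) 1, hseq g v n x ∈ Icc (0:ℝ) 1 := by
    intro n x hx
    obtain ⟨i0, i1, im, -⟩ := P n
    constructor
    · rw [← i0]; exact im I0 hx hx.1
    · rw [← i1]; exact im hx I1 hx.2
  have hdist : ∀ n, ∀ x ∈ Icc (0:ℝ) 1,
      dist (hseq g v n x) (hseq g v (n + 1) x) ≤ 1 * (1/2) ^ n := by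
    intro n
    induction n with
    | zero =>
      intro x hx
      have a := hrange 0 x hx
      have b := hrange 1 x hx
      rw [Real.dist_eq, abs_le, pow_zero]
      constructor <;> linarith [a.1, a.2, b.1, b.2]
    | succ n ih =>
      intro x hx
      have := ih (g x) (hm hx)
      rw [Real.dist_eq] at this ⊢
      rw [hseq, hseq]
      simp only
      rw [pow_succ]
      split_ifs with h
      · rw [← sub_div, abs_div, abs_two]; linarith
      · have e : (1 - hseq g v n (g x) / 2) - (1 - hseq g v (n + 1) (g x) / 2)
          = -((hseq g v n (g x) - hseq g v (n + 1) (g x)) / 2) := by ring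
        rw [e, abs_neg, abs_div, abs_two]; linarith
  have hlim : ∀ x : ℝ, ∃ l : ℝ, x ∈ Icc (0:ℝ) 1 →
      Filter.Tendsto (fun n => hseq g v n x) Filter.atTop (nhds l) := by
    intro x
    by_cases hx : x ∈ Icc (0:ℝ) 1
    · obtain ⟨l, hl⟩ := cauchySeq_tendsto_of_complete
        (cauchySeq_of_le_geometric (1/2) 1 (by norm_num) fun n => hdist n x hx)
      exact ⟨l, fun _ => hl⟩
    · exact ⟨0, fun h => absurd h hx⟩
  choose H hH using hlim
  have hbound : ∀ n, ∀ x ∈ Icc (0:ℝ) 1, dist (hseq g v n x) (H x) ≤ 1 * (1/2) ^ n / (1 - 1/2) :=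
    fun n x hx => dist_le_of_le_geometric_of_tendsto (1/2) 1 (by norm_num)
      (fun n => hdist n x hx) (hH x hx) n
  have hunif : TendstoUniformlyOn (hseq g v) H Filter.atTop (Icc 0 1) := by
    rw [Metric.tendstoUniformlyOn_iff]
    intro ε hε
    have ht : Filter.Tendsto (fun n : ℕ => 1 * (1/2 : ℝ) ^ n / (1 - 1/2)) Filter.atTop (nhds 0) := by
      have := (tendsto_pow_atTop_nhds_zero_of_lt_one (r := (1/2:ℝ)) (by norm_num) (by norm_num))
      simpa using (this.const_mul 1).div_const (1 - 1/2)
    filter_upwards [ht.eventually (gt_mem_nhds hε)] with n hn x hx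
    rw [dist_comm]
    exact lt_of_le_of_lt (hbound n x hx) hn
  have hHI : ∀ x ∈ Icc (0:ℝ) 1, H x ∈ Icc (0:ℝ) 1 := fun x hx =>
    isClosed_Icc.mem_of_tendsto (hH x hx) (Filter.Eventually.of_forall fun n => hrange n x hx)
  refine ⟨H, hunif.continuousOn (Filter.Frequently.of_forall fun n => (P n).2.2.2), ?_, ?_, ?_, ?_⟩
  · intro x hx y hy hxy
    exact le_of_tendsto_of_tendsto' (hH x hx) (hH y hy) fun n => (P n).2.2.1 hx hy hxy
  · exact tendsto_nhds_unique (hH 0 I0) (by simp [fun n => (P n).1])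
  · exact tendsto_nhds_unique (hH 1 I1) (by simp [fun n => (P n).2.1])
  · intro x hx
    have hs := (Filter.tendsto_add_atTop_iff_nat 1).2 (hH x hx)
    have hgx := hH (g x) (hm hx)
    have hI := hHI (g x) (hm hx)
    by_cases h : x ≤ v
    · have e : H x = H (g x) / 2 := by
        refine tendsto_nhds_unique hs ?_
        simpa [hseq, h] using hgx.div_const 2
      rw [tent, e, min_eq_left] <;> linarith [hI.2]
    · have e : H x = 1 - H (g x) / 2 := by
        refine tendsto_nhds_unique hs ?_
        simpa [hseq, h] using (hgx.div_const 2).const_sub 1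
      rw [tent, e, min_eq_right] <;> linarith [hI.2]

lemma iter_mem {g : ℝ → ℝ} (hm : MapsTo g (Icc 0 1) (Icc 0 1)) (n : ℕ) {x : ℝ}
    (hx : x ∈ Icc (0:ℝ) 1) : g^[n] x ∈ Icc (0:ℝ) 1 := hm.iterate n hx

lemma iter_semi {g H : ℝ → ℝ} (hm : MapsTo g (Icc 0 1) (Icc 0 1))
    (hH : ∀ x ∈ Icc (0:ℝ) 1, H (g x) = tent (H x)) (n : ℕ) {x : ℝ}
    (hx : x ∈ Icc (0:ℝ) 1) : H (g^[n] x) = tent^[n] (H x) := by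
  induction n with
  | zero => rfl
  | succ n ih =>
    rw [Function.iterate_succ_apply', Function.iterate_succ_apply', hH _ (iter_mem hm n hx), ih]

lemma iter_zero {f : ℝ → ℝ} (h : f 0 = 0) (n : ℕ) : f^[n] 0 = 0 := Function.iterate_fixed h n

lemma tent_zero : tent 0 = 0 := by simp [tent]

lemma semi_strictMono {g H : ℝ → ℝ} (hg : IsUnimodal g)
    (hdense : Icc (0:ℝ) 1 ⊆ closure (completePreimZero g))
    (hfin : ∀ n, 1 ≤ n → (preimZero g n).Finite)
    (hmonoH : MonotoneOn H (Icc 0 1)) (H0 : H 0 = 0) (H1 : H 1 = 1)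
    (hH : ∀ x ∈ Icc (0:ℝ) 1, H (g x) = tent (H x)) : StrictMonoOn H (Icc 0 1) := by
  obtain ⟨hc, hm, v, hv, hmono, hanti, h0, h1, hgv⟩ := hg
  have hdn : ∀ a b : ℝ, a ∈ Icc (0:ℝ) 1 → b ∈ Icc (0:ℝ) 1 → a < b →
      ∃ z ∈ Ioo a b, ∃ n, 1 ≤ n ∧ g^[n] z = 0 := by
    intro a b ha hb hab
    have hmid : (a + b) / 2 ∈ Icc (0:ℝ) 1 :=
      ⟨by linarith [ha.1, hb.1], by linarith [ha.2, hb.2]⟩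
    have := mem_closure_iff.1 (hdense hmid) (Ioo a b) isOpen_Ioo ⟨by linarith, by linarith⟩
    obtain ⟨z, hz, hz2⟩ := this
    simp only [completePreimZero, mem_iUnion] at hz2
    obtain ⟨n, hn, hz3⟩ := hz2
    exact ⟨z, hz, n, hn, hz3.2⟩
  have I0 : (0:ℝ) ∈ Icc (0:ℝ) 1 := by simp
  -- `H` does not vanish at positive points
  have hpos : ∀ w ∈ Icc (0:ℝ) 1, 0 < w → H w ≠ 0 := by
    intro w hw hw0 hHw
    obtain ⟨z, hz, n, hn, hgz⟩ := hdn 0 w I0 hw hw0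
    have hzI : z ∈ Icc (0:ℝ) 1 := ⟨hz.1.le, by linarith [hz.2, hw.2]⟩
    have hHz : H z = 0 := by
      apply le_antisymm
      · rw [← hHw]; exact hmonoH hzI hw hz.2.le
      · rw [← H0]; exact hmonoH I0 hzI hz.1.le
    have key : ∀ n, g^[n] z ≠ 0 := by
      intro n
      induction n with
      | zero => exact hz.1.ne'
      | succ n ih =>
        rw [Function.iterate_succ_apply']
        intro hbad
        have hyI := iter_mem hm n hzI
        have hy1 : g^[n] z = 1 := by
          rcases le_total (g^[n] z) v with h | h
          · exact absurd (hmono.injOn ⟨hyI.1, h⟩ ⟨le_rfl, hv.1.le⟩ (hbad.trans h0.symm)) ih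
          · exact hanti.injOn ⟨h, hyI.2⟩ ⟨hv.2.le, le_rfl⟩ (hbad.trans h1.symm)
        have := iter_semi hm hH n hzI
        rw [hy1, hHz, H1, iter_zero tent_zero] at this
        exact one_ne_zero this
    exact key n hgz
  intro x hx y hy hxy
  refine lt_of_le_of_ne (hmonoH hx hy hxy.le) fun heq => ?_
  obtain ⟨a, ha, n, hn, hga⟩ := hdn x y hx hy hxy
  have hsub : Icc x y ⊆ Icc (0:ℝ) 1 := Icc_subset_Icc hx.1 hy.2
  have hconst : ∀ z ∈ Icc x y, H z = H x := fun z hz =>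
    le_antisymm (by rw [heq]; exact hmonoH (hsub hz) hy hz.2) (hmonoH hx (hsub hz) hz.1)
  have hall : Icc x y ⊆ preimZero g n := by
    intro z hz
    refine ⟨hsub hz, ?_⟩
    have haI : a ∈ Icc x y := ⟨ha.1.le, ha.2.le⟩
    have e1 := iter_semi hm hH n (hsub hz)
    have e2 := iter_semi hm hH n (hsub haI)
    rw [hconst z hz] at e1
    rw [hconst a haI, hga, H0] at e2
    rw [← e2] at e1
    have hI := iter_mem hm n (hsub hz)
    by_contra hne
    exact hpos _ hI (lt_of_le_of_ne hI.1 (Ne.symm hne)) e1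
  exact (Icc_infinite hxy) ((hfin n hn).subset hall)

lemma exists_conj {g : ℝ → ℝ} (hg : IsUnimodal g)
    (hdense : Icc (0:ℝ) 1 ⊆ closure (completePreimZero g))
    (hfin : ∀ n, 1 ≤ n → (preimZero g n).Finite) :
    ∃ H : ℝ ≃o ℝ, H 0 = 0 ∧ H 1 = 1 ∧ ∀ x ∈ Icc (0:ℝ) 1, H (g x) = tent (H x) := by
  obtain ⟨F, hFc, hFm, F0, F1, hF⟩ := exists_semi hg
  have hs := semi_strictMono hg hdense hfin hFm F0 F1 hF
  have hm := hg.2.1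
  have I0 : (0:ℝ) ∈ Icc (0:ℝ) 1 := by simp
  have I1 : (1:ℝ) ∈ Icc (0:ℝ) 1 := by simp
  have hFI : ∀ x ∈ Icc (0:ℝ) 1, F x ∈ Icc (0:ℝ) 1 := fun x hx =>
    ⟨by rw [← F0]; exact hFm I0 hx hx.1, by rw [← F1]; exact hFm hx I1 hx.2⟩
  classical
  let G : ℝ → ℝ := fun x => if x ∈ Icc (0:ℝ) 1 then F x else x
  have hGin : ∀ x ∈ Icc (0:ℝ) 1, G x = F x := fun x hx => if_pos hx
  have hGout : ∀ x, x ∉ Icc (0:ℝ) 1 → G x = x := fun x hx => if_neg hx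
  have hGm : StrictMono G := by
    intro x y hxy
    by_cases hx : x ∈ Icc (0:ℝ) 1 <;> by_cases hy : y ∈ Icc (0:ℝ) 1
    · rw [hGin x hx, hGin y hy]; exact hs hx hy hxy
    · rw [hGin x hx, hGout y hy]
      refine lt_of_le_of_lt (hFI x hx).2 ?_
      by_contra h
      exact hy ⟨by linarith [hx.1], by linarith⟩
    · rw [hGout x hx, hGin y hy]
      refine lt_of_lt_of_le ?_ (hFI y hy).1
      by_contra h
      exact hx ⟨by linarith, by linarith [hy.2]⟩
    · rwa [hGout x hx, hGout y hy]
  have hGs : Function.Surjective G := by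
    intro y
    by_cases hy : y ∈ Icc (0:ℝ) 1
    · have := intermediate_value_Icc zero_le_one hFc
      rw [F0, F1] at this
      obtain ⟨x, hx, e⟩ := this hy
      exact ⟨x, by rw [hGin x hx, e]⟩
    · exact ⟨y, hGout y hy⟩
  refine ⟨hGm.orderIsoOfSurjective G hGs, ?_, ?_, ?_⟩
  · simpa [hGin 0 I0] using F0
  · simpa [hGin 1 I1] using F1
  · intro x hx
    simp only [StrictMono.coe_orderIsoOfSurjective]
    rw [hGin x hx, hGin _ (hm hx), hF x hx]

lemma pf_eq_zero {y : ℝ} (h : pf y = 0) : ∃ m : ℤ, y = 2 * m := by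
  obtain ⟨m, h' | h'⟩ := pf_spec y
  · exact ⟨-m, by push_cast; linarith⟩
  · exact ⟨m, by linarith⟩

lemma pf_even (m : ℤ) : pf (2 * m) = 0 := by
  have := pf_add 0 m
  rwa [zero_add, pf_id (x := 0) (by simp)] at this

lemma conj_mu {g : ℝ → ℝ} (hm : MapsTo g (Icc 0 1) (Icc 0 1)) {H : ℝ ≃o ℝ} (H0 : H 0 = 0)
    (H1 : H 1 = 1) (hH : ∀ x ∈ Icc (0:ℝ) 1, H (g x) = tent (H x))
    {μ : ℕ → ℕ → ℝ} (hμ : IsMuSeq g μ) (n : ℕ) {k : ℕ} (hk : k ≤ 2 ^ n) :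
    H (μ (n + 1) k) = k / 2 ^ n := by
  obtain ⟨hlt, hmem⟩ := hμ (n + 1) (by omega)
  simp only [Nat.add_sub_cancel] at hlt hmem
  have hpow : (0:ℝ) < 2 ^ n := by positivity
  have hHI : ∀ x, H x ∈ Icc (0:ℝ) 1 ↔ x ∈ Icc (0:ℝ) 1 := by
    intro x
    rw [mem_Icc, mem_Icc]
    have a : 0 ≤ H x ↔ 0 ≤ x := by rw [← H.le_iff_le (x := 0) (y := x), H0]
    have b : H x ≤ 1 ↔ x ≤ 1 := by rw [← H.le_iff_le (x := x) (y := 1), H1]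
    rw [a, b]
  have hpre : ∀ x, x ∈ preimZero g (n + 1) ↔ x ∈ Icc (0:ℝ) 1 ∧ pf (2 ^ (n + 1) * H x) = 0 := by
    intro x
    refine and_congr_right fun hx => ?_
    rw [← tent_iter_pf, pf_id ((hHI x).2 hx), ← iter_semi hm hH (n + 1) hx]
    constructor
    · intro h; rw [h, H0]
    · intro h; exact H.injective (h.trans H0.symm)
  let f1 : Fin (2 ^ n + 1) → ℝ := fun i => H (μ (n + 1) i)
  let f2 : Fin (2 ^ n + 1) → ℝ := fun i => ((i : ℕ) : ℝ) / 2 ^ n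
  have s1 : StrictMono f1 := by
    rw [Fin.strictMono_iff_lt_succ]
    intro i
    exact H.strictMono (by simpa using hlt i i.2)
  have s2 : StrictMono f2 := by
    intro i j hij
    have : ((i : ℕ) : ℝ) < ((j : ℕ) : ℝ) := by exact_mod_cast hij
    exact div_lt_div_of_pos_right this hpow
  have hr : range f1 = range f2 := by
    ext y
    constructor
    · rintro ⟨i, rfl⟩
      have hx := (hmem (μ (n + 1) i)).2 ⟨i, Nat.lt_succ_iff.1 i.2, rfl⟩
      obtain ⟨hxI, hz⟩ := (hpre _).1 hx
      obtain ⟨m, hm'⟩ := pf_eq_zero hz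
      have hy := (hHI _).2 hxI
      have e : 2 ^ n * H (μ (n + 1) i) = m := by rw [pow_succ] at hm'; linarith
      have hm0 : (0:ℤ) ≤ m := by
        have : (0:ℝ) ≤ m := by rw [← e]; exact mul_nonneg hpow.le hy.1
        exact_mod_cast this
      lift m to ℕ using hm0
      have hm1 : m ≤ 2 ^ n := by
        have : (m:ℝ) ≤ 2 ^ n := by
          have e' : 2 ^ n * H (μ (n + 1) i) = (m:ℝ) := by exact_mod_cast e
          rw [← e']; nlinarith [hy.2]
        exact_mod_cast this
      refine ⟨⟨m, Nat.lt_succ_iff.2 hm1⟩, ?_⟩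
      change (m:ℝ) / 2 ^ n = H (μ (n + 1) i)
      rw [div_eq_iff hpow.ne', mul_comm, e]; simp
    · rintro ⟨i, rfl⟩
      have hyI : f2 i ∈ Icc (0:ℝ) 1 := by
        constructor
        · positivity
        · change ((i : ℕ) : ℝ) / 2 ^ n ≤ 1
          rw [div_le_one hpow]
          exact_mod_cast Nat.lt_succ_iff.1 i.2
      have hx : H.symm (f2 i) ∈ preimZero g (n + 1) := by
        rw [hpre, ← hHI, H.apply_symm_apply]
        refine ⟨hyI, ?_⟩
        have : 2 ^ (n + 1) * f2 i = 2 * (((i : ℕ) : ℤ) : ℝ) := by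
          change 2 ^ (n + 1) * (((i : ℕ) : ℝ) / 2 ^ n) = _
          rw [pow_succ]; push_cast; field_simp
        rw [this, pf_even]
      obtain ⟨j, hj, e⟩ := (hmem _).1 hx
      refine ⟨⟨j, Nat.lt_succ_iff.2 hj⟩, ?_⟩
      change H (μ (n + 1) j) = f2 i
      rw [e, H.apply_symm_apply]
  have hfe := (s1.range_inj s2).1 hr
  exact congrFun hfe ⟨k, Nat.lt_succ_iff.2 hk⟩

/-- For every self-semiconjugation `ψ` of a carcass map `g` whose complete
pre-image of `0` is dense in `[0,1]`, there is `t ≥ 1` with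
`ψ(μ_{n,k}(g)) = μ_{n,t·k}(g)` for all `n ≥ 1` and `0 ≤ k ≤ ⌊2^{n-1}/t⌋`. -/
theorem selfSemiconj_on_mu (g : ℝ → ℝ) (hg : IsCarcass g)
    (hdense : Icc (0:ℝ) 1 ⊆ closure (completePreimZero g))
    (μ : ℕ → ℕ → ℝ) (hμ : IsMuSeq g μ)
    (ψ : ℝ → ℝ) (hψ : IsSelfSemiconj g ψ) :
    ∃ t : ℕ, 1 ≤ t ∧ ∀ n, 1 ≤ n → ∀ k ≤ 2 ^ (n - 1) / t, ψ (μ n k) = μ n (t * k) := by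
  have hm := hg.1.2.1
  have hfin : ∀ n, 1 ≤ n → (preimZero g n).Finite := by
    intro n hn
    refine ((Set.finite_Iic (2 ^ (n - 1))).image (μ n)).subset fun x hx => ?_
    obtain ⟨k, hk, e⟩ := ((hμ n hn).2 x).1 hx
    exact ⟨k, hk, e⟩
  obtain ⟨H, H0, H1, hH⟩ := exists_conj hg.1 hdense hfin
  have hHI : ∀ x, H x ∈ Icc (0:ℝ) 1 ↔ x ∈ Icc (0:ℝ) 1 := by
    intro x
    rw [mem_Icc, mem_Icc]
    have a : 0 ≤ H x ↔ 0 ≤ x := by rw [← H.le_iff_le (x := 0) (y := x), H0]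
    have b : H x ≤ 1 ↔ x ≤ 1 := by rw [← H.le_iff_le (x := x) (y := 1), H1]
    rw [a, b]
  have hHs : ∀ y, y ∈ Icc (0:ℝ) 1 → H.symm y ∈ Icc (0:ℝ) 1 := by
    intro y hy
    rwa [← hHI, H.apply_symm_apply]
  obtain ⟨hψc, hψm, hψs, hψg⟩ := hψ
  obtain ⟨c, hc0, hc⟩ := tent_comm (φ := fun y => H (ψ (H.symm y)))
    (H.continuous.comp_continuousOn (hψc.comp H.symm.continuous.continuousOn hHs))
    (fun y hy => (hHI _).2 (hψm (hHs y hy)))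
    (by
      intro y hy
      obtain ⟨x, hx, e⟩ := hψs (hHs y hy)
      refine ⟨H x, (hHI x).2 hx, ?_⟩
      simp [e])
    (by
      intro y hy
      have h1 := hH _ (hHs y hy)
      rw [H.apply_symm_apply] at h1
      rw [← h1, H.symm_apply_apply, hψg _ (hHs y hy), hH _ (hψm (hHs y hy))])
  refine ⟨c.natAbs, Nat.one_le_iff_ne_zero.2 (Int.natAbs_ne_zero.2 hc0), ?_⟩
  intro n hn k hk
  obtain ⟨n, rfl⟩ : ∃ m, n = m + 1 := ⟨n - 1, by omega⟩
  rw [Nat.add_sub_cancel] at hk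
  have hpos : 0 < c.natAbs := Int.natAbs_pos.2 hc0
  have htk : c.natAbs * k ≤ 2 ^ n := by
    rw [mul_comm]; exact (Nat.le_div_iff_mul_le hpos).1 hk
  have hk' : k ≤ 2 ^ n := le_trans (Nat.le_mul_of_pos_left k hpos) htk
  have hpow : (0:ℝ) < 2 ^ n := by positivity
  have e1 := conj_mu hm H0 H1 hH hμ n hk'
  have e2 := conj_mu hm H0 H1 hH hμ n htk
  apply H.injective
  have hI : (k:ℝ) / 2 ^ n ∈ Icc (0:ℝ) 1 := by
    refine ⟨by positivity, ?_⟩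
    rw [div_le_one hpow]; exact_mod_cast hk'
  have e3 := hc _ hI
  rw [← e1, H.symm_apply_apply, e1] at e3
  rw [e2, e3]
  have hI2 : ((c.natAbs * k : ℕ) : ℝ) / 2 ^ n ∈ Icc (0:ℝ) 1 := by
    refine ⟨by positivity, ?_⟩
    rw [div_le_one hpow]; exact_mod_cast htk
  rw [← pf_id hI2]
  have e4 : ((c.natAbs * k : ℕ) : ℝ) / 2 ^ n = |(c:ℝ)| * (k / 2 ^ n) := by
    push_cast
    rw [Nat.cast_natAbs]
    push_cast
    ring
  rw [e4]
  rcases abs_choice (c:ℝ) with h | h <;> rw [h]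
  rw [neg_mul, pf_neg]
end

section
/- Let g be a carcass map whose complete pre-image of 0 is dense in [0,1], let h be the unique homeomorphism of [0,1] with h(0) = 0 and h ∘ f = g ∘ h (f the tent map), and let a ∈ (0,1) be the smallest positive kink of g. For each natural number t ≥ 1 set ψ_t = h ∘ ξ_t ∘ h^{-1}. If ψ_t is piecewise linear for every t ≥ 1, then there exists w ∈ ℝ such that μ_{n,k}(g) = w·k/2^{n-1} for every n ≥ 1 and every k with 0 ≤ k ≤ 2^{n-1} and μ_{n,k}(g) ≤ g(a). -/
open Set

theorem aux_right_affine (F : ℝ → ℝ) (hF : IsPLOn F 0 1) (y : ℝ) (h0 : 0 ≤ y) (h1 : y < 1) :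
    ∃ e, y < e ∧ e ≤ 1 ∧ ∃ c d : ℝ, ∀ x ∈ Icc y e, F x = c * x + d := by
  obtain ⟨n, p, hn, hp0, hpn, hp, haff⟩ := hF
  have key : ∀ j ≤ n, y < p j → ∃ i < n, p i ≤ y ∧ y < p (i + 1) := by
    intro j
    induction j with
    | zero => intro _ h; linarith
    | succ j ih =>
      intro hj hy
      by_cases hc : p j ≤ y
      · exact ⟨j, by omega, hc, hy⟩
      · exact ih (by omega) (not_le.mp hc)
  obtain ⟨i, hi, h2, h3⟩ := key n le_rfl (by linarith)
  obtain ⟨c, d, hcd⟩ := haff i hi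
  refine ⟨min (p (i + 1)) 1, lt_min h3 h1, min_le_right _ _, c, d, fun x hx => hcd x ⟨?_, ?_⟩⟩
  · linarith [hx.1]
  · exact hx.2.trans (min_le_left _ _)

theorem aux_linear (g : ℝ → ℝ) (hg : IsPLOn g 0 1) (g0 : g 0 = 0) (a : ℝ) (ha : a ∈ Ioo (0:ℝ) 1)
    (hd : ∀ x ∈ Ioo 0 a, DifferentiableAt ℝ g x) : ∃ s : ℝ, ∀ x ∈ Icc 0 a, g x = s * x := by
  obtain ⟨n, p, hn, hp0, hpn, hp, haff⟩ := hg
  obtain ⟨s, d, hs⟩ := haff 0 hn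
  have hd0 : d = 0 := by
    have := hs 0 ⟨by rw [hp0], by rw [← hp0]; exact (hp 0 hn).le⟩
    rw [g0] at this; linarith
  subst hd0
  have key : ∀ i, i + 1 ≤ n → 0 < p (i + 1) ∧ ∀ x ∈ Icc 0 (min (p (i + 1)) a), g x = s * x := by
    intro i
    induction i with
    | zero =>
      intro _
      refine ⟨by rw [← hp0]; exact hp 0 hn, fun x hx => ?_⟩
      have := hs x ⟨by rw [hp0]; exact hx.1, hx.2.trans (min_le_left _ _)⟩
      simpa using this
    | succ i ih =>
      intro hi
      obtain ⟨hpos, ih⟩ := ih (by omega)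
      have hlt := hp (i + 1) (by omega)
      refine ⟨by linarith, fun x hx => ?_⟩
      by_cases hxp : x ≤ p (i + 1)
      · exact ih x ⟨hx.1, le_min hxp (hx.2.trans (min_le_right _ _))⟩
      · push Not at hxp
        have hxa : x ≤ a := hx.2.trans (min_le_right _ _)
        have hxp2 : x ≤ p (i + 1 + 1) := hx.2.trans (min_le_left _ _)
        set q := p (i + 1) with hq
        have hqa : q < a := by linarith
        obtain ⟨c, d, hcd⟩ := haff (i + 1) (by omega)
        have D := (hd q ⟨hpos, hqa⟩).hasDerivAt
        have e1 : g q = s * q := ih q ⟨hpos.le, le_min le_rfl hqa.le⟩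
        have e2 : g q = c * q + d := hcd q ⟨le_rfl, hlt.le⟩
        have L : HasDerivWithinAt g s (Icc 0 q) q := by
          have : HasDerivWithinAt (fun x : ℝ => s * x) s (Icc 0 q) q := by
            simpa using ((hasDerivAt_id q).const_mul s).hasDerivWithinAt
          exact this.congr (fun y hy => ih y ⟨hy.1, le_min hy.2 (hy.2.trans hqa.le)⟩) e1
        have R : HasDerivWithinAt g c (Icc q (p (i + 1 + 1))) q := by
          have : HasDerivWithinAt (fun x : ℝ => c * x + d) c (Icc q (p (i + 1 + 1))) q := by
            simpa using (((hasDerivAt_id q).const_mul c).add_const d).hasDerivWithinAt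
          exact this.congr (fun y hy => hcd y hy) e2
        have u1 : s = deriv g q :=
          (uniqueDiffOn_Icc hpos q ⟨hpos.le, le_rfl⟩).eq_deriv _ L D.hasDerivWithinAt
        have u2 : c = deriv g q :=
          (uniqueDiffOn_Icc hlt q ⟨le_rfl, hlt.le⟩).eq_deriv _ R D.hasDerivWithinAt
        have hcs : c = s := by rw [u1, u2]
        subst hcs
        have : d = 0 := by linarith
        rw [hcd x ⟨hxp.le, hxp2⟩, this, add_zero]
  refine ⟨s, fun x hx => ?_⟩
  obtain ⟨m, rfl⟩ : ∃ m, n = m + 1 := ⟨n - 1, by omega⟩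
  refine (key m le_rfl).2 x ⟨hx.1, le_min ?_ hx.2⟩
  rw [hpn]; linarith [hx.2, ha.2]

theorem aux_xi (t : ℕ) (x r : ℝ) (j : ℤ) (hx : (t : ℝ) * x = 2 * j + r) (h0 : 0 ≤ r) (h1 : r < 1) :
    xi t x = r := by
  have hf : ⌊(t : ℝ) * x⌋ = 2 * j := by
    rw [Int.floor_eq_iff, hx]; push_cast; constructor <;> linarith
  have he : (-1 : ℝ) ^ (2 * j) = 1 := Even.neg_one_zpow ⟨j, by ring⟩
  unfold xi
  rw [Int.fract, hf, he, hx]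
  push_cast; ring

theorem aux_tent (n : ℕ) : ∀ x ∈ Icc (0:ℝ) 1,
    (tent^[n + 1] x = 0 ↔ ∃ k : ℕ, k ≤ 2 ^ n ∧ x = k / 2 ^ n) := by
  induction n with
  | zero =>
    intro x hx
    simp only [zero_add, Function.iterate_one, pow_zero, div_one]
    constructor
    · intro h
      unfold tent at h
      rcases min_choice (2 * x) (2 - 2 * x) with h' | h'
      · exact ⟨0, by simp, by push_cast; linarith⟩
      · exact ⟨1, by simp, by push_cast; linarith⟩
    · rintro ⟨k, hk, rfl⟩
      interval_cases k <;> simp [tent]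
  | succ n ih =>
    intro x hx
    have ht : tent x ∈ Icc (0:ℝ) 1 := by
      unfold tent
      refine ⟨le_min (by linarith [hx.1]) (by linarith [hx.2]), ?_⟩
      rcases le_total x (1/2) with h | h
      · exact (min_le_left _ _).trans (by linarith)
      · exact (min_le_right _ _).trans (by linarith)
    rw [Function.iterate_succ_apply, ih _ ht]
    have hp : (0:ℝ) < 2 ^ n := by positivity
    constructor
    · rintro ⟨k, hk, e⟩
      unfold tent at e
      rcases min_choice (2 * x) (2 - 2 * x) with h' | h'
      · refine ⟨k, by rw [pow_succ]; omega, ?_⟩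
        rw [h'] at e
        rw [pow_succ]; field_simp at e ⊢; linarith
      · refine ⟨2 ^ (n + 1) - k, by omega, ?_⟩
        rw [h'] at e
        have hk2 : k ≤ 2 ^ (n + 1) := by rw [pow_succ]; omega
        rw [Nat.cast_sub hk2]; push_cast
        rw [pow_succ]; field_simp at e ⊢; linarith
    · rintro ⟨k, hk, rfl⟩
      rcases le_total k (2 ^ n) with h | h
      · refine ⟨k, h, ?_⟩
        have hr : (k : ℝ) ≤ 2 ^ n := by exact_mod_cast h
        have e : (2:ℝ) * (k / 2 ^ (n + 1)) = k / 2 ^ n := by rw [pow_succ]; field_simp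
        have : (k:ℝ) / 2 ^ n ≤ 1 := by rw [div_le_one hp]; exact hr
        unfold tent
        rw [e, min_eq_left (by linarith)]
      · refine ⟨2 ^ (n + 1) - k, by rw [pow_succ]; omega, ?_⟩
        have hr : (2:ℝ) ^ n ≤ k := by exact_mod_cast h
        have e : (2:ℝ) * (k / 2 ^ (n + 1)) = k / 2 ^ n := by rw [pow_succ]; field_simp
        have : 1 ≤ (k:ℝ) / 2 ^ n := by rw [one_le_div hp]; exact hr
        unfold tent
        rw [e, min_eq_right (by linarith), Nat.cast_sub hk]; push_cast
        rw [pow_succ]; field_simp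

theorem aux_mu (g h : ℝ → ℝ) (hh : ConjTent g h) (hmono : StrictMonoOn h (Icc 0 1))
    (μ : ℕ → ℕ → ℝ) (hμ : IsMuSeq g μ) (n : ℕ) (k : ℕ) (hk : k ≤ 2 ^ n) :
    μ (n + 1) k = h (k / 2 ^ n) := by
  obtain ⟨⟨hcont, hbij⟩, h0, hconj⟩ := hh
  have hmem : ∀ k : ℕ, k ≤ 2 ^ n → (k : ℝ) / 2 ^ n ∈ Icc (0:ℝ) 1 := by
    intro k hk
    have hr : (k : ℝ) ≤ 2 ^ n := by exact_mod_cast hk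
    exact ⟨by positivity, by rw [div_le_one (by positivity)]; exact hr⟩
  have htent : ∀ x ∈ Icc (0:ℝ) 1, tent x ∈ Icc (0:ℝ) 1 := by
    intro x hx
    unfold tent
    refine ⟨le_min (by linarith [hx.1]) (by linarith [hx.2]), ?_⟩
    rcases le_total x (1/2) with h | h
    · exact (min_le_left _ _).trans (by linarith)
    · exact (min_le_right _ _).trans (by linarith)
  have hiter : ∀ m : ℕ, ∀ x ∈ Icc (0:ℝ) 1, tent^[m] x ∈ Icc (0:ℝ) 1 ∧ g^[m] (h x) = h (tent^[m] x) := by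
    intro m
    induction m with
    | zero => intro x hx; exact ⟨hx, rfl⟩
    | succ m ih =>
      intro x hx
      rw [Function.iterate_succ_apply, Function.iterate_succ_apply, ← hconj x hx]
      exact ih _ (htent x hx)
  have hpre : ∀ y, y ∈ preimZero g (n + 1) ↔ ∃ k : ℕ, k ≤ 2 ^ n ∧ h (k / 2 ^ n) = y := by
    intro y
    constructor
    · rintro ⟨hy, hz⟩
      obtain ⟨x, hx, rfl⟩ := hbij.surjOn hy
      obtain ⟨hm, he⟩ := hiter (n + 1) x hx
      rw [he, ← h0] at hz
      have := hbij.injOn hm ⟨le_rfl, zero_le_one⟩ hz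
      obtain ⟨k, hk, rfl⟩ := (aux_tent n x hx).1 this
      exact ⟨k, hk, rfl⟩
    · rintro ⟨k, hk, rfl⟩
      refine ⟨hbij.mapsTo (hmem k hk), ?_⟩
      rw [(hiter (n + 1) _ (hmem k hk)).2, (aux_tent n _ (hmem k hk)).2 ⟨k, hk, rfl⟩, h0]
  obtain ⟨m1, m2⟩ := hμ (n + 1) (by omega)
  simp only [Nat.add_sub_cancel] at m1 m2
  let A : Fin (2 ^ n + 1) → ℝ := fun i => μ (n + 1) i
  let B : Fin (2 ^ n + 1) → ℝ := fun i => h (i / 2 ^ n)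
  have hA : StrictMono A := by
    rw [Fin.strictMono_iff_lt_succ]
    intro i
    exact m1 i i.2
  have hB : StrictMono B := by
    intro i j hij
    refine hmono (hmem i (by omega)) (hmem j (by omega)) ?_
    have : ((i : ℕ) : ℝ) < (j : ℕ) := by exact_mod_cast hij
    gcongr
  have hAB : A = B := by
    rw [← hA.range_inj hB]
    ext y
    constructor
    · rintro ⟨i, rfl⟩
      obtain ⟨k, hk, e⟩ := (hpre _).1 ((m2 (A i)).2 ⟨i, by omega, rfl⟩)
      exact ⟨⟨k, by omega⟩, e⟩
    · rintro ⟨i, rfl⟩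
      obtain ⟨k, hk, e⟩ := (m2 _).1 ((hpre (B i)).2 ⟨i, by omega, rfl⟩)
      exact ⟨⟨k, by omega⟩, e⟩
  exact congrFun hAB ⟨k, by omega⟩

theorem aux_half (h : ℝ → ℝ) (Y s : ℝ) (hs : ∀ y, 0 ≤ y → y ≤ Y → h y = s * h (y / 2)) :
    ∀ m : ℕ, ∀ y, 0 ≤ y → y ≤ Y → h y = s ^ m * h (y / 2 ^ m) := by
  intro m
  induction m with
  | zero => intro y _ _; simp
  | succ m ih =>
    intro y h0 h1
    rw [hs y h0 h1, ih (y / 2) (by linarith) (by linarith)]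
    rw [pow_succ, pow_succ, div_div, mul_comm (2:ℝ) (2 ^ m)]; ring

theorem aux_scale (h : ℝ → ℝ) (Y s : ℝ) (hpos : ∀ x ∈ Ioc (0:ℝ) 1, 0 < h x)
    (hs0 : s ≠ 0) (hY1 : Y ≤ 1) (hs : ∀ y, 0 ≤ y → y ≤ Y → h y = s * h (y / 2))
    (k : ℕ) (hk : 1 ≤ k) (ε c : ℝ) (hε : 0 < ε)
    (hloc : ∀ u, 0 ≤ u → u ≤ ε → (k : ℝ) * u < 1 → h (k * u) = c * h u) :
    0 < c ∧ ∀ x, 0 ≤ x → (k : ℝ) * x ≤ Y → h (k * x) = c * h x := by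
  have hk' : (1:ℝ) ≤ k := by exact_mod_cast hk
  constructor
  · set u := min ε (1 / (2 * k)) with hu
    have hu0 : 0 < u := lt_min hε (by positivity)
    have hku : (k:ℝ) * u ≤ 1 / 2 := by
      calc (k:ℝ) * u ≤ k * (1 / (2 * k)) := by gcongr; exact min_le_right _ _
        _ = 1 / 2 := by field_simp
    have hu1 : u ≤ k * u := by nlinarith
    have e := hloc u hu0.le (min_le_left _ _) (by linarith)
    have p1 := hpos u ⟨hu0, by linarith⟩
    have p2 := hpos (k * u) ⟨by positivity, by linarith⟩
    rw [e] at p2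
    exact pos_of_mul_pos_left p2 p1.le
  · intro x hx hkx
    have hxx : x ≤ k * x := by nlinarith
    obtain ⟨m, hm⟩ := exists_pow_lt_of_lt_one (show (0:ℝ) < min ε (1/2) by positivity)
      (show (1/2:ℝ) < 1 by norm_num)
    have hx1 : x / 2 ^ m ≤ (1/2) ^ m := by
      rw [div_pow, one_pow]; gcongr; linarith
    have hkx1 : (k * x) / 2 ^ m ≤ (1/2) ^ m := by
      rw [div_pow, one_pow]; gcongr; linarith
    have e := hloc (x / 2 ^ m) (by positivity) (by
      have := min_le_left ε (1/2); linarith) (by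
      have := min_le_right ε (1/2)
      rw [← mul_div_assoc]; linarith)
    rw [aux_half h Y s hs m (k * x) (by positivity) hkx, aux_half h Y s hs m x hx (by linarith),
      mul_div_assoc, e]
    ring

/-- the core argument: local affine behaviour at `q` forces the scaling constants to be `k` -/
theorem aux_core (h : ℝ → ℝ) (Y : ℝ) (hpos : ∀ x ∈ Ioc (0:ℝ) 1, 0 < h x) (hY1 : Y ≤ 1)
    (hsc : ∀ k : ℕ, 1 ≤ k → ∃ c, 0 < c ∧ ∀ x, 0 ≤ x → (k : ℝ) * x ≤ Y → h (k * x) = c * h x)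
    (q δ B : ℝ) (hq : 0 < q) (hqY : 4 * q ≤ Y) (hδ : 0 < δ) (hδq : δ ≤ q) (hB : B ≠ 0)
    (hloc : ∀ u, 0 ≤ u → u ≤ δ → h (q + u) = h q + B * h u)
    (k : ℕ) (x : ℝ) (h00 : h 0 = 0) (hx : 0 ≤ x) (hkx : (k : ℝ) * x ≤ Y) :
    h (k * x) = k * h x := by
  rcases Nat.eq_zero_or_pos k with rfl | hk
  · simp [h00]
  -- choose `m` large
  obtain ⟨m, hm⟩ := exists_nat_gt (k * q / δ)
  have hk' : (1:ℝ) ≤ k := by exact_mod_cast hk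
  have hm0 : (0:ℝ) < m := lt_of_le_of_lt (by positivity) hm
  have hm1 : 1 ≤ m := by exact_mod_cast hm0
  set v := q / m with hv
  have hv0 : 0 < v := by positivity
  have hmv : m * v = q := by rw [hv]; field_simp
  have hkv : k * v ≤ δ := by
    rw [div_lt_iff₀ hδ] at hm
    rw [hv, ← mul_div_assoc, div_le_iff₀ hm0]; linarith
  obtain ⟨c1, hc1, e1⟩ := hsc m hm1
  obtain ⟨c2, hc2, e2⟩ := hsc (m + 1) (by omega)
  push_cast at e2
  have hm1' : (1:ℝ) ≤ m := by exact_mod_cast hm1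
  -- local affine behaviour at `q + v`
  have E : ∀ z, 0 ≤ z → z ≤ δ → h (q + v + z) = h (q + v) + B * h z := by
    intro z hz0 hz
    set z' := z / (m + 1) with hz'
    have hzz : (m + 1) * z' = z := by rw [hz']; field_simp
    have hz'0 : 0 ≤ z' := by positivity
    have hmz : m * z' ≤ δ := by nlinarith
    have r1 := hloc (m * z') (by positivity) hmz
    have a1 := e1 (v + z') (by positivity) (by rw [mul_add, hmv]; linarith)
    have a2 := e1 v hv0.le (by rw [hmv]; linarith)
    have a3 := e1 z' hz'0 (by linarith)
    have hvq : v ≤ q := by nlinarith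
    have b1 := e2 (v + z') (by positivity) (by rw [add_mul, mul_add, hmv]; nlinarith)
    have b2 := e2 v hv0.le (by rw [add_mul, hmv]; linarith)
    have b3 := e2 z' hz'0 (by linarith)
    rw [mul_add, hmv] at a1
    rw [hmv] at a2
    have w1 : ((m:ℝ) + 1) * (v + z') = q + v + z := by rw [mul_add, hzz, add_mul, hmv]; ring
    have w2 : ((m:ℝ) + 1) * v = q + v := by rw [add_mul, hmv]; ring
    rw [w1] at b1
    rw [w2] at b2
    rw [hzz] at b3
    rw [b1, b2, b3]
    rw [a1, a2, a3] at r1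
    have : h (v + z') = h v + B * h z' := by
      apply mul_left_cancel₀ hc1.ne'
      linarith
    rw [this]; ring
  have K : ∀ j : ℕ, j ≤ k → h (j * v) = j * h v := by
    intro j
    induction j with
    | zero => intro _; simp [h00]
    | succ j ih =>
      intro hj
      have hj' : ((j:ℝ) + 1) ≤ k := by exact_mod_cast hj
      have hjv : ((j:ℝ) + 1) * v ≤ δ := le_trans (by gcongr) hkv
      have t1 := E (j * v) (by positivity) (by nlinarith)
      have t2 := hloc v hv0.le (by nlinarith [mul_nonneg (Nat.cast_nonneg (α := ℝ) j) hv0.le])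
      have t3 := hloc ((j + 1) * v) (by positivity) hjv
      have t4 : q + v + j * v = q + (j + 1) * v := by ring
      rw [t4, t3, t2, ih (by omega)] at t1
      push_cast
      apply mul_left_cancel₀ hB
      linarith
  obtain ⟨c, hc, e⟩ := hsc k hk
  have f1 := e v hv0.le (by linarith)
  rw [K k le_rfl] at f1
  have hvq : v ≤ q := by nlinarith
  have hvp := hpos v ⟨hv0, by linarith⟩
  have hck : (k:ℝ) = c := mul_right_cancel₀ hvp.ne' f1
  rw [e x hx hkx, hck]

/-- Let `g` be a carcass map whose complete pre-image of `0` is dense in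
`[0,1]`, `h` the (unique) conjugacy of the tent map and `g`, with inverse `h'`, and
`a` the smallest positive kink of `g`. If `ψ_t = h ∘ ξ_t ∘ h⁻¹` is piecewise linear for
every `t ≥ 1`, then there is `w ∈ ℝ` with `μ_{n,k}(g) = w·k/2^{n-1}` for all `n ≥ 1` and
all `k ≤ 2^{n-1}` with `μ_{n,k}(g) ≤ g(a)`. -/
theorem mu_linear_of_all_psi_pl (g h h' : ℝ → ℝ) (hg : IsCarcass g)
    (hdense : Icc (0:ℝ) 1 ⊆ closure (completePreimZero g))
    (hh : ConjTent g h)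
    (hinv₁ : ∀ x ∈ Icc (0:ℝ) 1, h' (h x) = x)
    (hinv₂ : ∀ y ∈ Icc (0:ℝ) 1, h (h' y) = y)
    (a : ℝ) (ha : a ∈ Ioo (0:ℝ) 1) (haKink : IsKink g a)
    (haMin : ∀ y, IsKink g y → a ≤ y)
    (μ : ℕ → ℕ → ℝ) (hμ : IsMuSeq g μ)
    (hpl : ∀ t : ℕ, 1 ≤ t → IsPLOn (fun x => h (xi t (h' x))) 0 1) :
    ∃ w : ℝ, ∀ n, 1 ≤ n → ∀ k ≤ 2 ^ (n - 1),
      μ n k ≤ g a → μ n k = w * (k : ℝ) / 2 ^ (n - 1) := by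
  obtain ⟨⟨hgc, hgm, -⟩, hgpl⟩ := hg
  have hh2 := hh
  obtain ⟨⟨hcont, hbij⟩, h0, hconj⟩ := hh2
  have m0 : (0:ℝ) ∈ Icc (0:ℝ) 1 := ⟨le_rfl, zero_le_one⟩
  have m1 : (1:ℝ) ∈ Icc (0:ℝ) 1 := ⟨zero_le_one, le_rfl⟩
  have hmono : StrictMonoOn h (Icc 0 1) := by
    rcases hcont.strictMonoOn_of_injOn_Icc' zero_le_one hbij.injOn with H | H
    · exact H
    · exfalso
      have := H m0 m1 zero_lt_one
      have := (hbij.mapsTo m1).1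
      linarith
  have h1 : h 1 = 1 := by
    obtain ⟨x, hx, e⟩ := hbij.surjOn m1
    have := hmono.monotoneOn hx m1 hx.2
    have := (hbij.mapsTo m1).2
    linarith
  have hpos : ∀ x ∈ Ioc (0:ℝ) 1, 0 < h x := by
    intro x hx
    have := hmono m0 ⟨hx.1.le, hx.2⟩ hx.1
    rwa [h0] at this
  have t0 : tent 0 = 0 := by simp [tent]
  have g0 : g 0 = 0 := by
    have := hconj 0 m0
    rw [t0, h0] at this; exact this.symm
  obtain ⟨s, hs⟩ := aux_linear g hgpl g0 a ha (fun x hx => by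
    by_contra hc
    have := haMin x ⟨⟨hx.1, hx.2.trans ha.2⟩, hc⟩
    linarith [hx.2])
  obtain ⟨A, hA, hAa⟩ := hbij.surjOn (show a ∈ Icc (0:ℝ) 1 from ⟨ha.1.le, ha.2.le⟩)
  have hA0 : 0 < A := by
    rcases hA.1.lt_or_eq with h | h
    · exact h
    · exfalso; rw [← h, h0] at hAa; linarith [ha.1]
  have hga := (hgm (show a ∈ Icc (0:ℝ) 1 from ⟨ha.1.le, ha.2.le⟩)).2
  have hA2 : A ≤ 1 / 2 := by
    by_contra hc
    push Not at hc
    have mh : (1/2:ℝ) ∈ Icc (0:ℝ) 1 := by constructor <;> norm_num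
    have l1 := hmono mh hA hc
    have l2 := hconj _ mh
    have : tent (1/2) = 1 := by unfold tent; norm_num
    have l3 := hpos (1/2) (by constructor <;> norm_num)
    rw [this, h1, hs _ ⟨l3.le, by linarith⟩] at l2
    rw [hs a ⟨ha.1.le, le_rfl⟩] at hga
    rw [hAa] at l1
    have : 0 < s := pos_of_mul_pos_left (by rw [← l2]; norm_num) l3.le
    nlinarith
  have hhalf : ∀ y, 0 ≤ y → y ≤ 2 * A → h y = s * h (y / 2) := by
    intro y hy0 hy
    have my : y / 2 ∈ Icc (0:ℝ) 1 := ⟨by linarith, by linarith⟩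
    have e := hconj (y / 2) my
    have ht : tent (y / 2) = y := by
      unfold tent
      rw [min_eq_left (by linarith)]; ring
    have hle := hmono.monotoneOn my hA (by linarith)
    rw [ht, hs _ ⟨(hbij.mapsTo my).1, by linarith⟩] at e
    exact e
  have hYg : h (2 * A) = g a := by
    rw [hhalf _ (by linarith) le_rfl, hs a ⟨ha.1.le, le_rfl⟩, ← hAa]
    congr 2; ring
  have hs0 : s ≠ 0 := by
    rintro rfl
    have := hpos (2 * A) ⟨by linarith, by linarith⟩
    rw [hhalf _ (by linarith) le_rfl] at this
    linarith
  -- local affine behaviour of ψ_t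
  have hlocal : ∀ t : ℕ, 1 ≤ t → ∀ x0, 0 ≤ x0 → x0 < 1 → ∃ ε > 0, x0 + ε ≤ 1 ∧ ∃ c d : ℝ,
      ∀ u, 0 ≤ u → u ≤ ε → h (xi t (x0 + u)) = c * h (x0 + u) + d := by
    intro t ht x0 hx0 hx1
    have mx : x0 ∈ Icc (0:ℝ) 1 := ⟨hx0, hx1.le⟩
    have hlt : h x0 < 1 := by rw [← h1]; exact hmono mx m1 hx1
    obtain ⟨e, he, he1, c, d, hcd⟩ := aux_right_affine _ (hpl t ht) (h x0) (hbij.mapsTo mx).1 hlt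
    obtain ⟨z, hz, rfl⟩ := hbij.surjOn (show e ∈ Icc (0:ℝ) 1 from
      ⟨(hbij.mapsTo mx).1.trans he.le, he1⟩)
    have hxz : x0 < z := (hmono.lt_iff_lt mx hz).1 he
    refine ⟨z - x0, by linarith, by linarith [hz.2], c, d, fun u hu0 hu => ?_⟩
    have mu : x0 + u ∈ Icc (0:ℝ) 1 := ⟨by linarith, by linarith [hz.2]⟩
    have := hcd (h (x0 + u)) ⟨hmono.monotoneOn mx mu (by linarith),
      hmono.monotoneOn mu hz (by linarith)⟩
    simp only [hinv₁ _ mu] at this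
    exact this
  have hlin0 : ∀ k : ℕ, 1 ≤ k → ∃ ε > 0, ∃ c : ℝ,
      ∀ u, 0 ≤ u → u ≤ ε → (k : ℝ) * u < 1 → h (k * u) = c * h u := by
    intro k hk
    obtain ⟨ε, hε, -, c, d, hcd⟩ := hlocal k hk 0 le_rfl zero_lt_one
    refine ⟨ε, hε, c, fun u hu0 hu hku => ?_⟩
    have e0 := hcd 0 le_rfl hε.le
    have e1 := hcd u hu0 hu
    rw [aux_xi k (0 + 0) 0 0 (by simp) le_rfl zero_lt_one] at e0
    rw [aux_xi k (0 + u) (k * u) 0 (by simp) (by positivity) hku] at e1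
    simp only [add_zero, zero_add, h0, mul_zero] at e0 e1
    rw [e1, ← e0, add_zero]
  have hsc : ∀ k : ℕ, 1 ≤ k →
      ∃ c, 0 < c ∧ ∀ x, 0 ≤ x → (k : ℝ) * x ≤ 2 * A → h (k * x) = c * h x := by
    intro k hk
    obtain ⟨ε, hε, c, hc⟩ := hlin0 k hk
    exact ⟨c, aux_scale h (2 * A) s hpos hs0 (by linarith) hhalf k hk ε c hε hc⟩
  -- base point
  obtain ⟨t, ht⟩ := exists_nat_gt (8 / (2 * A))
  have ht0 : (0:ℝ) < t := lt_of_le_of_lt (by positivity) ht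
  have ht1 : 1 ≤ t := by exact_mod_cast ht0
  have hq0 : (0:ℝ) < 2 / t := by positivity
  have htq : (t:ℝ) * (2 / t) = 2 := by field_simp
  have hqY : 4 * (2 / (t:ℝ)) ≤ 2 * A := by
    rw [div_lt_iff₀ (by linarith)] at ht
    rw [← mul_div_assoc, div_le_iff₀ ht0]; linarith
  set q : ℝ := 2 / t with hqdef
  obtain ⟨ε, hε, hqε, c, d, hcd⟩ := hlocal t ht1 q hq0.le (by linarith)
  obtain ⟨ε', hε', c', hc'⟩ := hlin0 t ht1
  set δ := min (min ε ε') (q / 4) with hδdef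
  have hδ0 : 0 < δ := by positivity
  have d1 : δ ≤ ε := (min_le_left _ _).trans (min_le_left _ _)
  have d2 : δ ≤ ε' := (min_le_left _ _).trans (min_le_right _ _)
  have d3 : δ ≤ q / 4 := min_le_right _ _
  have hdd : c * h q + d = 0 := by
    have := hcd 0 le_rfl hε.le
    rw [aux_xi t (q + 0) 0 1 (by rw [add_zero, htq]; norm_num) le_rfl zero_lt_one, h0, add_zero]
      at this
    exact this.symm
  have main : ∀ u, 0 ≤ u → u ≤ δ → h (t * u) = c * (h (q + u) - h q) ∧ h (t * u) = c' * h u := by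
    intro u hu0 hu
    have htu : (t:ℝ) * u < 1 := by
      calc (t:ℝ) * u ≤ t * (q / 4) := by gcongr; linarith
        _ < 1 := by rw [← mul_div_assoc, htq]; norm_num
    refine ⟨?_, hc' u hu0 (by linarith) htu⟩
    have := hcd u hu0 (by linarith)
    rw [aux_xi t (q + u) (t * u) 1 (by rw [mul_add, htq]; norm_num) (by positivity) htu] at this
    rw [this]; linarith
  have htδ : 0 < h (t * δ) := by
    apply hpos
    refine ⟨by positivity, ?_⟩
    calc (t:ℝ) * δ ≤ t * (q / 4) := by gcongr
      _ ≤ 1 := by rw [← mul_div_assoc, htq]; norm_num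
  have hc0 : c ≠ 0 := by
    rintro rfl
    have := (main δ hδ0.le le_rfl).1
    linarith
  have hc'0 : c' ≠ 0 := by
    rintro rfl
    have := (main δ hδ0.le le_rfl).2
    linarith
  have hlin : ∀ (k : ℕ) (x : ℝ), 0 ≤ x → (k : ℝ) * x ≤ 2 * A → h (k * x) = k * h x := by
    intro k x hx hkx
    refine aux_core h (2 * A) hpos (by linarith) hsc q δ (c' / c) hq0 hqY hδ0 (by linarith)
      (div_ne_zero hc'0 hc0) (fun u hu0 hu => ?_) k x h0 hx hkx
    obtain ⟨e1, e2⟩ := main u hu0 hu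
    rw [e1] at e2
    field_simp
    linarith
  -- the constant
  obtain ⟨N, hN⟩ := exists_pow_lt_of_lt_one (show (0:ℝ) < 2 * A by linarith)
    (show (1/2:ℝ) < 1 by norm_num)
  refine ⟨2 ^ N * h (1 / 2 ^ N), fun n hn k hk hle => ?_⟩
  obtain ⟨n, rfl⟩ : ∃ m, n = m + 1 := ⟨n - 1, by omega⟩
  simp only [Nat.add_sub_cancel] at hk ⊢
  rw [aux_mu g h hh hmono μ hμ n k hk] at hle ⊢
  have hkr : (k:ℝ) ≤ 2 ^ n := by exact_mod_cast hk
  have mk : (k : ℝ) / 2 ^ n ∈ Icc (0:ℝ) 1 :=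
    ⟨by positivity, by rw [div_le_one (by positivity)]; exact hkr⟩
  rw [← hYg] at hle
  have hkY : (k : ℝ) / 2 ^ n ≤ 2 * A :=
    (hmono.le_iff_le mk ⟨by linarith, by linarith⟩).1 hle
  -- compare both with `1 / (2^N * 2^n)`
  have p1 := hlin (2 ^ n) (1 / (2 ^ N * 2 ^ n)) (by positivity) (by
    push_cast
    have : (2:ℝ) ^ n * (1 / (2 ^ N * 2 ^ n)) = (1/2) ^ N := by
      rw [div_pow, one_pow]; field_simp
    rw [this]; exact hN.le)
  have w2 : ((k * 2 ^ N : ℕ) : ℝ) * (1 / (2 ^ N * 2 ^ n)) = k / 2 ^ n := by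
    push_cast; field_simp
  have p2 := hlin (k * 2 ^ N) (1 / (2 ^ N * 2 ^ n)) (by positivity) (by rw [w2]; exact hkY)
  have w1 : ((2 ^ n : ℕ) : ℝ) * (1 / (2 ^ N * 2 ^ n)) = 1 / 2 ^ N := by
    push_cast; field_simp
  rw [w1] at p1
  rw [w2] at p2
  rw [p2, p1]
  push_cast
  field_simp
end
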